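/- Let Λ be the Leech lattice and let φ ∈ O(Λ) be an isometry of order 3. Then the coinvariant lattice S_φ(Λ) has rank 12, 16, 18, or 24. Moreover, if the rank is 16 then S_φ(Λ) is isometric to S_{3.exo}, and if the rank is 24 then S_φ(Λ) = Λ. -/

import Mathlib

open Matrix Module

/-- The orthogonal complement of a submodule with respect to a bilinear form. -/
def orthSub {M : Type*} [AddCommGroup M] (b : M →ₗ[ℤ] M →ₗ[ℤ] ℤ)
    (T : Submodule ℤ M) : Submodule ℤ M where
  carrier := {x | ∀ y ∈ T, b x y = 0}
  add_mem' := by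
    intro a c ha hc y hy
    simp only [Set.mem_setOf_eq] at *
    rw [map_add, LinearMap.add_apply, ha y hy, hc y hy, add_zero]
  zero_mem' := by intro y hy; simp
  smul_mem' := by
    intro k x hx y hy
    simp only [Set.mem_setOf_eq] at hx
    rw [_root_.map_smul, LinearMap.smul_apply, hx y hy, smul_zero]

/-- The invariant lattice `T_φ` of an isometry. -/
def fixSub {M : Type*} [AddCommGroup M] (φ : M ≃ₗ[ℤ] M) : Submodule ℤ M :=
  LinearMap.ker (φ.toLinearMap - LinearMap.id)

/-- The E8 Cartan matrix (Bourbaki numbering). -/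
def E8M : Matrix (Fin 8) (Fin 8) ℤ :=
  !![2,0,-1,0,0,0,0,0;
     0,2,0,-1,0,0,0,0;
     -1,0,2,-1,0,0,0,0;
     0,-1,-1,2,-1,0,0,0;
     0,0,0,-1,2,-1,0,0;
     0,0,0,0,-1,2,-1,0;
     0,0,0,0,0,-1,2,-1;
     0,0,0,0,0,0,-1,2]

/-- The underlying module of `E8(-1)^3`. -/
abbrev E83 : Type := Fin 3 → Fin 8 → ℤ

/-- The bilinear form of `E8(-1)^3`. -/
def bE83 (x y : E83) : ℤ := -∑ j : Fin 3, (x j) ⬝ᵥ (E8M *ᵥ (y j))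

/-- The cyclic permutation `σ(x, y, z) = (z, x, y)` of the three factors of
`E8(-1)^3`. -/
def sigma3 : E83 ≃ₗ[ℤ] E83 where
  toFun x := fun j => x (j - 1)
  invFun x := fun j => x (j + 1)
  map_add' := fun _ _ => rfl
  map_smul' := fun _ _ => rfl
  left_inv := by intro x; funext j; simp
  right_inv := by intro x; funext j; simp

/-- The lattice `S_{3.exo} = {a - σ(a) : a ∈ E8(-1)^3}`. -/
def S3exo : Submodule ℤ E83 :=
  LinearMap.range (LinearMap.id - sigma3.toLinearMap)

section PartA
open Real Complex

lemma pa_1d {A : ℝ} (hA : 0 < A) (a z : ℝ) :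
    ∑' n : ℤ, cexp ((-π * A * (n + a)^2 : ℝ) + 2 * π * I * (z * n : ℝ)) =
      ((1 / √A : ℝ) : ℂ) * ∑' k : ℤ, cexp ((-π / A * (k - z)^2 : ℝ) + 2 * π * I * ((k - z) * a : ℝ)) := by
  have h := Complex.tsum_exp_neg_quadratic (a := (A : ℂ)) (by simpa using hA) (-A * a + I * z)
  have hA' : (A : ℂ) ≠ 0 := by exact_mod_cast hA.ne'
  have e1 : ∀ n : ℤ, cexp ((-π * A * (n + a)^2 : ℝ) + 2 * π * I * (z * n : ℝ))
      = cexp (-π * A * a ^ 2) * cexp (-π * A * n ^ 2 + 2 * π * (-A * a + I * z) * n) := by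
    intro n
    rw [← Complex.exp_add]; congr 1; push_cast; ring
  have e2 : ∀ k : ℤ, cexp ((-π / A * (k - z)^2 : ℝ) + 2 * π * I * ((k - z) * a : ℝ))
      = cexp (-π * A * a ^ 2) * cexp (-π / A * (k + I * (-A * a + I * z)) ^ 2) := by
    intro k
    rw [← Complex.exp_add]; congr 1; push_cast
    field_simp
    ring_nf
    simp only [Complex.I_sq, Complex.I_pow_four, Complex.I_pow_three]
    ring
  have e3 : ((1 / √A : ℝ) : ℂ) = 1 / (A : ℂ) ^ (1 / 2 : ℂ) := by
    rw [Real.sqrt_eq_rpow]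
    push_cast
    rw [Complex.ofReal_cpow hA.le]; norm_num
  simp_rw [e1, e2]
  rw [tsum_mul_left, tsum_mul_left, h, e3]
  ring

lemma pa_1d_summable {A : ℝ} (hA : 0 < A) (a : ℝ) :
    Summable fun n : ℤ => Real.exp (-π * A * (n + a)^2) := by
  have h := (summable_jacobiTheta₂_term_iff (I * (A * a)) (I * A)).2 (by simpa using hA)
  have h2 := h.norm.mul_left (Real.exp (-π * A * a ^ 2))
  refine h2.congr fun n => ?_
  rw [norm_jacobiTheta₂_term, ← Real.exp_add]
  congr 1
  simp
  ring

lemma pa_1d_bound {A : ℝ} (hA : 0 < A) : ∃ C : ℝ, ∀ a : ℝ,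
    ∑' n : ℤ, Real.exp (-π * A * (n + a)^2) ≤ C := by
  refine ⟨(1 / √A) * ∑' k : ℤ, Real.exp (-π * A⁻¹ * (k + 0)^2), fun a => ?_⟩
  have h := pa_1d hA a 0
  have h1 : ((∑' n : ℤ, Real.exp (-π * A * (n + a)^2) : ℝ) : ℂ) =
      ∑' n : ℤ, cexp ((-π * A * (n + a)^2 : ℝ) + 2 * π * I * ((0:ℝ) * n : ℝ)) := by
    rw [Complex.ofReal_tsum]; congr 1; ext n; simp
  rw [h] at h1
  have h2 := congrArg norm h1
  rw [Complex.norm_real, norm_mul, Complex.norm_real, Real.norm_of_nonneg (tsum_nonneg fun _ => (Real.exp_pos _).le),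
    Real.norm_of_nonneg (by positivity)] at h2
  rw [h2]
  refine mul_le_mul_of_nonneg_left ?_ (by positivity)
  have hs := pa_1d_summable (inv_pos.2 hA) 0
  have hn : ∀ k : ℤ, ‖cexp ((-π / A * (k - (0:ℝ))^2 : ℝ) + 2 * π * I * ((k - (0:ℝ)) * a : ℝ))‖ =
      Real.exp (-π * A⁻¹ * (k + 0)^2) := by
    intro k
    rw [Complex.norm_exp]; congr 1
    simp; ring_nf; simp [← Complex.ofReal_intCast, ← Complex.ofReal_pow,← Complex.ofReal_inv, ← Complex.ofReal_mul]
  refine (norm_tsum_le_tsum_norm ?_).trans ?_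
  · simp_rw [hn]; exact hs
  · simp_rw [hn]; exact le_rfl

structure PP (n : ℕ) (Q Qs : (Fin n → ℝ) → ℝ) (c : ℝ) : Prop where
  cpos : 0 < c
  s1 : ∀ t > 0, Summable fun x : Fin n → ℤ => Real.exp (-π * t * Q (fun i => x i))
  s2 : ∀ t > 0, ∀ z : Fin n → ℝ, Summable fun k : Fin n → ℤ => Real.exp (-π / t * Qs (fun i => k i - z i))
  eq : ∀ t > 0, ∀ z : Fin n → ℝ,
    ∑' x : Fin n → ℤ, cexp ((-π * t * Q (fun i => x i) : ℝ) + 2 * π * I * (∑ i, z i * x i : ℝ)) =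
    ((c * (1 / √t) ^ n : ℝ) : ℂ) * ((∑' k : Fin n → ℤ, Real.exp (-π / t * Qs (fun i => k i - z i)) : ℝ) : ℂ)

lemma PP.bound {n Q Qs c} (h : PP n Q Qs c) (t : ℝ) (ht : 0 < t) : ∃ C : ℝ, ∀ z : Fin n → ℝ,
    ∑' k : Fin n → ℤ, Real.exp (-π / t * Qs (fun i => k i - z i)) ≤ C := by
  have hc : 0 < c * (1 / √t) ^ n := by have := h.cpos; positivity
  refine ⟨(∑' x : Fin n → ℤ, Real.exp (-π * t * Q (fun i => x i))) / (c * (1 / √t) ^ n), fun z => ?_⟩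
  rw [le_div_iff₀ hc, mul_comm]
  have h2 := congrArg norm (h.eq t ht z)
  rw [norm_mul, Complex.norm_real, Complex.norm_real, Real.norm_of_nonneg hc.le,
    Real.norm_of_nonneg (tsum_nonneg fun _ => (Real.exp_pos _).le)] at h2
  rw [← h2]
  have hn : ∀ x : Fin n → ℤ, ‖cexp ((-π * t * Q (fun i => x i) : ℝ) + 2 * π * I * (∑ i, z i * x i : ℝ))‖
      = Real.exp (-π * t * Q (fun i => x i)) := by
    intro x
    rw [Complex.norm_exp]; congr 1
    simp
  refine (norm_tsum_le_tsum_norm ?_).trans ?_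
  · simp_rw [hn]; exact h.s1 t ht
  · simp_rw [hn]; exact le_rfl

lemma PP.zero : PP 0 (fun _ => 0) (fun _ => 0) 1 where
  cpos := one_pos
  s1 t ht := by exact Summable.of_finite
  s2 t ht z := by exact Summable.of_finite
  eq t ht z := by simp

end PartA

section PartA
open Real Complex

lemma pa_norm (u v : ℝ) : ‖cexp ((u : ℂ) + 2 * π * I * (v : ℂ))‖ = Real.exp u := by
  rw [Complex.norm_exp]; congr 1; simp

set_option maxHeartbeats 1000000 in
lemma PP.step {n : ℕ} {Q Qs : (Fin n → ℝ) → ℝ} {c : ℝ} (h : PP n Q Qs c) (d : ℝ) (hd : 0 < d)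
    (l : Fin n → ℝ) :
    PP (n+1) (fun x => d * (x 0 + ∑ j, l j * x j.succ) ^ 2 + Q (fun j => x j.succ))
      (fun k => k 0 ^ 2 / d + Qs (fun j => k j.succ - k 0 * l j)) (c / √d) := by
  let e := Fin.consEquiv (fun _ : Fin (n+1) => ℤ)
  have s1 : ∀ t > 0, Summable fun p : (Fin n → ℤ) × ℤ =>
      Real.exp (-π * (t * d) * (p.2 + ∑ j, l j * p.1 j) ^ 2) * Real.exp (-π * t * Q (fun j => p.1 j)) := by
    intro t ht
    obtain ⟨C, hC⟩ := pa_1d_bound (mul_pos ht hd)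
    rw [summable_prod_of_nonneg (fun p => by positivity)]
    refine ⟨fun x => (pa_1d_summable (mul_pos ht hd) (∑ j, l j * (x j : ℝ))).mul_right (Real.exp (-π * t * Q (fun j => x j))), ?_⟩
    refine Summable.of_nonneg_of_le (fun x => tsum_nonneg fun _ => by positivity) (fun x => ?_)
      ((h.s1 t ht).mul_left C)
    simp only
    rw [tsum_mul_right]
    exact mul_le_mul_of_nonneg_right (hC _) (Real.exp_pos _).le
  have s2 : ∀ t > 0, ∀ z : Fin (n+1) → ℝ, Summable fun p : ℤ × (Fin n → ℤ) =>
      Real.exp (-π * (t * d)⁻¹ * (p.1 + -z 0) ^ 2) *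
        Real.exp (-π / t * Qs (fun j => p.2 j - (z j.succ + (p.1 - z 0) * l j))) := by
    intro t ht z
    obtain ⟨C, hC⟩ := h.bound t ht
    rw [summable_prod_of_nonneg (fun p => by positivity)]
    refine ⟨fun x => (h.s2 t ht (fun j => z j.succ + (x - z 0) * l j)).mul_left (Real.exp (-π * (t * d)⁻¹ * (x + -z 0) ^ 2)), ?_⟩
    refine Summable.of_nonneg_of_le (fun x => tsum_nonneg fun _ => by positivity) (fun x => ?_)
      ((pa_1d_summable (inv_pos.2 (mul_pos ht hd)) (-z 0)).mul_right C)
    simp only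
    rw [tsum_mul_left]
    exact mul_le_mul_of_nonneg_left (hC _) (Real.exp_pos _).le
  have s2' : ∀ t > 0, ∀ z : Fin (n+1) → ℝ, ∀ p : ℤ × (Fin n → ℤ), 
     Real.exp (-π / t * ((fun k : Fin (n+1) → ℝ => k 0 ^ 2 / d + Qs (fun j => k j.succ - k 0 * l j)) 
       (fun i => (e p i) - z i))) = Real.exp (-π * (t * d)⁻¹ * (p.1 + -z 0) ^ 2) *
        Real.exp (-π / t * Qs (fun j => p.2 j - (z j.succ + (p.1 - z 0) * l j))) := by
    intro t ht z p
    rw [← Real.exp_add]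
    congr 1
    simp only [e, Fin.consEquiv_apply, Fin.cons_zero, Fin.cons_succ]
    rw [mul_add]
    congr 1
    · field_simp; ring
    · congr 2; ext j; ring
  refine ⟨div_pos h.cpos (Real.sqrt_pos.2 hd), fun t ht => ?_, fun t ht z => ?_, fun t ht z => ?_⟩
  · rw [← e.summable_iff, ← (Equiv.prodComm _ _).summable_iff]
    refine (s1 t ht).congr fun p => ?_
    rw [← Real.exp_add]
    congr 1
    simp [e, Fin.consEquiv_apply]
    ring
  · rw [← e.summable_iff]
    exact (s2 t ht z).congr fun p => (s2' t ht z p).symm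
  · have htd := mul_pos ht hd
    let G : (Fin n → ℤ) → ℤ → ℂ := fun x k =>
      cexp ((-π / (t*d) * (k - z 0)^2 : ℝ) + 2 * π * I * ((k - z 0) * (∑ j, l j * x j) : ℝ)) *
      cexp ((-π * t * Q (fun i => x i) : ℝ) + 2 * π * I * (∑ i : Fin n, z i.succ * x i : ℝ))
    have hG : Summable (Function.uncurry G) := by
      apply Summable.of_norm
      have := (Summable.mul_of_nonneg (h.s1 t ht) (pa_1d_summable (inv_pos.2 htd) (-z 0))
        (fun _ => (Real.exp_pos _).le) (fun _ => (Real.exp_pos _).le))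
      refine this.congr fun p => ?_
      simp only [Function.uncurry, G]
      rw [norm_mul, pa_norm, pa_norm, mul_comm]
      rw [← div_eq_mul_inv, sub_eq_add_neg]
    have L1 : ∑' x : Fin (n+1) → ℤ, cexp ((-π * t * (d * ((x 0:ℝ) + ∑ j : Fin n, l j * x j.succ) ^ 2 + Q (fun j : Fin n => x j.succ)) : ℝ) + 2 * π * I * (∑ i, z i * x i : ℝ))
      = ∑' x : Fin n → ℤ, ((1 / √(t * d) : ℝ) : ℂ) * ∑' k, G x k := by
      rw [← e.tsum_eq, ← (Equiv.prodComm _ _).tsum_eq]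
      have hT : ∀ p : (Fin n → ℤ) × ℤ, 
        cexp ((-π * t * (d * ((e (Equiv.prodComm _ _ p) 0:ℝ) + ∑ j : Fin n, l j * (e (Equiv.prodComm _ _ p)) j.succ) ^ 2 + Q (fun j : Fin n => (e (Equiv.prodComm _ _ p)) j.succ)) : ℝ) + 2 * π * I * (∑ i, z i * (e (Equiv.prodComm _ _ p)) i : ℝ)) =
        cexp ((-π * (t * d) * (p.2 + ∑ j, l j * p.1 j) ^ 2 : ℝ) + 2 * π * I * (z 0 * p.2 : ℝ)) *
        cexp ((-π * t * Q (fun i => p.1 i) : ℝ) + 2 * π * I * (∑ i : Fin n, z i.succ * p.1 i : ℝ)) := by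
        intro p
        rw [← Complex.exp_add]; congr 1
        simp only [e, Fin.consEquiv_apply, Fin.cons_zero, Fin.cons_succ, Equiv.prodComm_apply, Prod.fst_swap, Prod.snd_swap, Fin.sum_univ_succ (fun i => z i * _)]
        push_cast
        ring
      simp_rw [hT]
      have hs : Summable fun p : (Fin n → ℤ) × ℤ => cexp ((-π * (t * d) * (p.2 + ∑ j, l j * p.1 j) ^ 2 : ℝ) + 2 * π * I * (z 0 * p.2 : ℝ)) *
        cexp ((-π * t * Q (fun i => p.1 i) : ℝ) + 2 * π * I * (∑ i : Fin n, z i.succ * p.1 i : ℝ)) := by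
        apply Summable.of_norm
        refine (s1 t ht).congr fun p => ?_
        rw [norm_mul, pa_norm, pa_norm]
      rw [hs.tsum_prod]
      congr 1; ext x
      simp only [G]
      rw [tsum_mul_right, tsum_mul_right, pa_1d htd]
      ring
    have R1 : ∑' k : Fin (n+1) → ℤ, Real.exp (-π / t * (((k 0 : ℝ) - z 0) ^ 2 / d + Qs (fun j => (k j.succ - z j.succ) - (k 0 - z 0) * l j)))
       = ∑' k : ℤ, Real.exp (-π * (t * d)⁻¹ * (k + -z 0) ^ 2) * ∑' x : Fin n → ℤ,
        Real.exp (-π / t * Qs (fun j => x j - (z j.succ + (k - z 0) * l j))) := by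
      rw [← e.tsum_eq]
      have := s2' t ht z
      simp only at this
      simp_rw [this]
      rw [(s2 t ht z).tsum_prod]
      simp_rw [tsum_mul_left]
    simp only
    rw [L1, R1, tsum_mul_left, ← hG.tsum_comm, Complex.ofReal_tsum, ← tsum_mul_left, ← tsum_mul_left]
    congr 1; ext k
    have := h.eq t ht (fun j => z j.succ + (k - z 0) * l j)
    have hk : ∑' x, G x k = ((Real.exp (-π * (t * d)⁻¹ * (k + -z 0) ^ 2) : ℝ) : ℂ) *
       ∑' x : Fin n → ℤ, cexp ((-π * t * Q (fun i => x i) : ℝ) + 2 * π * I * (∑ i, (z i.succ + (k - z 0) * l i) * x i : ℝ)) := by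
      rw [← tsum_mul_left]; congr 1; ext x
      simp only [G]
      rw [Complex.ofReal_exp, ← Complex.exp_add, ← Complex.exp_add]; congr 1
      have : ∑ i, (z i.succ + (k - z 0) * l i) * x i = ∑ i : Fin n, z i.succ * x i + (k - z 0) * ∑ j, l j * x j := by
        rw [Finset.mul_sum, ← Finset.sum_add_distrib]; congr 1; ext i; ring
      rw [this]; push_cast
      rw [← sub_eq_add_neg, div_eq_mul_inv]
      ring
    rw [hk, this]
    push_cast
    rw [Real.sqrt_mul ht.le, pow_succ _ n]
    have h1 : ((√t : ℝ) : ℂ) ≠ 0 := by exact_mod_cast (Real.sqrt_pos.2 ht).ne'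
    have h2 : ((√d : ℝ) : ℂ) ≠ 0 := by exact_mod_cast (Real.sqrt_pos.2 hd).ne'
    push_cast
    generalize ((1 : ℂ) / ((√t : ℝ) : ℂ)) ^ n = X
    field_simp

lemma PP.exists_of (n : ℕ) : ∀ A : Fin n → Fin n → ℝ, (∀ i j, A i j = A j i) →
    (∀ i j, ∃ q : ℚ, A i j = q) →
    (∀ x : Fin n → ℚ, x ≠ 0 → 0 < ∑ i, ∑ j, (x i : ℝ) * A i j * x j) →
    ∃ Qs c, PP n (fun x => ∑ i, ∑ j, x i * A i j * x j) Qs c ∧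
      ∀ x : Fin n → ℝ, Qs (fun i => ∑ j, A i j * x j) = ∑ i, ∑ j, x i * A i j * x j := by
  induction n with
  | zero => 
    intro A _ _ _
    refine ⟨fun _ => 0, 1, ?_, fun x => by simp⟩
    convert PP.zero using 2
    simp
  | succ n ih =>
    intro A hs hq hp
    have hd : 0 < A 0 0 := by
      have := hp (Pi.single 0 1) (by simp)
      simpa [Fin.sum_univ_succ, Pi.single_apply] using this
    set d := A 0 0 with hdd
    let l : Fin n → ℝ := fun j => A 0 j.succ / d
    let A' : Fin n → Fin n → ℝ := fun i j => A i.succ j.succ - d * l i * l j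
    have key : ∀ x : Fin (n+1) → ℝ, ∑ i, ∑ j, x i * A i j * x j =
        d * (x 0 + ∑ j, l j * x j.succ) ^ 2 + ∑ i, ∑ j, x (Fin.succ i) * A' i j * x (Fin.succ j) := by
      intro x
      have hl : ∀ j : Fin n, A 0 j.succ = d * l j := fun j => by simp only [l]; field_simp
      have hl' : ∀ j : Fin n, A j.succ 0 = d * l j := fun j => by rw [hs]; exact hl j
      simp only [Fin.sum_univ_succ, hl, hl', ← hdd, A', mul_sub, sub_mul, Finset.sum_sub_distrib, Finset.sum_add_distrib]
      have e1 : ∑ i : Fin n, ∑ j : Fin n, x i.succ * (d * l i * l j) * x j.succ = d * (∑ j, l j * x j.succ)^2 := by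
        rw [sq, Finset.sum_mul_sum, Finset.mul_sum]; congr 1; ext i
        rw [Finset.mul_sum]; congr 1; ext j; ring
      have e2 : ∑ j : Fin n, x 0 * (d * l j) * x j.succ = d * x 0 * ∑ j, l j * x j.succ := by
        rw [Finset.mul_sum]; congr 1; ext i; ring
      have e3 : ∑ j : Fin n, x j.succ * (d * l j) * x 0 = d * x 0 * ∑ j, l j * x j.succ := by
        rw [Finset.mul_sum]; congr 1; ext i; ring
      rw [e1, e2, e3]; ring
    choose q hq using hq
    obtain ⟨Qs, c, h1, h2⟩ := ih A' (fun i j => by simp only [A']; rw [hs i.succ]; ring) (fun i j => 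
      ⟨q i.succ j.succ - q 0 0 * (q 0 i.succ / q 0 0) * (q 0 j.succ / q 0 0), by
        simp only [A', l, hdd, hq]; push_cast; rfl⟩) (by
      intro x hx
      have := hp (Fin.cons (-∑ j, q 0 j.succ / q 0 0 * x j) x) (by
        intro h0; apply hx; ext i
        have := congrFun h0 i.succ
        simpa using this)
      rw [key (fun i => ((Fin.cons (-∑ j, q 0 j.succ / q 0 0 * x j) x : Fin (n+1) → ℚ) i : ℝ))] at this
      have h0 : (((Fin.cons (-∑ j, q 0 j.succ / q 0 0 * x j) x : Fin (n+1) → ℚ) 0 : ℚ) : ℝ) = -∑ j, l j * x j := by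
        simp [l, hdd, hq]
      simp only [h0] at this
      simpa using this)
    refine ⟨(fun k => k 0 ^ 2 / d + Qs (fun j => k j.succ - k 0 * l j)), c / √d, ?_, ?_⟩
    · have := h1.step d hd l
      convert this using 2
      exact key _
    · intro x
      rw [key, ← h2]
      have hk0 : ∑ j, A 0 j * x j = d * (x 0 + ∑ j, l j * x j.succ) := by
        rw [Fin.sum_univ_succ, mul_add, Finset.mul_sum, ← hdd]; congr 2; ext j; simp only [l]; field_simp
      simp only [hk0]
      congr 1
      · field_simp
      · congr 1; ext i
        rw [Fin.sum_univ_succ]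
        simp only [A', sub_mul, Finset.sum_sub_distrib]
        have : A i.succ 0 = d * l i := by rw [hs]; simp only [l]; field_simp
        rw [this]
        have e4 : ∑ j : Fin n, d * l i * l j * x j.succ = d * l i * ∑ j, l j * x j.succ := by
          rw [Finset.mul_sum]; congr 1; ext i; ring
        rw [e4]; ring
end PartA

structure LL (Λ : Type*) [AddCommGroup Λ] [Module.Free ℤ Λ] [Module.Finite ℤ Λ]
    (B : Λ →ₗ[ℤ] Λ →ₗ[ℤ] ℤ) : Prop where
  symm : ∀ x y : Λ, B x y = B y x
  even : ∀ x : Λ, Even (B x x)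
  pos : ∀ x : Λ, x ≠ 0 → 0 < B x x
  rank : finrank ℤ Λ = 24
  bij : Function.Bijective B
  noroot : ∀ x : Λ, B x x ≠ 2

section PartA
open Real Complex

variable {Λ : Type*} [AddCommGroup Λ] [Module.Free ℤ Λ] [Module.Finite ℤ Λ]
    {B : Λ →ₗ[ℤ] Λ →ₗ[ℤ] ℤ}

lemma LL.poisson (h : LL Λ B) :
    (∀ t > 0, ∀ (r : ℝ) (a : Λ), Summable fun x : Λ => 
      Real.exp (-π * t * (B x x - 2 * r * B x a + r ^ 2 * B a a))) ∧
    (∀ t > 0, ∀ (r : ℝ) (a : Λ), 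
      ∑' x : Λ, cexp ((-π * t * B x x : ℝ) + 2 * π * I * (r * B x a : ℝ)) = 
       (((1 / √t) ^ 24 : ℝ) : ℂ) * ((∑' x : Λ, 
         Real.exp (-π / t * (B x x - 2 * r * B x a + r ^ 2 * B a a)) : ℝ) : ℂ)) := by
  classical
  let b : Basis (Fin 24) ℤ Λ := finBasisOfFinrankEq ℤ Λ h.rank
  let A : Fin 24 → Fin 24 → ℝ := fun i j => B (b i) (b j)
  have hQ : ∀ x : Fin 24 → ℤ, (B (∑ i, x i • b i) (∑ i, x i • b i) : ℤ) = ∑ i, ∑ j, x i * B (b i) (b j) * x j := by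
    intro x
    simp only [map_sum, LinearMap.sum_apply, map_smul, LinearMap.smul_apply, smul_eq_mul]
    simp only [Finset.mul_sum]
    rw [Finset.sum_comm]
    refine Finset.sum_congr rfl fun i _ => Finset.sum_congr rfl fun j _ => by ring
  obtain ⟨Qs, c, hP, hd⟩ := PP.exists_of 24 A (fun i j => by simp only [A]; rw [h.symm])
    (fun i j => ⟨B (b i) (b j), by simp [A]⟩) (by
      intro x hx
      obtain ⟨⟨D, hD⟩, hD'⟩ := IsLocalization.exist_integer_multiples_of_finite (nonZeroDivisors ℤ) x
      choose y hy using hD'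
      have hy' : ∀ i, (y i : ℝ) = D * x i := by
        intro i
        have := hy i
        simp at this
        exact_mod_cast this
      have hD0 : D ≠ 0 := nonZeroDivisors.ne_zero hD
      have hyne : ∑ i, y i • b i ≠ 0 := by
        intro h0
        apply hx
        ext i
        have h1 : ∀ i, y i = 0 := Fintype.linearIndependent_iff.1 b.linearIndependent y h0
        have := hy' i
        rw [h1 i] at this
        simp [hD0] at this
        exact this
      have h1 := h.pos _ hyne
      rw [hQ] at h1
      have h2 : (0:ℝ) < ∑ i, ∑ j, (y i : ℝ) * A i j * y j := by simp only [A]; exact_mod_cast h1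
      have h3 : ∑ i, ∑ j, (y i : ℝ) * A i j * y j = D ^ 2 * ∑ i, ∑ j, (x i : ℝ) * A i j * x j := by
        rw [Finset.mul_sum]; refine Finset.sum_congr rfl fun i _ => ?_
        rw [Finset.mul_sum]; refine Finset.sum_congr rfl fun j _ => ?_
        rw [hy', hy']; ring
      rw [h3] at h2
      exact pos_of_mul_pos_right h2 (by positivity))
  -- equivalences
  let e1 : (Fin 24 → ℤ) ≃ Λ := b.equivFun.symm.toEquiv
  have he1 : ∀ x, e1 x = ∑ i, x i • b i := fun x => by simp [e1, Basis.equivFun_symm_apply]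
  let e2 : Λ ≃ (Fin 24 → ℤ) := (Equiv.ofBijective B h.bij).trans (b.constr ℤ).symm.toEquiv
  have he2 : ∀ y i, e2 y i = B (b i) y := fun y i => by 
    simp [e2, Basis.constr_symm_apply] <;> rw [h.symm]
  have hsum : ∀ y : Λ, ∀ i, (B (b i) y : ℝ) = ∑ j, A i j * (b.repr y j : ℝ) := by
    intro y i
    conv_lhs => rw [← b.sum_repr y]
    simp only [map_sum, map_smul, smul_eq_mul]
    push_cast
    refine Finset.sum_congr rfl fun j _ => by simp only [A]; ring
  have hQs : ∀ (y a : Λ) (r : ℝ), Qs (fun i => (e2 y i : ℝ) - r * B (b i) a) = 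
      B y y - 2 * r * B y a + r ^ 2 * B a a := by
    intro y a r
    have h1 : (fun i => (e2 y i : ℝ) - r * B (b i) a) = fun i => ∑ j, A i j * ((b.repr y j : ℝ) - r * b.repr a j) := by
      ext i
      rw [he2, hsum, hsum]
      simp only [mul_sub, Finset.sum_sub_distrib, Finset.mul_sum]
      congr 1
      refine Finset.sum_congr rfl fun j _ => by ring
    rw [h1, hd]
    have h2 : ∀ u v : Λ, (B u v : ℝ) = ∑ i, ∑ j, (b.repr u i : ℝ) * A i j * (b.repr v j : ℝ) := by
      intro u v
      conv_lhs => rw [← b.sum_repr u]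
      simp only [map_sum, LinearMap.sum_apply, map_smul, LinearMap.smul_apply, smul_eq_mul]
      push_cast
      refine Finset.sum_congr rfl fun i _ => ?_
      rw [hsum, Finset.mul_sum]
      refine Finset.sum_congr rfl fun j _ => by ring
    have h3 : (B y y - 2 * r * B y a + r ^ 2 * B a a : ℝ) = B y y - r * B y a - r * B a y + r ^ 2 * B a a := by
      rw [h.symm a y]; ring
    rw [h3, h2, h2, h2, h2]
    simp only [Finset.mul_sum, ← Finset.sum_sub_distrib, ← Finset.sum_add_distrib]
    refine Finset.sum_congr rfl fun i _ => Finset.sum_congr rfl fun j _ => by ring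
  have S : (∀ t > 0, ∀ (r : ℝ) (a : Λ), Summable fun x : Λ => 
      Real.exp (-π / t * (B x x - 2 * r * B x a + r ^ 2 * B a a))) := by
    intro t ht r a
    have := hP.s2 t ht (fun i => r * B (b i) a)
    rw [← e2.summable_iff] at this
    refine this.congr fun x => ?_
    simp only [Function.comp]
    rw [hQs]
  have E : (∀ t > 0, ∀ (r : ℝ) (a : Λ), 
      ∑' x : Λ, cexp ((-π * t * B x x : ℝ) + 2 * π * I * (r * B x a : ℝ)) = 
       ((c * (1 / √t) ^ 24 : ℝ) : ℂ) * ((∑' x : Λ, 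
         Real.exp (-π / t * (B x x - 2 * r * B x a + r ^ 2 * B a a)) : ℝ) : ℂ)) := by
    intro t ht r a
    have := hP.eq t ht (fun i => r * B (b i) a)
    rw [← e2.tsum_eq (fun k => Real.exp (-π / t * Qs fun i => (k i : ℝ) - r * B (b i) a))] at this
    simp_rw [hQs] at this
    rw [← this, ← e1.tsum_eq]
    congr 1; ext x
    rw [he1, hQ]
    congr 2
    · push_cast; rfl
    · simp only [map_sum, LinearMap.sum_apply, map_smul, LinearMap.smul_apply, smul_eq_mul]
      push_cast
      rw [Finset.mul_sum]
      congr 1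
      refine Finset.sum_congr rfl fun i _ => by ring
  have hc : c = 1 := by
    have h1 := E 1 one_pos 0 0
    have h2 : 0 < ∑' x : Λ, Real.exp (-π / 1 * (B x x - 2 * 0 * B x 0 + 0 ^ 2 * B 0 0)) :=
      (S 1 one_pos 0 0).tsum_pos (fun _ => (Real.exp_pos _).le) 0 (Real.exp_pos _)
    have h3 : ∑' x : Λ, cexp ((-π * 1 * B x x : ℝ) + 2 * π * I * ((0:ℝ) * B x 0 : ℝ)) = ((∑' x : Λ, Real.exp (-π / 1 * (B x x - 2 * 0 * B x 0 + 0 ^ 2 * B 0 0)) : ℝ) : ℂ) := by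
      rw [Complex.ofReal_tsum]; congr 1; ext x; simp
    rw [h3, ← Complex.ofReal_mul, Complex.ofReal_inj] at h1
    simp at h1 h2
    exact (mul_eq_right₀ h2.ne').1 h1.symm
  subst hc
  refine ⟨fun t ht r a => ?_, fun t ht r a => ?_⟩
  · have := S t⁻¹ (inv_pos.2 ht) r a
    simpa using this
  · rw [E t ht r a, one_mul]
end PartA

section PartB
open Real Complex MatrixGroups ModularForm
open UpperHalfPlane hiding I

variable {Λ : Type*} [AddCommGroup Λ] [Module.Free ℤ Λ] [Module.Finite ℤ Λ]
    {B : Λ →ₗ[ℤ] Λ →ₗ[ℤ] ℤ}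

lemma LL.summ0 (h : LL Λ B) {t : ℝ} (ht : 0 < t) : Summable fun x : Λ => Real.exp (-π * t * B x x) := by
  simpa using h.poisson.1 t ht 0 0

lemma LL.nonneg (h : LL Λ B) (x : Λ) : 0 ≤ B x x := by
  rcases eq_or_ne x 0 with rfl | hx
  · simp
  · exact (h.pos x hx).le

lemma LL.fin (h : LL Λ B) (n : ℕ) : {x : Λ | B x x = 2 * n}.Finite := by
  have := (h.summ0 one_pos).tendsto_cofinite_zero
  have h2 := this.eventually (gt_mem_nhds (Real.exp_pos (-π * 1 * (2 * n))))
  rw [Filter.eventually_cofinite] at h2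
  refine h2.subset fun x hx => ?_
  simp only [Set.mem_ofPred_eq] at hx ⊢
  rw [hx]; push_cast; simp

noncomputable def LL.sh (h : LL Λ B) (n : ℕ) : Finset Λ := (h.fin n).toFinset

lemma LL.mem_sh (h : LL Λ B) (n : ℕ) (x : Λ) : x ∈ h.sh n ↔ B x x = 2 * n := by
  simp [LL.sh]

lemma LL.hasSum_sh (h : LL Λ B) {f : Λ → ℂ} {a : ℂ} (hf : HasSum f a) :
    HasSum (fun n : ℕ => ∑ x ∈ h.sh n, f x) a := by
  have := hf.tsum_fiberwise (fun x : Λ => (B x x / 2).toNat)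
  refine this.congr_fun ?_
  intro n
  rw [← Finset.tsum_subtype]
  have : ((fun x : Λ => (B x x / 2).toNat) ⁻¹' {n}) = {x | x ∈ h.sh n} := by
    ext x
    simp only [Set.mem_preimage, Set.mem_singleton_iff, Set.mem_ofPred_eq, h.mem_sh]
    obtain ⟨k, hk⟩ := h.even x
    have := h.nonneg x
    omega
  rw [this]; rfl

lemma LL.mf (h : LL Λ B) (K : ℕ) (w : Λ → ℂ)
    (hs : ∀ t > 0, Summable fun x => ‖w x‖ * Real.exp (-π * t * B x x))
    (hS : ∀ t : ℝ, 0 < t → ∑' x, w x * (Real.exp (-π * (1 / t) * B x x) : ℝ) =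
      (I * t) ^ K * ∑' x, w x * (Real.exp (-π * t * B x x) : ℝ)) :
    ∃ f : ModularForm 𝒮ℒ (K : ℤ), (∀ n, (qExpansion 1 f).coeff n = ∑ x ∈ h.sh n, w x) ∧
      ∀ τ : ℍ, f τ = ∑' x, w x * cexp (π * I * τ * B x x) := by
  let F : ℂ → ℂ := fun τ => ∑' x, w x * cexp (π * I * τ * B x x)
  have hn : ∀ τ : ℂ, ∀ x, ‖w x * cexp (π * I * τ * B x x)‖ = ‖w x‖ * Real.exp (-π * τ.im * B x x) := by
    intro τ x
    rw [norm_mul, Complex.norm_exp]; congr 2; simp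
  have hdiff : DifferentiableOn ℂ F {z | 0 < z.im} := by
    intro z hz
    have hz' : 0 < z.im := hz
    have ho : IsOpen {y : ℂ | z.im / 2 < y.im} := isOpen_lt continuous_const Complex.continuous_im
    have := differentiableOn_tsum_of_summable_norm (hs (z.im / 2) (by positivity)) 
      (F := fun x τ => w x * cexp (π * I * τ * B x x)) (U := {y : ℂ | z.im / 2 < y.im})
      (fun x => by fun_prop) ho (by
        intro x y hy
        simp only [Set.mem_ofPred_eq] at hy
        rw [hn]
        refine mul_le_mul_of_nonneg_left (Real.exp_le_exp.2 ?_) (norm_nonneg _)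
        have h0 : (0:ℝ) ≤ B x x := by exact_mod_cast h.nonneg x
        have : 0 ≤ π * B x x := by positivity
        nlinarith)
    exact ((this z (by simp; linarith)).differentiableAt (ho.mem_nhds (by simp; linarith))).differentiableWithinAt
  have hax : ∀ t : ℝ, 0 < t → F (I * t) = ∑' x, w x * (Real.exp (-π * t * B x x) : ℝ) := by
    intro t ht
    simp only [F]; congr 1; ext x; rw [Complex.ofReal_exp]; congr 2
    push_cast; ring_nf; simp
  have hopen : IsOpen {z : ℂ | 0 < z.im} := isOpen_lt continuous_const Complex.continuous_im
  have hST : ∀ τ : ℂ, 0 < τ.im → F (-1 / τ) = τ ^ K * F τ := by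
    let G : ℂ → ℂ := fun τ => F (-1 / τ) - τ ^ K * F τ
    have hG : DifferentiableOn ℂ G {z | 0 < z.im} := by
      refine DifferentiableOn.sub ?_ ?_
      · refine hdiff.comp ?_ ?_
        · intro z hz
          have : z ≠ 0 := by rintro rfl; simp at hz
          exact (DifferentiableAt.div (by fun_prop) (by fun_prop) this).differentiableWithinAt
        · intro z hz
          have hz' : 0 < z.im := hz
          have h1 : z ≠ 0 := by rintro rfl; simp at hz
          simp only [Set.mem_ofPred_eq, Complex.div_im]
          have := Complex.normSq_pos.2 h1
          simp
          exact div_neg_of_neg_of_pos (by linarith) this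
      · exact (by fun_prop : DifferentiableOn ℂ (fun z : ℂ => z ^ K) _).mul hdiff
    have hGa := hG.analyticOnNhd hopen
    have hz : Set.EqOn G 0 {z | 0 < z.im} := by
      refine hGa.eqOn_zero_of_preconnected_of_frequently_eq_zero (z₀ := I) ?_ (by simp) ?_
      · exact (convex_halfSpace_im_gt 0).isPreconnected
      · have ht : Filter.Tendsto (fun t : ℝ => (I * t : ℂ)) (nhdsWithin 1 {1}ᶜ) (nhdsWithin I {I}ᶜ) := by
          refine tendsto_nhdsWithin_iff.2 ⟨?_, ?_⟩
          · have : Continuous (fun t : ℝ => (I * t : ℂ)) := by fun_prop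
            have := this.tendsto 1
            simp only [Complex.ofReal_one, mul_one] at this
            exact this.mono_left nhdsWithin_le_nhds
          · filter_upwards [self_mem_nhdsWithin] with t ht
            simp only [Set.mem_compl_iff, Set.mem_singleton_iff] at ht ⊢
            intro h1
            apply ht
            have := congrArg Complex.im h1
            simpa using this
        refine ht.frequently (Filter.Eventually.frequently ?_)
        have : ∀ᶠ t in nhdsWithin (1:ℝ) {1}ᶜ, 0 < t := nhdsWithin_le_nhds (lt_mem_nhds one_pos)
        filter_upwards [this] with t ht
        simp only [G]
        have e1 : -1 / (I * t : ℂ) = I * ((1 / t : ℝ) : ℂ) := by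
          have : (t : ℂ) ≠ 0 := by exact_mod_cast ht.ne'
          push_cast; field_simp; simp
        rw [e1, hax _ (by positivity), hax _ ht, hS t ht, sub_self]
    intro τ hτ
    have := hz hτ
    exact sub_eq_zero.1 this
  let f : ℍ → ℂ := fun τ => F τ
  have hT : ∀ τ : ℂ, F (1 + τ) = F τ := by
    intro τ
    simp only [F]; congr 1; ext x
    obtain ⟨k, hk⟩ := h.even x
    congr 1
    rw [Complex.exp_eq_exp_iff_exists_int]
    refine ⟨k, ?_⟩
    rw [hk]; push_cast; ring
  have hsl : ∀ γ : SL(2, ℤ), f ∣[(K : ℤ)] γ = f := by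
    apply SlashInvariantForm.slash_action_generators_SL2Z
    · ext τ
      rw [SlashInvariantForm.slash_S_apply]
      have h1 : (τ : ℂ) ≠ 0 := UpperHalfPlane.ne_zero τ
      simp only [f]
      have := hST τ τ.im_pos
      have e2 : (-(τ:ℂ))⁻¹ = -1 / τ := by field_simp
      rw [e2, this]
      rw [_root_.zpow_neg, zpow_natCast]
      field_simp
    · ext τ
      rw [SL_slash_apply, modular_T_smul]
      simp only [f]
      have := hT τ
      have hd : denom (ModularGroup.T : SL(2, ℤ)) τ = 1 := by
        rw [ModularGroup.denom_apply]; simp [ModularGroup.T]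
      rw [hd]
      simp [this]
  have hq : ∀ τ : ℍ, HasSum (fun m : ℕ => (∑ x ∈ h.sh m, w x) • Function.Periodic.qParam 1 τ ^ m) (f τ) := by
    intro τ
    have hsu : HasSum (fun x => w x * cexp (π * I * τ * B x x)) (f τ) := by
      apply Summable.hasSum
      apply Summable.of_norm
      simp_rw [hn]
      exact hs _ τ.im_pos
    have := h.hasSum_sh hsu
    convert this using 2 with m
    rw [smul_eq_mul, Finset.sum_mul]
    refine Finset.sum_congr rfl fun x hx => ?_
    rw [h.mem_sh] at hx
    rw [hx, Function.Periodic.qParam, ← Complex.exp_nat_mul]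
    congr 2
    push_cast; ring
  have hb : IsBoundedAtImInfty f := isBoundedAtImInfty_of_hasSum_qExpansion one_pos hq
  let fm : ModularForm 𝒮ℒ (K : ℤ) := 
    { toFun := f
      slash_action_eq' := by
        rintro _ ⟨γ, rfl⟩
        exact hsl γ
      holo' := by
        rw [UpperHalfPlane.mdifferentiable_iff]
        refine hdiff.congr fun z hz => ?_
        simp only [Function.comp]
        show F _ = _
        rw [UpperHalfPlane.ofComplex_apply_of_im_pos hz]
      bdd_at_cusps' := by
        intro c hc
        rw [OnePoint.isBoundedAt_iff_exists_SL2Z hc]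
        obtain ⟨γ, rfl⟩ := isCusp_SL2Z_iff'.mp hc
        refine ⟨γ, rfl, ?_⟩
        have := hsl γ
        show IsBoundedAtImInfty (f ∣[(K:ℤ)] γ)
        rw [this]; exact hb }
  refine ⟨fm, fun n => ?_, fun τ => rfl⟩
  exact (ModularFormClass.qExpansion_coeff_unique one_pos one_mem_strictPeriods_SL (f := fm) hq n).symm

lemma LL.mf_zero (h : LL Λ B) (K : ℕ) (hK : K / 12 ≤ 1) (w : Λ → ℂ)
    (hs : ∀ t > 0, Summable fun x => ‖w x‖ * Real.exp (-π * t * B x x))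
    (hS : ∀ t : ℝ, 0 < t → ∑' x, w x * (Real.exp (-π * (1 / t) * B x x) : ℝ) =
      (I * t) ^ K * ∑' x, w x * (Real.exp (-π * t * B x x) : ℝ)) (h0 : w 0 = 0) :
    (∑ x ∈ h.sh 2, w x = 0) ∧ ∀ t : ℝ, 0 < t → ∑' x, w x * (Real.exp (-π * t * B x x) : ℝ) = 0 := by
  obtain ⟨f, hf, hf'⟩ := h.mf K w hs hS
  have c0 : (qExpansion 1 f).coeff 0 = 0 := by
    rw [hf]
    refine Finset.sum_eq_zero fun x hx => ?_
    rw [h.mem_sh] at hx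
    by_cases hx0 : x = 0
    · rw [hx0, h0]
    · have := h.pos x hx0; simp at hx; omega
  have c1 : (qExpansion 1 f).coeff 1 = 0 := by
    rw [hf]
    refine Finset.sum_eq_zero fun x hx => ?_
    rw [h.mem_sh] at hx
    exact absurd hx (by simpa using h.noroot x)
  have : f = 0 := by
    apply sturm_bound_levelOne_nat
    have : (2 : ℕ∞) ≤ (qExpansion 1 f).order := by
      apply PowerSeries.nat_le_order
      intro i hi
      interval_cases i
      · exact c0
      · exact c1
    refine lt_of_lt_of_le ?_ this
    have : ((K / 12 : ℕ) : ℕ∞) ≤ 1 := by exact_mod_cast hK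
    refine lt_of_le_of_lt this (by norm_num)
  subst this
  refine ⟨?_, fun t ht => ?_⟩
  · rw [← hf 2]
    show (PowerSeries.coeff 2) (qExpansion 1 ((0 : ModularForm 𝒮ℒ (K:ℤ)) : ℍ → ℂ)) = 0
    simp [qExpansion_zero]
  · have := hf' ⟨I * t, by simpa using ht⟩
    rw [show (0 : ModularForm 𝒮ℒ (K:ℤ)) (⟨I * t, by simpa using ht⟩ : ℍ) = 0 from rfl] at this
    rw [this]
    congr 1; ext x; rw [Complex.ofReal_exp]; congr 2
    push_cast; ring_nf; simp
end PartB

section PartB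
open Real Complex MatrixGroups ModularForm EisensteinSeries
open UpperHalfPlane hiding I

variable {Λ : Type*} [AddCommGroup Λ] [Module.Free ℤ Λ] [Module.Finite ℤ Λ]
    {B : Λ →ₗ[ℤ] Λ →ₗ[ℤ] ℤ}

lemma LL.sumexp (h : LL Λ B) {t : ℝ} (ht : 0 < t) (a : Λ) (C : ℝ) :
    Summable fun x => Real.exp (C * |(B x a : ℝ)|) * Real.exp (-π * t * B x x) := by
  have hp : ∀ C : ℝ, Summable fun x => Real.exp (C * B x a) * Real.exp (-π * t * B x x) := by
    intro C
    have := (h.poisson.1 t ht (C / (2 * π * t)) a).mul_left (Real.exp (π * t * (C / (2 * π * t)) ^ 2 * B a a))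
    refine this.congr fun x => ?_
    rw [← Real.exp_add, ← Real.exp_add]; congr 1
    have : π ≠ 0 := Real.pi_ne_zero
    field_simp; ring
  refine Summable.of_nonneg_of_le (fun x => by positivity) (fun x => ?_) ((hp C).add (hp (-C)))
  rw [← add_mul]
  refine mul_le_mul_of_nonneg_right ?_ (by positivity)
  rcases abs_cases (B x a : ℝ) with ⟨h1, _⟩ | ⟨h1, _⟩
  · rw [h1]; have := Real.exp_pos (-C * B x a); linarith
  · rw [h1]; have := Real.exp_pos (C * B x a); rw [neg_mul, ← mul_neg]; linarith

lemma LL.sumpow (h : LL Λ B) {t : ℝ} (ht : 0 < t) (a : Λ) (r : ℝ) (k : ℕ) (C : ℝ) :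
    Summable fun x => |r * (B x a : ℝ)| ^ k * Real.exp (C * |r * (B x a : ℝ)|) * Real.exp (-π * t * B x x) := by
  refine Summable.of_nonneg_of_le (fun x => by positivity) (fun x => ?_)
    ((h.sumexp ht a ((1 + C) * |r|)).mul_left (k.factorial : ℝ))
  rw [← mul_assoc]
  refine mul_le_mul_of_nonneg_right ?_ (by positivity)
  have h1 := Real.pow_div_factorial_le_exp (|r * (B x a : ℝ)|) (abs_nonneg _) k
  rw [div_le_iff₀ (by positivity)] at h1
  have h2 : Real.exp ((1 + C) * |r| * |(B x a : ℝ)|) = Real.exp |r * (B x a : ℝ)| * Real.exp (C * |r * (B x a : ℝ)|) := by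
    rw [← Real.exp_add, abs_mul]; congr 1; ring
  rw [h2, ← mul_assoc, mul_comm (k.factorial : ℝ)]
  exact mul_le_mul_of_nonneg_right h1 (by positivity)

noncomputable def MM (B : Λ →ₗ[ℤ] Λ →ₗ[ℤ] ℤ) (a : Λ) (r : ℝ) (j : ℕ) (t : ℝ) : ℂ :=
  ∑' x, (r * B x a : ℂ) ^ j * (Real.exp (-π * t * B x x) : ℝ)

noncomputable def HH (B : Λ →ₗ[ℤ] Λ →ₗ[ℤ] ℤ) (a : Λ) (r : ℝ) (t : ℝ) (ζ : ℂ) : ℂ :=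
  ∑' x, cexp (ζ * (r * B x a)) * (Real.exp (-π * t * B x x) : ℝ)

lemma LL.summM (h : LL Λ B) {t : ℝ} (ht : 0 < t) (a : Λ) (r : ℝ) (k : ℕ) :
    Summable fun x => ‖(r * B x a : ℂ) ^ k‖ * Real.exp (-π * t * B x x) := by
  refine (h.sumpow ht a r k 0).congr fun x => ?_
  rw [norm_pow]
  have : (r * B x a : ℂ) = ((r * B x a : ℝ) : ℂ) := by push_cast; rfl
  rw [this, Complex.norm_real, Real.norm_eq_abs]; simp

lemma LL.tay (h : LL Λ B) {t : ℝ} (ht : 0 < t) (a : Λ) (r : ℝ) (J : ℕ) (R : ℝ) :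
    ∃ K : ℝ, ∀ ζ : ℂ, ‖ζ‖ ≤ R → ‖HH B a r t ζ - ∑ j ∈ Finset.range (J+1), ζ ^ j / (j.factorial : ℂ) * MM B a r j t‖
      ≤ ‖ζ‖ ^ (J+1) * K := by
  have hsK := h.sumpow ht a r (J+1) R
  refine ⟨∑' x, |r * (B x a : ℝ)| ^ (J+1) * Real.exp (R * |r * (B x a : ℝ)|) * Real.exp (-π * t * B x x), fun ζ hζ => ?_⟩
  have hu : ∀ x, ‖(r * B x a : ℂ)‖ = |r * (B x a : ℝ)| := fun x => by
    have : (r * B x a : ℂ) = ((r * B x a : ℝ) : ℂ) := by push_cast; rfl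
    rw [this, Complex.norm_real, Real.norm_eq_abs]
  have hj : ∀ j, Summable fun x => ζ ^ j / (j.factorial : ℂ) * ((r * B x a : ℂ) ^ j * (Real.exp (-π * t * B x x) : ℝ)) := by
    intro j
    refine Summable.mul_left _ ?_
    apply Summable.of_norm
    refine (h.summM ht a r j).congr fun x => ?_
    rw [norm_mul, Complex.norm_real, Real.norm_of_nonneg (Real.exp_pos _).le]
  have hH : Summable fun x => cexp (ζ * (r * B x a)) * ((Real.exp (-π * t * B x x) : ℝ) : ℂ) := by
    apply Summable.of_norm
    refine Summable.of_nonneg_of_le (fun x => norm_nonneg _) (fun x => ?_) (h.sumpow ht a r 0 R)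
    rw [norm_mul, Complex.norm_real, Real.norm_of_nonneg (Real.exp_pos _).le, pow_zero, one_mul]
    refine mul_le_mul_of_nonneg_right ?_ (by positivity)
    refine (Complex.norm_exp_le_exp_norm _).trans (Real.exp_le_exp.2 ?_)
    rw [norm_mul, hu]
    gcongr
  have e1 : HH B a r t ζ - ∑ j ∈ Finset.range (J+1), ζ ^ j / (j.factorial : ℂ) * MM B a r j t =
      ∑' x, (cexp (ζ * (r * B x a)) - ∑ j ∈ Finset.range (J+1), (ζ * (r * B x a)) ^ j / (j.factorial : ℂ)) * ((Real.exp (-π * t * B x x) : ℝ) : ℂ) := by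
    unfold HH MM
    simp_rw [← tsum_mul_left]
    rw [← Summable.tsum_finsetSum (fun j _ => hj j), ← hH.tsum_sub (summable_sum fun j _ => hj j)]
    congr 1; ext x
    rw [sub_mul, Finset.sum_mul]; congr 1
    refine Finset.sum_congr rfl fun j _ => ?_
    rw [mul_pow]; ring
  have hb : ∀ x, ‖(cexp (ζ * (r * B x a)) - ∑ j ∈ Finset.range (J+1), (ζ * (r * B x a)) ^ j / (j.factorial : ℂ)) * ((Real.exp (-π * t * B x x) : ℝ) : ℂ)‖ ≤
     ‖ζ‖ ^ (J+1) * (|r * (B x a : ℝ)| ^ (J+1) * Real.exp (R * |r * (B x a : ℝ)|) * Real.exp (-π * t * B x x)) := by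
    intro x
    rw [norm_mul, Complex.norm_real, Real.norm_of_nonneg (Real.exp_pos _).le, ← mul_assoc (‖ζ‖ ^ (J+1))]
    refine mul_le_mul_of_nonneg_right ?_ (Real.exp_pos _).le
    refine (Complex.norm_exp_sub_sum_le_norm_mul_exp _ _).trans ?_
    rw [norm_mul, hu, mul_pow, mul_assoc]
    gcongr
  rw [e1]
  refine (norm_tsum_le_tsum_norm ?_).trans ?_
  · exact Summable.of_nonneg_of_le (fun x => norm_nonneg _) hb (hsK.mul_left _)
  · refine ((Summable.of_nonneg_of_le (fun x => norm_nonneg _) hb (hsK.mul_left _)).tsum_le_tsum hb (hsK.mul_left _)).trans ?_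
    rw [tsum_mul_left]

lemma LL.tay_lim (h : LL Λ B) {t : ℝ} (ht : 0 < t) (a a' : Λ) (r r' : ℝ) (J : ℕ)
    (hJ : ∀ j < J, MM B a r j t = MM B a' r' j t) (c : ℂ) :
    Filter.Tendsto (fun s : ℝ => (HH B a r t (c * s) - HH B a' r' t (c * s)) / (s : ℂ) ^ J) (nhdsWithin 0 {0}ᶜ)
      (nhds (c ^ J / (J.factorial : ℂ) * (MM B a r J t - MM B a' r' J t))) := by
  obtain ⟨K, hK⟩ := h.tay ht a r J ‖c‖
  obtain ⟨K', hK'⟩ := h.tay ht a' r' J ‖c‖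
  rw [tendsto_iff_norm_sub_tendsto_zero]
  have hlim : Filter.Tendsto (fun s : ℝ => |s| * (‖c‖ ^ (J+1) * (K + K'))) (nhdsWithin 0 {0}ᶜ) (nhds 0) := by
    have : Continuous (fun s : ℝ => |s| * (‖c‖ ^ (J+1) * (K + K'))) := by fun_prop
    have := this.tendsto 0
    simp only [abs_zero, zero_mul] at this
    exact this.mono_left nhdsWithin_le_nhds
  refine squeeze_zero' (Filter.Eventually.of_forall fun _ => norm_nonneg _) ?_ hlim
  have h1 : ∀ᶠ s : ℝ in nhdsWithin 0 {0}ᶜ, |s| < 1 := by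
    have : ∀ᶠ s : ℝ in nhds 0, |s| < 1 := by
      have := (continuous_abs (G := ℝ)).tendsto 0
      rw [abs_zero] at this
      exact this.eventually (gt_mem_nhds one_pos)
    exact nhdsWithin_le_nhds this
  filter_upwards [h1, self_mem_nhdsWithin] with s hs hs0
  have hs0' : (s : ℂ) ≠ 0 := by simpa using hs0
  have hn : ‖c * s‖ ≤ ‖c‖ := by
    rw [norm_mul, Complex.norm_real, Real.norm_eq_abs]
    exact mul_le_of_le_one_right (norm_nonneg _) hs.le
  have i1 := hK (c * s) hn
  have i2 := hK' (c * s) hn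
  have e : (HH B a r t (c * s) - HH B a' r' t (c * s)) / (s : ℂ) ^ J - c ^ J / (J.factorial : ℂ) * (MM B a r J t - MM B a' r' J t)
      = ((HH B a r t (c * s) - ∑ j ∈ Finset.range (J+1), (c * s) ^ j / (j.factorial : ℂ) * MM B a r j t) -
        (HH B a' r' t (c * s) - ∑ j ∈ Finset.range (J+1), (c * s) ^ j / (j.factorial : ℂ) * MM B a' r' j t)) / (s : ℂ) ^ J := by
    rw [Finset.sum_range_succ, Finset.sum_range_succ]
    have : ∑ j ∈ Finset.range J, (c * s) ^ j / (j.factorial : ℂ) * MM B a r j t = ∑ j ∈ Finset.range J, (c * s) ^ j / (j.factorial : ℂ) * MM B a' r' j t :=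
      Finset.sum_congr rfl fun j hj => by rw [hJ j (Finset.mem_range.1 hj)]
    rw [this, mul_pow]
    field_simp
    ring
  rw [e, norm_div, norm_pow, Complex.norm_real, Real.norm_eq_abs]
  have hsp : 0 < |s| := abs_pos.2 (by simpa using hs0)
  rw [div_le_iff₀ (by positivity)]
  refine (norm_sub_le _ _).trans ?_
  rw [norm_mul, Complex.norm_real, Real.norm_eq_abs, mul_pow] at i1 i2
  calc _ ≤ _ := add_le_add i1 i2
    _ = _ := by ring

lemma LL.HH_pois (h : LL Λ B) {t : ℝ} (ht : 0 < t) (a : Λ) (r s : ℝ) :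
    HH B a r t (2 * π * I * s) = ((1 / t : ℝ) : ℂ) ^ 12 * cexp (- π / t * s ^ 2 * (r ^ 2 * B a a)) * 
      HH B a r (1 / t) (2 * π / t * s) := by
  have := h.poisson.2 t ht (s * r) a
  have e0 : HH B a r t (2 * π * I * s) = ∑' x : Λ, cexp ((-π * t * B x x : ℝ) + 2 * π * I * (s * r * B x a : ℝ)) := by
    unfold HH; congr 1; ext x
    rw [Complex.ofReal_exp, ← Complex.exp_add]; congr 1; push_cast; ring
  have e1 : ((1 / √t) ^ 24 : ℝ) = (1 / t) ^ 12 := by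
    rw [show 24 = 2 * 12 from rfl, pow_mul]; congr 1
    rw [div_pow, Real.sq_sqrt ht.le]; simp
  rw [e0, this, e1, Complex.ofReal_tsum, Complex.ofReal_pow, mul_assoc]
  congr 1
  unfold HH
  rw [← tsum_mul_left]; congr 1; ext x
  rw [Complex.ofReal_exp, Complex.ofReal_exp, ← Complex.exp_add, ← Complex.exp_add]; congr 1
  push_cast
  ring

lemma LL.des (h : LL Λ B) (a a' : Λ) (r r' : ℝ) (hr : r ^ 2 * B a a = r' ^ 2 * B a' a') (J : ℕ) :
    J ≤ 11 → (∀ t > 0, MM B a r J t = MM B a' r' J t) ∧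
      (∑ x ∈ h.sh 2, ((r * B x a : ℂ) ^ J - (r' * B x a' : ℂ) ^ J) = 0) := by
  induction J using Nat.strong_induction_on with
  | _ J ih =>
  intro hJ
  have hprev : ∀ t > 0, ∀ j < J, MM B a r j t = MM B a' r' j t := fun t ht j hj => (ih j hj (by omega)).1 t ht
  have hsum : ∀ t > 0, ∀ (a : Λ) (r : ℝ), Summable fun x => (r * B x a : ℂ) ^ J * (Real.exp (-π * t * B x x) : ℝ) := by
    intro t ht a r
    apply Summable.of_norm
    refine (h.summM ht a r J).congr fun x => ?_
    rw [norm_mul, Complex.norm_real, Real.norm_of_nonneg (Real.exp_pos _).le]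
  have hD : ∀ t > 0, ∑' x, ((r * B x a : ℂ) ^ J - (r' * B x a' : ℂ) ^ J) * (Real.exp (-π * t * B x x) : ℝ) =
     MM B a r J t - MM B a' r' J t := by
    intro t ht
    unfold MM
    rw [← (hsum t ht a r).tsum_sub (hsum t ht a' r')]
    congr 1; ext x; rw [sub_mul]
  have key := h.mf_zero (12 + J) (by omega) (fun x => (r * B x a : ℂ) ^ J - (r' * B x a' : ℂ) ^ J)
    (by
      intro t ht
      refine Summable.of_nonneg_of_le (fun x => by positivity) (fun x => ?_) ((h.summM ht a r J).add (h.summM ht a' r' J))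
      rw [← add_mul]
      exact mul_le_mul_of_nonneg_right (norm_sub_le _ _) (by positivity))
    (by
      intro t ht
      rw [hD t ht, hD (1 / t) (by positivity)]
      have l1 := h.tay_lim ht a a' r r' J (hprev t ht) (2 * π * I)
      have l2 := h.tay_lim (t := 1 / t) (by positivity) a a' r r' J (hprev (1 / t) (by positivity)) (2 * π / t)
      have l3 : Filter.Tendsto (fun s : ℝ => ((1 / t : ℝ) : ℂ) ^ 12 * cexp (- π / t * s ^ 2 * (r ^ 2 * B a a))) (nhdsWithin 0 {0}ᶜ)
          (nhds (((1 / t : ℝ) : ℂ) ^ 12 * 1)) := by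
        have : Continuous (fun s : ℝ => ((1 / t : ℝ) : ℂ) ^ 12 * cexp (- π / t * s ^ 2 * (r ^ 2 * B a a))) := by fun_prop
        have := this.tendsto 0
        simp only [Complex.ofReal_zero, ne_eq, OfNat.ofNat_ne_zero, not_false_eq_true, zero_pow, mul_zero, zero_mul, Complex.exp_zero] at this
        exact this.mono_left nhdsWithin_le_nhds
      have l4 := l3.mul l2
      have e : (fun s : ℝ => (HH B a r t (2 * π * I * s) - HH B a' r' t (2 * π * I * s)) / (s : ℂ) ^ J) = 
         fun s : ℝ => ((1 / t : ℝ) : ℂ) ^ 12 * cexp (- π / t * s ^ 2 * (r ^ 2 * B a a)) * ((HH B a r (1 / t) (2 * π / t * s) - HH B a' r' (1 / t) (2 * π / t * s)) / (s : ℂ) ^ J) := by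
        ext s
        rw [h.HH_pois ht, h.HH_pois ht]
        have : (r ^ 2 * B a a : ℂ) = r' ^ 2 * B a' a' := by exact_mod_cast hr
        rw [this]; ring
      rw [e] at l1
      have := tendsto_nhds_unique l1 l4
      have ht0 : (t : ℂ) ≠ 0 := by exact_mod_cast ht.ne'
      have hpi : (π : ℂ) ≠ 0 := by exact_mod_cast Real.pi_ne_zero
      have hf : (J.factorial : ℂ) ≠ 0 := by exact_mod_cast J.factorial_ne_zero
      rw [mul_one, mul_pow, div_pow (2 * π : ℂ)] at this
      push_cast at this
      have h2 : (2 * π : ℂ) ^ J ≠ 0 := pow_ne_zero _ (by simp [hpi])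
      rw [pow_add, mul_pow I _ 12, show (I : ℂ) ^ 12 = 1 by rw [show 12 = 4 * 3 from rfl, pow_mul, Complex.I_pow_four, one_pow], mul_pow I _ J]
      rw [one_div, inv_pow] at this
      have hE : ∀ (P T12 TJ F II X Y : ℂ), P ≠ 0 → T12 ≠ 0 → TJ ≠ 0 → F ≠ 0 → P * II / F * X = T12⁻¹ * (P / TJ / F * Y) → Y = 1 * T12 * (II * TJ) * X := by
        intro P T12 TJ F II X Y h1 h2 h3 h4 h5
        field_simp at h5
        rw [one_mul]
        linear_combination -h5
      exact hE _ _ _ _ _ _ _ h2 (pow_ne_zero 12 ht0) (pow_ne_zero J ht0) hf this)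
    (by simp)
  refine ⟨fun t ht => ?_, key.1⟩
  have := key.2 t ht
  rw [hD t ht] at this
  exact sub_eq_zero.1 this

lemma LL.design (h : LL Λ B) (k : ℕ) (hk : k ≤ 5) (a a' : Λ) :
    (∑ x ∈ h.sh 2, B x a ^ (2 * k)) * B a' a' ^ k = (∑ x ∈ h.sh 2, B x a' ^ (2 * k)) * B a a ^ k := by
  have n1 : (0:ℝ) ≤ B a a := by exact_mod_cast h.nonneg a
  have n2 : (0:ℝ) ≤ B a' a' := by exact_mod_cast h.nonneg a'
  have := (h.des a a' (√(B a' a')) (√(B a a)) (by rw [Real.sq_sqrt n1, Real.sq_sqrt n2]; ring) (2 * k) (by omega)).2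
  have e1 : ∀ x a : Λ, ∀ y : ℝ, 0 ≤ y → ((√y : ℂ) * B x a) ^ (2 * k) = ((y ^ k * (B x a : ℝ) ^ (2 * k) : ℝ) : ℂ) := by
    intro x a y hy
    have : (√y ^ 2) ^ k = y ^ k := by rw [Real.sq_sqrt hy]
    rw [← this, ← pow_mul, ← mul_pow]; push_cast; rfl
  simp only [e1 _ _ _ n1, e1 _ _ _ n2] at this
  rw [Finset.sum_sub_distrib, sub_eq_zero, ← Complex.ofReal_sum, ← Complex.ofReal_sum, Complex.ofReal_inj, ← Finset.mul_sum, ← Finset.mul_sum] at this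
  have h2 : ((B a' a' ^ k * ∑ x ∈ h.sh 2, B x a ^ (2 * k) : ℤ) : ℝ) = ((B a a ^ k * ∑ x ∈ h.sh 2, B x a' ^ (2 * k) : ℤ) : ℝ) := by
    push_cast; exact this
  have h3 := Int.cast_injective h2
  linarith

lemma LL.card (h : LL Λ B) : (h.sh 2).card = 196560 := by
  obtain ⟨f, hf, -⟩ := h.mf 12 (fun _ => 1) (by
      intro t ht; simpa using h.summ0 ht) (by
      intro t ht
      have := h.HH_pois ht 0 0 0
      simp [HH] at this
      simp only [one_mul]
      rw [mul_pow, show (I : ℂ) ^ 12 = 1 by rw [show 12 = 4 * 3 from rfl, pow_mul, Complex.I_pow_four, one_pow], one_mul]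
      have ht0 : (t : ℂ) ≠ 0 := by exact_mod_cast ht.ne'
      simp
      rw [this]
      field_simp)
  have c0 : (qExpansion 1 f).coeff 0 = 1 := by
    rw [hf, Finset.sum_const, show h.sh 0 = {0} from ?_]; · simp
    ext x
    rw [h.mem_sh, Finset.mem_singleton]
    constructor
    · intro hx; by_contra h0; have := h.pos x h0; simp at hx; omega
    · rintro rfl; simp
  have c1 : (qExpansion 1 f).coeff 1 = 0 := by
    rw [hf]
    refine Finset.sum_eq_zero fun x hx => ?_
    rw [h.mem_sh] at hx
    exact absurd hx (by simpa using h.noroot x)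
  let g : ModularForm 𝒮ℒ 12 := (7/12 : ℂ) • ModularForm.mcast (by decide) (E₄.pow 3) +
    (5/12 : ℂ) • ModularForm.mcast (by decide) (E₆.pow 2)
  have hg : qExpansion 1 g = (7/12 : ℂ) • (qExpansion 1 E₄ * qExpansion 1 E₄ * qExpansion 1 E₄) + (5/12 : ℂ) • (qExpansion 1 E₆ * qExpansion 1 E₆) := by
    have e : (g : ℍ → ℂ) = ⇑((7/12 : ℂ) • ModularForm.mcast (by decide) (E₄.pow 3) : ModularForm 𝒮ℒ 12) +
      ⇑((5/12 : ℂ) • ModularForm.mcast (by decide) (E₆.pow 2) : ModularForm 𝒮ℒ 12) := rfl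
    rw [e, ModularForm.qExpansion_add one_pos one_mem_strictPeriods_SL]
    have e1 : ∀ (c : ℂ) (f : ModularForm 𝒮ℒ 12), qExpansion 1 (c • f) = c • qExpansion 1 f := fun c f =>
      ModularForm.qExpansion_smul one_pos one_mem_strictPeriods_SL c f
    rw [FunLike.coe_smul, FunLike.coe_smul, e1, e1, coe_mcast, coe_mcast,
      ModularForm.qExpansion_pow one_pos one_mem_strictPeriods_SL,
      ModularForm.qExpansion_pow one_pos one_mem_strictPeriods_SL]
    congr 2 <;> ring
  have a0 := E_qExpansion_coeff_zero (k := 4) (by norm_num) ⟨2, rfl⟩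
  have b0 := E_qExpansion_coeff_zero (k := 6) (by norm_num) ⟨3, rfl⟩
  have a1 : (qExpansion 1 E₄).coeff 1 = 240 := E₄_qExpansion_coeff_one
  have b1 : (qExpansion 1 E₆).coeff 1 = -504 := E₆_qExpansion_coeff_one
  have s3 : ArithmeticFunction.sigma 3 2 = 9 := by decide +kernel
  have s5 : ArithmeticFunction.sigma 5 2 = 33 := by decide +kernel
  have a2 : (qExpansion 1 E₄).coeff 2 = 2160 := by
    norm_num [E_qExpansion_coeff _ ⟨2, rfl⟩, show bernoulli 4 = -1 / 30 by decide +kernel, s3]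
  have b2 : (qExpansion 1 E₆).coeff 2 = -16632 := by
    norm_num [E_qExpansion_coeff _ ⟨3, rfl⟩, show bernoulli 6 = 1 / 42 by decide +kernel, s5]
  have g0 : (qExpansion 1 g).coeff 0 = 1 := by
    rw [hg]
    norm_num [PowerSeries.coeff_mul, Finset.Nat.antidiagonal_succ, a0, b0, -PowerSeries.coeff_zero_eq_constantCoeff]
  have g1 : (qExpansion 1 g).coeff 1 = 0 := by
    rw [hg]
    norm_num [PowerSeries.coeff_mul, Finset.Nat.antidiagonal_succ, a0, b0, a1, b1, -PowerSeries.coeff_zero_eq_constantCoeff]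
  have g2 : (qExpansion 1 g).coeff 2 = 196560 := by
    rw [hg]
    norm_num [PowerSeries.coeff_mul, Finset.Nat.antidiagonal_succ, a0, b0, a1, b1, a2, b2, -PowerSeries.coeff_zero_eq_constantCoeff]
  have hs : qExpansion 1 ⇑(f - g) = qExpansion 1 f - qExpansion 1 g :=
    by simp only [FunLike.coe_sub, ModularForm.qExpansion_sub one_pos one_mem_strictPeriods_SL]
  have hz : f - g = 0 := by
    refine ModularForm.sturm_bound_levelOne_nat (k := 12) (lt_of_lt_of_le ?_ (PowerSeries.nat_le_order _ 2 fun i hi => ?_))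
    · norm_num
    · rw [hs, map_sub]
      interval_cases i
      · rw [c0, g0, sub_self]
      · rw [c1, g1, sub_self]
  have hfg : f = g := sub_eq_zero.1 hz
  have c2 := hf 2
  rw [hfg, g2, Finset.sum_const, nsmul_eq_mul, mul_one] at c2
  exact_mod_cast c2.symm
end PartB

section PartC

variable {Λ : Type*} [AddCommGroup Λ] [Module.Free ℤ Λ] [Module.Finite ℤ Λ]
    {B : Λ →ₗ[ℤ] Λ →ₗ[ℤ] ℤ}

lemma pc_second {ι : Type*} (A : Finset ι) (ψ p q : ι → ℚ) (c a b e : ℚ) (m : ℕ)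
    (H : ∀ t : ℤ, ∑ x ∈ A, ψ x * (p x + q x * t) ^ (2 * m + 1 + 1) = c * (a + 2 * t * b + e * t ^ 2) ^ (m + 1)) :
    (2 * m + 1) * ∑ x ∈ A, ψ x * p x ^ (2 * m) * q x ^ 2 = c * (2 * m * a ^ (m - 1) * b ^ 2 + a ^ m * e) := by
  open Polynomial in
  have key : (∑ x ∈ A, C (ψ x) * (C (p x) + X * C (q x)) ^ (2 * m + 1 + 1) : ℚ[X]) =
      C c * (C a + C 2 * X * C b + X ^ 2 * C e) ^ (m + 1) := by
    refine Polynomial.eq_of_infinite_eval_eq _ _ ?_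
    refine Set.Infinite.mono ?_ (Set.infinite_range_of_injective (Int.cast_injective (α := ℚ)))
    rintro _ ⟨t, rfl⟩
    have := H t
    simp only [Set.mem_ofPred_eq, Polynomial.eval_finset_sum]
    simpa using this
  have k2 := congrArg (fun P => (Polynomial.derivative (Polynomial.derivative P)).eval 0) key
  simp only [Polynomial.derivative_sum, Polynomial.eval_finset_sum] at k2
  simp [Polynomial.derivative_pow] at k2
  have e1 : ∑ x ∈ A, ψ x * ((2 * (m:ℚ) + 1 + 1) * ((2 * m + 1) * p x ^ (2 * m) * q x) * q x) =
     2 * (m + 1) * ((2 * m + 1) * ∑ x ∈ A, ψ x * p x ^ (2 * m) * q x ^ 2) := by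
    rw [Finset.mul_sum, Finset.mul_sum]
    exact Finset.sum_congr rfl fun x _ => by ring
  rw [e1] at k2
  have : (2 * ((m:ℚ) + 1)) ≠ 0 := by positivity
  apply mul_left_cancel₀ this
  rw [k2]; ring

structure QQ (B : Λ →ₗ[ℤ] Λ →ₗ[ℤ] ℤ) (Q : Λ →ₗ[ℤ] Λ) (c : ℤ) : Prop where
  sa : ∀ x y, B (Q x) y = B x (Q y)
  sq : ∀ x, Q (Q x) = c • Q x
  hc : c ≠ 0

def QS (Q : Λ →ₗ[ℤ] Λ) (c : ℤ) : Submodule ℤ Λ := LinearMap.ker (Q - c • LinearMap.id)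

lemma mem_QS {Q : Λ →ₗ[ℤ] Λ} {c : ℤ} {x : Λ} : x ∈ QS Q c ↔ Q x = c • x := by
  simp [QS, sub_eq_zero]

lemma QQ.trace {Q : Λ →ₗ[ℤ] Λ} {c : ℤ} (hQ : QQ B Q c) :
    LinearMap.trace ℤ Λ Q = c * finrank ℤ (QS Q c) := by
  have hm : ∀ x, Q x ∈ QS Q c := fun x => mem_QS.2 (hQ.sq x)
  rw [← LinearMap.trace_restrict_eq_of_forall_mem (QS Q c) Q hm]
  have : Q.restrict (fun x _ => hm x) = c • (LinearMap.id : QS Q c →ₗ[ℤ] QS Q c) := by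
    ext x
    simpa using mem_QS.1 x.2
  rw [this, map_smul, LinearMap.trace_id]; rfl

noncomputable def ub (Λ : Type*) [AddCommGroup Λ] [Module.Free ℤ Λ] := Module.Free.chooseBasis ℤ Λ

lemma LL.dual (h : LL Λ B) : ∃ v : Module.Free.ChooseBasisIndex ℤ Λ → Λ,
    (∀ i y, B (v i) y = (ub Λ).repr y i) ∧ (∀ x y, ∑ i, B x (ub Λ i) * B y (v i) = B x y) := by
  choose v hv using fun i => h.bij.2 ((ub Λ).coord i)
  have h1 : ∀ i y, B (v i) y = (ub Λ).repr y i := fun i y => by rw [hv]; rfl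
  refine ⟨v, h1, fun x y => ?_⟩
  conv_rhs => rw [← (ub Λ).sum_repr y]
  rw [map_sum]
  refine Finset.sum_congr rfl fun i _ => ?_
  rw [h.symm y, h1, map_smul, smul_eq_mul, mul_comm]

lemma LL.lap (h : LL Λ B) {Q : Λ →ₗ[ℤ] Λ} {c : ℤ} (hQ : QQ B Q c) (A : Finset Λ) (ψ : Λ → ℚ) (C : ℚ) (m : ℕ)
    (H : ∀ α ∈ QS Q c, ∑ x ∈ A, ψ x * (B x α : ℚ) ^ (2 * (m + 1)) = C * (B α α : ℚ) ^ (m + 1)) :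
    ∀ α ∈ QS Q c, (2 * m + 1) * ∑ x ∈ A, ψ x * B (Q x) x * (B x α : ℚ) ^ (2 * m) =
      c * C * (finrank ℤ (QS Q c) + 2 * m) * (B α α : ℚ) ^ m := by
  intro α hα
  have s1 : ∀ u ∈ QS Q c, (2 * (m:ℚ) + 1) * ∑ x ∈ A, ψ x * (B x α : ℚ) ^ (2 * m) * (B x u : ℚ) ^ 2 =
      C * (2 * m * (B α α : ℚ) ^ (m - 1) * (B α u : ℚ) ^ 2 + (B α α : ℚ) ^ m * B u u) := by
    intro u hu
    refine pc_second A ψ (fun x => B x α) (fun x => B x u) C (B α α) (B α u) (B u u) m fun t => ?_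
    have := H (α + t • u) (Submodule.add_mem _ hα (Submodule.smul_mem _ _ hu))
    simp only [map_add, map_smul, LinearMap.add_apply, LinearMap.smul_apply, smul_eq_mul] at this
    rw [h.symm u α] at this
    push_cast at this
    refine Eq.trans (Finset.sum_congr rfl fun x _ => ?_) (this.trans ?_)
    · rw [mul_comm (t:ℚ)]; rfl
    · ring
  have s2 : ∀ u ∈ QS Q c, ∀ v ∈ QS Q c, (2 * (m:ℚ) + 1) * ∑ x ∈ A, ψ x * (B x α : ℚ) ^ (2 * m) * (B x u * B x v) =
      C * (2 * m * (B α α : ℚ) ^ (m - 1) * (B α u * B α v) + (B α α : ℚ) ^ m * B u v) := by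
    intro u hu v hv
    have a1 := s1 _ (Submodule.add_mem _ hu hv)
    have a2 := s1 _ hu
    have a3 := s1 _ hv
    have : ∑ x ∈ A, ψ x * (B x α : ℚ) ^ (2 * m) * (B x (u + v) : ℚ) ^ 2 = 
       ∑ x ∈ A, ψ x * (B x α : ℚ) ^ (2 * m) * (B x u : ℚ) ^ 2 + ∑ x ∈ A, ψ x * (B x α : ℚ) ^ (2 * m) * (B x v : ℚ) ^ 2 +
        2 * ∑ x ∈ A, ψ x * (B x α : ℚ) ^ (2 * m) * (B x u * B x v) := by
      rw [Finset.mul_sum, ← Finset.sum_add_distrib, ← Finset.sum_add_distrib]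
      refine Finset.sum_congr rfl fun x _ => ?_
      rw [map_add]; push_cast; ring
    rw [this] at a1
    simp only [map_add, LinearMap.add_apply] at a1
    rw [h.symm v u] at a1
    push_cast at a1
    linarith
  obtain ⟨v, hv, hs⟩ := h.dual
  have hm : ∀ x, Q x ∈ QS Q c := fun x => mem_QS.2 (hQ.sq x)
  have s3 := Finset.sum_congr (rfl : Finset.univ = Finset.univ) fun i _ => s2 _ (hm (ub Λ i)) _ (hm (v i))
  have f1 : ∀ x y, ∑ i, B x (Q (ub Λ i)) * B y (Q (v i)) = c * B (Q x) y := by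
    intro x y
    simp_rw [← hQ.sa]
    rw [hs, ← hQ.sa, hQ.sq, map_smul, LinearMap.smul_apply, smul_eq_mul]
  have f2 : ∑ i, B (Q (ub Λ i)) (Q (v i)) = c * (c * finrank ℤ (QS Q c)) := by
    rw [← hQ.trace, LinearMap.trace_eq_matrix_trace ℤ (ub Λ), Matrix.trace, Finset.mul_sum]
    refine Finset.sum_congr rfl fun i _ => ?_
    rw [← hQ.sa, hQ.sq, map_smul, LinearMap.smul_apply, smul_eq_mul, h.symm, hv, Matrix.diag_apply, LinearMap.toMatrix_apply]
  rw [← Finset.mul_sum, ← Finset.mul_sum, Finset.sum_comm] at s3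
  have f3 : ∀ x y, ∑ i, (B x (Q (ub Λ i)) : ℚ) * B y (Q (v i)) = c * B (Q x) y := by
    intro x y; exact_mod_cast f1 x y
  have f4 : ∑ i, (B (Q (ub Λ i)) (Q (v i)) : ℚ) = c * (c * finrank ℤ (QS Q c)) := by exact_mod_cast f2
  simp_rw [← Finset.mul_sum, f3] at s3
  rw [Finset.sum_add_distrib, ← Finset.mul_sum, ← Finset.mul_sum, f3, f4, mem_QS.1 hα, map_smul, LinearMap.smul_apply, smul_eq_mul] at s3
  have hc : (c : ℚ) ≠ 0 := by exact_mod_cast hQ.hc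
  apply mul_left_cancel₀ hc
  have e : ∑ x ∈ A, ψ x * (B x α : ℚ) ^ (2 * m) * (c * B (Q x) x) = c * ∑ x ∈ A, ψ x * B (Q x) x * (B x α : ℚ) ^ (2 * m) := by
    rw [Finset.mul_sum]; exact Finset.sum_congr rfl fun x _ => by ring
  rw [e] at s3
  have e2 : 2 * (m:ℚ) * (B α α : ℚ) ^ (m - 1) * B α α = 2 * m * (B α α : ℚ) ^ m := by
    rcases m with _ | m
    · simp
    · simp; ring
  push_cast at s3
  linear_combination s3 + C * c ^ 2 * e2
end PartC

section PartC

variable {Λ : Type*} [AddCommGroup Λ] [Module.Free ℤ Λ] [Module.Finite ℤ Λ]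
    {B : Λ →ₗ[ℤ] Λ →ₗ[ℤ] ℤ}

def CC : ℕ → ℚ
  | 0 => 196560
  | 1 => 32760
  | 2 => 15120
  | 3 => 10800
  | 4 => 10080
  | 5 => 11340
  | _ => 0

lemma LL.nontriv (h : LL Λ B) : ∃ a : Λ, a ≠ 0 := by
  by_contra! hh
  have : Subsingleton Λ := ⟨fun x y => by rw [hh x, hh y]⟩
  have h2 := h.rank
  rw [Module.finrank_zero_of_subsingleton] at h2
  omega

lemma LL.desC (h : LL Λ B) (k : ℕ) (hk : k ≤ 5) (α : Λ) :
    ∑ x ∈ h.sh 2, (B x α : ℚ) ^ (2 * k) = CC k * (B α α : ℚ) ^ k := by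
  obtain ⟨a, ha⟩ := h.nontriv
  have hpos : (0:ℚ) < B a a := by exact_mod_cast h.pos a ha
  have ex : ∀ k ≤ 5, ∃ c : ℚ, ∀ α, ∑ x ∈ h.sh 2, (B x α : ℚ) ^ (2 * k) = c * (B α α : ℚ) ^ k := by
    intro k hk
    refine ⟨(∑ x ∈ h.sh 2, (B x a : ℚ) ^ (2 * k)) / (B a a) ^ k, fun α => ?_⟩
    have := h.design k hk α a
    have h2 : (∑ x ∈ h.sh 2, (B x α : ℚ) ^ (2 * k)) * (B a a : ℚ) ^ k = (∑ x ∈ h.sh 2, (B x a : ℚ) ^ (2 * k)) * (B α α : ℚ) ^ k := by exact_mod_cast this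
    field_simp
    linarith
  have hQ : QQ B LinearMap.id 1 := ⟨fun _ _ => rfl, fun x => by simp, one_ne_zero⟩
  have hS : QS (LinearMap.id : Λ →ₗ[ℤ] Λ) 1 = ⊤ := by ext x; simp [mem_QS]
  have step : ∀ k : ℕ, k + 1 ≤ 5 → ∀ c c' : ℚ, (∀ α, ∑ x ∈ h.sh 2, (B x α : ℚ) ^ (2 * k) = c * (B α α : ℚ) ^ k) → 
      (∀ α, ∑ x ∈ h.sh 2, (B x α : ℚ) ^ (2 * (k + 1)) = c' * (B α α : ℚ) ^ (k + 1)) → c' = 4 * (2 * k + 1) * c / (24 + 2 * k) := by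
    intro k hk c c' h1 h2
    have := h.lap hQ (h.sh 2) (fun _ => 1) c' k (fun α _ => by simpa using h2 α) a (by rw [hS]; trivial)
    rw [hS, finrank_top, h.rank] at this
    have e : ∑ x ∈ h.sh 2, (1:ℚ) * (B ((LinearMap.id : Λ →ₗ[ℤ] Λ) x) x) * (B x a : ℚ) ^ (2 * k) = 4 * (c * (B a a : ℚ) ^ k) := by
      rw [← h1, Finset.mul_sum]
      refine Finset.sum_congr rfl fun x hx => ?_
      rw [h.mem_sh] at hx
      simp [hx]
    rw [e] at this
    have hp : (B a a : ℚ) ^ k ≠ 0 := by positivity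
    have h24 : (24 + 2 * (k:ℚ)) ≠ 0 := by positivity
    rw [eq_div_iff h24]
    apply mul_right_cancel₀ hp
    push_cast at this
    linarith
  have e0 : ∀ α, ∑ x ∈ h.sh 2, (B x α : ℚ) ^ (2 * 0) = CC 0 * (B α α : ℚ) ^ 0 := by
    intro α; simp [h.card, CC]
  have nxt : ∀ k : ℕ, k + 1 ≤ 5 → CC (k+1) = 4 * (2 * k + 1) * CC k / (24 + 2 * k) → (∀ α, ∑ x ∈ h.sh 2, (B x α : ℚ) ^ (2 * k) = CC k * (B α α : ℚ) ^ k) → 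
      (∀ α, ∑ x ∈ h.sh 2, (B x α : ℚ) ^ (2 * (k + 1)) = CC (k+1) * (B α α : ℚ) ^ (k + 1)) := by
    intro k hk hc h1 α
    obtain ⟨c', hc'⟩ := ex (k+1) hk
    rw [hc, ← step k hk _ _ h1 hc', hc']
  have e1 := nxt 0 (by norm_num) (by norm_num [CC]) e0
  have e2 := nxt 1 (by norm_num) (by norm_num [CC]) e1
  have e3 := nxt 2 (by norm_num) (by norm_num [CC]) e2
  have e4 := nxt 3 (by norm_num) (by norm_num [CC]) e3
  have e5 := nxt 4 (by norm_num) (by norm_num [CC]) e4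
  interval_cases k
  exacts [e0 α, e1 α, e2 α, e3 α, e4 α, e5 α]

structure L3 (Λ : Type*) [AddCommGroup Λ] [Module.Free ℤ Λ] [Module.Finite ℤ Λ]
    (B : Λ →ₗ[ℤ] Λ →ₗ[ℤ] ℤ) (φ : Λ →ₗ[ℤ] Λ) : Prop where
  ll : LL Λ B
  iso : ∀ x y, B (φ x) (φ y) = B x y
  cube : ∀ x, φ (φ (φ x)) = x
  ne : ∃ x, φ x ≠ x

variable {φ : Λ →ₗ[ℤ] Λ}

def Qf (φ : Λ →ₗ[ℤ] Λ) : Λ →ₗ[ℤ] Λ := (2:ℤ) • LinearMap.id - φ - φ ∘ₗ φ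

lemma Qf_apply (x : Λ) : Qf φ x = (2:ℤ) • x - φ x - φ (φ x) := rfl

def Sf (φ : Λ →ₗ[ℤ] Λ) : Submodule ℤ Λ := QS (Qf φ) 3

lemma mem_Sf {x : Λ} : x ∈ Sf φ ↔ x + φ x + φ (φ x) = 0 := by
  rw [Sf, mem_QS, Qf_apply, ← sub_eq_zero, ← neg_eq_zero]
  congr! 1
  module

lemma L3.adj (h : L3 Λ B φ) (x y : Λ) : B (φ x) y = B x (φ (φ y)) := by
  rw [← h.iso x, h.cube]

lemma L3.adj2 (h : L3 Λ B φ) (x y : Λ) : B (φ (φ x)) y = B x (φ y) := by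
  rw [h.adj, h.adj, h.cube]

lemma L3.qq (h : L3 Λ B φ) : QQ B (Qf φ) 3 where
  sa x y := by
    simp only [Qf_apply, map_sub, map_smul, LinearMap.sub_apply, LinearMap.smul_apply, h.adj, h.cube]
    ring
  sq x := by
    simp only [Qf_apply, map_sub, map_smul, h.cube]
    module
  hc := by norm_num

lemma L3.q_apply (h : L3 Λ B φ) (x : Λ) : B (Qf φ x) x = 2 * B x x - 2 * B x (φ x) := by
  simp only [Qf_apply, map_sub, map_smul, LinearMap.sub_apply, LinearMap.smul_apply]
  rw [h.adj2, h.ll.symm (φ x) x, smul_eq_mul]; ring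

def DD (d : ℚ) : ℕ → ℕ → ℚ
  | 0, n => CC n
  | j+1, n => 3 * DD d j (n + 1) * (d + 2 * n) / (2 * n + 1)

lemma L3.mom (h : L3 Λ B φ) (j n : ℕ) (hjn : j + n ≤ 5) (α : Λ) (hα : α ∈ Sf φ) :
    ∑ x ∈ h.ll.sh 2, (8 - 2 * B x (φ x) : ℚ) ^ j * (B x α : ℚ) ^ (2 * n) = DD (finrank ℤ (Sf φ)) j n * (B α α : ℚ) ^ n := by
  induction j generalizing n α with
  | zero => simpa [DD] using h.ll.desC n (by omega) α
  | succ j ih =>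
    have := h.ll.lap h.qq (h.ll.sh 2) (fun x => (8 - 2 * B x (φ x) : ℚ) ^ j) _ n
      (fun α hα => ih (n+1) (by omega) α hα) α hα
    have h0 : (2 * (n:ℚ) + 1) ≠ 0 := by positivity
    apply mul_left_cancel₀ h0
    have e : ∑ x ∈ h.ll.sh 2, (8 - 2 * B x (φ x) : ℚ) ^ (j+1) * (B x α : ℚ) ^ (2 * n) = 
      ∑ x ∈ h.ll.sh 2, (8 - 2 * B x (φ x) : ℚ) ^ j * (B (Qf φ x) x : ℚ) * (B x α : ℚ) ^ (2 * n) := by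
      refine Finset.sum_congr rfl fun x hx => ?_
      rw [h.ll.mem_sh] at hx
      rw [h.q_apply, hx]; push_cast; ring
    rw [e, this, DD]
    change 3 * _ * ((finrank ℤ (Sf φ) : ℚ) + _) * _ = _
    field_simp

lemma L3.beta (h : L3 Λ B φ) {x : Λ} (hx : x ∈ h.ll.sh 2) : B x (φ x) ∈ ({4, 2, 1, 0, -1, -2} : Finset ℤ) := by
  rw [h.ll.mem_sh] at hx
  have e2 : B (x - φ x) (x - φ x) = 8 - 2 * B x (φ x) := by
    simp only [map_sub, LinearMap.sub_apply, h.iso, h.ll.symm (φ x) x, hx]; ring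
  have h2 := h.ll.noroot (x - φ x)
  have h3 := h.ll.nonneg (x - φ x)
  have h4 := h.ll.nonneg (x + φ x + φ (φ x))
  have e4 : B (x + φ x + φ (φ x)) (x + φ x + φ (φ x)) = 12 + 6 * B x (φ x) := by
    simp only [map_add, LinearMap.add_apply, h.iso, h.adj2, h.ll.symm (φ x) x, hx]
    rw [h.ll.symm x (φ (φ x)), h.adj2]; ring
  rw [e2] at h2 h3; rw [e4] at h4
  have : B x (φ x) ≤ 4 := by omega
  have : -2 ≤ B x (φ x) := by omega
  generalize B x (φ x) = b at *
  interval_cases b <;> simp at h2 ⊢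

/-- counts -/
noncomputable def L3.n (h : L3 Λ B φ) (b : ℤ) : ℕ := ((h.ll.sh 2).filter fun x => B x (φ x) = b).card

lemma L3.sum_beta (h : L3 Λ B φ) (g : ℤ → Λ → ℚ) :
    ∑ x ∈ h.ll.sh 2, g (B x (φ x)) x = ∑ b ∈ ({4, 2, 1, 0, -1, -2} : Finset ℤ), ∑ x ∈ (h.ll.sh 2).filter (fun x => B x (φ x) = b), g b x := by
  rw [← Finset.sum_fiberwise_of_maps_to (t := ({4, 2, 1, 0, -1, -2} : Finset ℤ)) (g := fun x => B x (φ x)) (fun x hx => h.beta hx)]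
  refine Finset.sum_congr rfl fun b _ => Finset.sum_congr rfl fun x hx => ?_
  rw [(Finset.mem_filter.1 hx).2]

lemma L3.cnt (h : L3 Λ B φ) (k : ℕ) (hk : k ≤ 5) :
    (h.n 4 : ℚ) * 0 ^ k + h.n 2 * 4 ^ k + h.n 1 * 6 ^ k + h.n 0 * 8 ^ k + h.n (-1) * 10 ^ k + h.n (-2) * 12 ^ k =
      DD (finrank ℤ (Sf φ)) k 0 := by
  have := h.mom k 0 (by omega) 0 (Submodule.zero_mem _)
  simp only [mul_zero, pow_zero, mul_one] at this
  rw [← this, h.sum_beta (fun b _ => (8 - 2 * b : ℚ) ^ k)]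
  simp only [Finset.sum_const, nsmul_eq_mul]
  rw [Finset.sum_insert (by decide), Finset.sum_insert (by decide), Finset.sum_insert (by decide), Finset.sum_insert (by decide), Finset.sum_insert (by decide), Finset.sum_singleton]
  symm
  change ((h.n 4 : ℚ)) * _ + ((h.n 2 : ℚ) * _ + ((h.n 1 : ℚ) * _ + ((h.n 0 : ℚ) * _ + ((h.n (-1) : ℚ) * _ + (h.n (-2) : ℚ) * _)))) = _ 
  norm_num
  ring

lemma L3.pos_d (h : L3 Λ B φ) : 0 < finrank ℤ (Sf φ) := by
  obtain ⟨x, hx⟩ := h.ne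
  have hm : x - φ x ∈ Sf φ := by
    rw [mem_Sf]; simp only [map_sub, h.cube]; abel
  have : Nontrivial (Sf φ) := ⟨⟨⟨x - φ x, hm⟩, 0, fun hh => hx (by
    have := congrArg Subtype.val hh
    simp only [ZeroMemClass.coe_zero] at this
    exact (sub_eq_zero.1 this).symm)⟩⟩
  exact Module.finrank_pos

lemma L3.n_pos_of (h : L3 Λ B φ) (h2 : 0 < h.n 2) : 0 < h.n (-2) := by
  rw [L3.n, Finset.card_pos] at *
  obtain ⟨x, hx⟩ := h2
  rw [Finset.mem_filter, h.ll.mem_sh] at hx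
  obtain ⟨hx, hb⟩ := hx
  refine ⟨x - φ x, Finset.mem_filter.2 ⟨(h.ll.mem_sh _ _).2 ?_, ?_⟩⟩
  · simp only [map_sub, LinearMap.sub_apply, h.iso, h.ll.symm (φ x) x, hx, hb]; norm_num
  · simp only [map_sub, LinearMap.sub_apply, h.iso, hx, hb]
    rw [h.ll.symm x (φ (φ x)), h.adj2, hb]; norm_num

lemma L3.cnts (h : L3 Λ B φ) (d : ℕ) (hd : finrank ℤ (Sf φ) = d) :
    (h.n 4 : ℤ) + h.n 2 + h.n 1 + h.n 0 + h.n (-1) + h.n (-2) = 196560 ∧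
    (h.n 2 : ℤ) * 4 + h.n 1 * 6 + h.n 0 * 8 + h.n (-1) * 10 + h.n (-2) * 12 = 98280 * d ∧
    (h.n 2 : ℤ) * 16 + h.n 1 * 36 + h.n 0 * 64 + h.n (-1) * 100 + h.n (-2) * 144 = 45360 * (d * (d + 2)) ∧
    (h.n 2 : ℤ) * 64 + h.n 1 * 216 + h.n 0 * 512 + h.n (-1) * 1000 + h.n (-2) * 1728 = 19440 * (d * (d + 2) * (d + 4)) ∧
    (h.n 2 : ℤ) * 256 + h.n 1 * 1296 + h.n 0 * 4096 + h.n (-1) * 10000 + h.n (-2) * 20736 = 7776 * (d * (d + 2) * (d + 4) * (d + 6)) ∧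
    (h.n 2 : ℤ) * 1024 + h.n 1 * 7776 + h.n 0 * 32768 + h.n (-1) * 100000 + h.n (-2) * 248832 = 2916 * (d * (d + 2) * (d + 4) * (d + 6) * (d + 8)) := by
  have c0 := h.cnt 0 (by norm_num)
  have c1 := h.cnt 1 (by norm_num)
  have c2 := h.cnt 2 (by norm_num)
  have c3 := h.cnt 3 (by norm_num)
  have c4 := h.cnt 4 (by norm_num)
  have c5 := h.cnt 5 (by norm_num)
  rw [hd] at c0 c1 c2 c3 c4 c5
  norm_num [DD, CC] at c0 c1 c2 c3 c4 c5
  refine ⟨?_, ?_, ?_, ?_, ?_, ?_⟩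
  all_goals (apply Int.cast_injective (α := ℚ); push_cast; linarith)

lemma L3.rank_cases (h : L3 Λ B φ) : finrank ℤ (Sf φ) = 12 ∨ finrank ℤ (Sf φ) = 16 ∨
    finrank ℤ (Sf φ) = 18 ∨ finrank ℤ (Sf φ) = 24 := by
  have hle : finrank ℤ (Sf φ) ≤ 24 := h.ll.rank ▸ Submodule.finrank_le _
  have hp := h.pos_d
  obtain ⟨d, hd⟩ : ∃ d, finrank ℤ (Sf φ) = d := ⟨_, rfl⟩
  obtain ⟨e0, e1, e2, e3, e4, e5⟩ := h.cnts d hd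
  have h2 := h.n_pos_of
  rw [hd] at hle hp ⊢
  generalize h.n 4 = a at *
  generalize h.n 2 = b at *
  generalize h.n 1 = c at *
  generalize h.n 0 = e at *
  generalize h.n (-1) = f at *
  generalize h.n (-2) = g at *
  clear hd
  interval_cases d <;> norm_num at e1 e2 e3 e4 e5 ⊢ <;> omega

lemma L3.cnt16 (h : L3 Λ B φ) (hd : finrank ℤ (Sf φ) = 16) :
    h.n 4 = 0 ∧ h.n 2 = 6480 ∧ h.n (-2) = 720 := by
  obtain ⟨e0, e1, e2, e3, e4, e5⟩ := h.cnts 16 hd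
  norm_num at e1 e2 e3 e4 e5
  omega
end PartC

section PartD

variable {Λ : Type*} [AddCommGroup Λ] [Module.Free ℤ Λ] [Module.Finite ℤ Λ]
    {B : Λ →ₗ[ℤ] Λ →ₗ[ℤ] ℤ} {φ : Λ →ₗ[ℤ] Λ}

structure DV (B : Λ →ₗ[ℤ] Λ →ₗ[ℤ] ℤ) (φ : Λ →ₗ[ℤ] Λ) (V : Finset Λ) : Prop where
  symm : ∀ x y, B x y = B y x
  iso : ∀ x y, B (φ x) (φ y) = B x y
  cube : ∀ x, φ (φ (φ x)) = x
  nn : ∀ x, x ≠ 0 → 4 ≤ B x x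
  memV : ∀ x, x ∈ V ↔ B x x = 4 ∧ x + φ x + φ (φ x) = 0
  tri : ∀ v ∈ V, ∀ w, w + φ w + φ (φ w) = 0 → 3 ∣ B v w - B v (φ w)
  frame : ∀ a, a + φ a + φ (φ a) = 0 → ∑ w ∈ V, B w a ^ 2 = 180 * B a a
  card : V.card = 720

noncomputable def L3.V (h : L3 Λ B φ) : Finset Λ := (h.ll.sh 2).filter fun x => B x (φ x) = -2
noncomputable def L3.W (h : L3 Λ B φ) : Finset Λ := (h.ll.sh 2).filter fun x => B x (φ x) = 2

lemma L3.nn (h : L3 Λ B φ) (x : Λ) (hx : x ≠ 0) : 4 ≤ B x x := by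
  have h1 := h.ll.pos x hx
  have h2 := h.ll.noroot x
  obtain ⟨k, hk⟩ := h.ll.even x
  omega

lemma L3.normN (h : L3 Λ B φ) (x : Λ) :
    B (x + φ x + φ (φ x)) (x + φ x + φ (φ x)) = 3 * B x x + 6 * B x (φ x) := by
  simp only [map_add, LinearMap.add_apply, h.iso, h.adj2, h.ll.symm (φ x) x]
  rw [h.ll.symm x (φ (φ x)), h.adj2]; ring

lemma L3.eq_zero (h : L3 Λ B φ) (x : Λ) (hx : B x x = 0) : x = 0 := by
  by_contra h0
  have := h.nn x h0
  omega

lemma L3.memV (h : L3 Λ B φ) (x : Λ) : x ∈ h.V ↔ B x x = 4 ∧ x + φ x + φ (φ x) = 0 := by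
  rw [L3.V, Finset.mem_filter, h.ll.mem_sh]
  have e := h.normN x
  constructor
  · rintro ⟨h1, h2⟩
    refine ⟨by rw [h1]; norm_num, h.eq_zero _ ?_⟩
    rw [e, h1, h2]; norm_num
  · rintro ⟨h1, h2⟩
    rw [h2, h1] at e
    simp at e
    exact ⟨by rw [h1]; norm_num, by omega⟩

lemma L3.memW (h : L3 Λ B φ) (x : Λ) : x ∈ h.W ↔ B x x = 4 ∧ B x (φ x) = 2 := by
  rw [L3.W, Finset.mem_filter, h.ll.mem_sh]
  norm_num

lemma L3.W_V (h : L3 Λ B φ) {x : Λ} (hx : x ∈ h.W) : x - φ x ∈ h.V := by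
  rw [h.memW] at hx
  rw [h.memV]
  constructor
  · simp only [map_sub, LinearMap.sub_apply, h.iso, h.ll.symm (φ x) x, hx]; norm_num
  · simp only [map_sub, h.cube]; abel

lemma L3.fiber (h : L3 Λ B φ) (h4 : h.n 4 = 0) (v : Λ) [DecidableEq Λ] :
    (h.W.filter fun x => x - φ x = v).card ≤ 9 := by
  set F := h.W.filter fun x => x - φ x = v with hF
  have hfix : ∀ z, φ z = z → B z z ≠ 4 := by
    intro z hz h0
    rw [L3.n, Finset.card_eq_zero] at h4
    have : z ∈ (h.ll.sh 2).filter fun x => B x (φ x) = 4 := by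
      rw [Finset.mem_filter, h.ll.mem_sh, hz]; norm_num [h0]
    rw [h4] at this; simp at this
  have key : ∀ x ∈ F, ∀ y ∈ F, B (x + φ x + φ (φ x)) (y + φ y + φ (φ y)) ≤ if x = y then 24 else -3 := by
    intro x hx y hy
    rw [hF, Finset.mem_filter, h.memW] at hx hy
    obtain ⟨⟨x1, x2⟩, x3⟩ := hx
    obtain ⟨⟨y1, y2⟩, y3⟩ := hy
    split_ifs with hxy
    · rw [← hxy, h.normN, x1, x2]; norm_num
    · have e1 : φ y = y - x + φ x := by
        have t : y - φ y = x - φ x := y3.trans x3.symm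
        have t2 : φ y = y - (y - φ y) := by abel
        rw [t2, t]; abel
      have e2 : φ (φ y) = y - x + φ (φ x) := by rw [e1]; simp only [map_add, map_sub]; rw [e1]; abel
      have f1 : φ (x - y) = x - y := by rw [map_sub, e1]; abel
      have n1 := h.nn (x - y) (sub_ne_zero.2 hxy)
      have n2 := hfix _ f1
      obtain ⟨k, hk⟩ := h.ll.even (x - y)
      have n3 : B (x - y) (x - y) = 8 - 2 * B x y := by
        simp only [map_sub, LinearMap.sub_apply, x1, y1, h.ll.symm y x]; ring
      have a1 : B x y ≤ 1 := by omega
      have a2 : B x (φ (φ x)) = 2 := by rw [h.ll.symm, h.adj2, x2]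
      have : B (x + φ x + φ (φ x)) (y + φ y + φ (φ y)) = 3 * (B x (y + φ y + φ (φ y))) := by
        simp only [map_add, LinearMap.add_apply, h.adj, h.cube]; ring
      rw [this, e2, e1]
      simp only [map_add, map_sub, x1, x2, a2]
      omega
  have hs : 0 ≤ B (∑ x ∈ F, (x + φ x + φ (φ x))) (∑ x ∈ F, (x + φ x + φ (φ x))) := h.ll.nonneg _
  rw [map_sum B, LinearMap.sum_apply] at hs
  have hle : ∑ x ∈ F, B (x + φ x + φ (φ x)) (∑ y ∈ F, (y + φ y + φ (φ y))) ≤ ∑ x ∈ F, ∑ y ∈ F, if x = y then (24:ℤ) else -3 := by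
    refine Finset.sum_le_sum fun x hx => ?_
    rw [map_sum]
    exact Finset.sum_le_sum fun y hy => key x hx y hy
  have hc : ∑ x ∈ F, ∑ y ∈ F, (if x = y then (24:ℤ) else -3) = F.card * (27 - 3 * F.card) := by
    have : ∀ x ∈ F, ∑ y ∈ F, (if x = y then (24:ℤ) else -3) = 27 - 3 * F.card := by
      intro x hx
      have : ∀ y, (if x = y then (24:ℤ) else -3) = (if x = y then 27 else 0) + -3 := fun y => by split_ifs <;> norm_num
      simp_rw [this]
      rw [Finset.sum_add_distrib, Finset.sum_ite_eq, if_pos hx, Finset.sum_const, nsmul_eq_mul]; ring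
    rw [Finset.sum_congr rfl this, Finset.sum_const, nsmul_eq_mul]
  rw [hc] at hle
  by_contra hcon
  push Not at hcon
  have : (10:ℤ) ≤ F.card := by exact_mod_cast hcon
  nlinarith

lemma L3.fiber_eq (h : L3 Λ B φ) (hd : finrank ℤ (Sf φ) = 16) [DecidableEq Λ] :
    ∀ v ∈ h.V, (h.W.filter fun x => x - φ x = v).card = 9 := by
  obtain ⟨c4, c2, cm⟩ := h.cnt16 hd
  have h1 : h.W.card = ∑ v ∈ h.V, (h.W.filter fun x => x - φ x = v).card :=
    Finset.card_eq_sum_card_fiberwise (fun x hx => h.W_V hx)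
  have h2 : h.W.card = 6480 := c2
  have h3 : h.V.card = 720 := cm
  have h4 : ∑ v ∈ h.V, (h.W.filter fun x => x - φ x = v).card = ∑ v ∈ h.V, 9 := by
    rw [← h1, h2, Finset.sum_const, h3]; rfl
  exact (Finset.sum_eq_sum_iff_of_le (fun v _ => h.fiber c4 v)).1 h4

lemma L3.dv (h : L3 Λ B φ) (hd : finrank ℤ (Sf φ) = 16) : DV B φ h.V := by
  classical
  have fe := h.fiber_eq hd
  have c4 := (h.cnt16 hd).1
  have hx3 : ∀ x w, w + φ w + φ (φ w) = 0 → B (x - φ x) w - B (x - φ x) (φ w) = 3 * B x w := by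
    intro x w hw
    have : B x (w + φ w + φ (φ w)) = 0 := by rw [hw, map_zero]
    simp only [map_add] at this
    simp only [map_sub, LinearMap.sub_apply, h.adj, h.cube]
    linarith
  refine ⟨h.ll.symm, h.iso, h.cube, h.nn, h.memV, ?_, ?_, (h.cnt16 hd).2.2⟩
  · intro v hv w hw
    have := fe v hv
    have hne : (h.W.filter fun x => x - φ x = v).Nonempty := by rw [← Finset.card_pos]; omega
    obtain ⟨x, hx⟩ := hne
    rw [← (Finset.mem_filter.1 hx).2, hx3 x w hw]
    exact dvd_mul_right _ _
  · intro a ha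
    have haS : a ∈ Sf φ := mem_Sf.2 ha
    have m0 := h.mom 0 1 (by norm_num) a haS
    have m1 := h.mom 1 1 (by norm_num) a haS
    have m2 := h.mom 2 1 (by norm_num) a haS
    have m3 := h.mom 3 1 (by norm_num) a haS
    have key : ∑ x ∈ h.ll.sh 2, (((8 - 2 * B x (φ x) : ℚ)) - 6) * ((8 - 2 * B x (φ x) : ℚ) - 8) * ((8 - 2 * B x (φ x) : ℚ) - 10) * (B x a : ℚ) ^ 2 =
       (DD (finrank ℤ (Sf φ)) 3 1 - 24 * DD (finrank ℤ (Sf φ)) 2 1 + 188 * DD (finrank ℤ (Sf φ)) 1 1 - 480 * DD (finrank ℤ (Sf φ)) 0 1) * B a a := by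
      have : (DD (finrank ℤ (Sf φ)) 3 1 - 24 * DD (finrank ℤ (Sf φ)) 2 1 + 188 * DD (finrank ℤ (Sf φ)) 1 1 - 480 * DD (finrank ℤ (Sf φ)) 0 1) * (B a a : ℚ) = 
        DD (finrank ℤ (Sf φ)) 3 1 * (B a a : ℚ) ^ 1 - 24 * (DD (finrank ℤ (Sf φ)) 2 1 * (B a a : ℚ) ^ 1) + 188 * (DD (finrank ℤ (Sf φ)) 1 1 * (B a a : ℚ) ^ 1) - 480 * (DD (finrank ℤ (Sf φ)) 0 1 * (B a a : ℚ) ^ 1) := by ring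
      rw [this, ← m0, ← m1, ← m2, ← m3, Finset.mul_sum, Finset.mul_sum, Finset.mul_sum, ← Finset.sum_sub_distrib, ← Finset.sum_add_distrib, ← Finset.sum_sub_distrib]
      refine Finset.sum_congr rfl fun x _ => by ring
    rw [hd, h.sum_beta (fun b x => ((8 - 2 * b : ℚ) - 6) * ((8 - 2 * b : ℚ) - 8) * ((8 - 2 * b : ℚ) - 10) * (B x a : ℚ) ^ 2)] at key
    rw [L3.n, Finset.card_eq_zero] at c4
    rw [Finset.sum_insert (by decide), Finset.sum_insert (by decide), Finset.sum_insert (by decide), Finset.sum_insert (by decide), Finset.sum_insert (by decide), Finset.sum_singleton, c4] at key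
    simp only [← Finset.mul_sum] at key
    norm_num [DD, CC] at key
    change -(48 * ∑ x ∈ h.W, (B x a : ℚ) ^ 2) + 48 * ∑ x ∈ h.V, (B x a : ℚ) ^ 2 = _ at key
    have hφV : ∀ b : Λ, ∑ x ∈ h.V, (B x (φ b)) ^ 2 = ∑ x ∈ h.V, (B x b) ^ 2 := by
      intro b
      symm
      refine Finset.sum_bij' (fun x _ => φ x) (fun x _ => φ (φ x)) ?_ ?_ ?_ ?_ ?_
      · intro x hx; rw [h.memV] at hx ⊢
        refine ⟨by rw [h.iso, hx.1], ?_⟩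
        rw [← map_add, ← map_add, hx.2, map_zero]
      · intro x hx; rw [h.memV] at hx ⊢
        refine ⟨by rw [h.iso, h.iso, hx.1], ?_⟩
        rw [← map_add, ← map_add, ← map_add, ← map_add, hx.2, map_zero, map_zero]
      · intro x _; exact h.cube x
      · intro x _; exact h.cube x
      · intro x _; rw [h.iso]
    have hW : ∑ x ∈ h.W, (B x a) ^ 2 = 3 * ∑ x ∈ h.V, (B x a) ^ 2 := by
      have e1 : 9 * ∑ x ∈ h.W, (B x a) ^ 2 = ∑ x ∈ h.W, (B (x - φ x) a - B (x - φ x) (φ a)) ^ 2 := by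
        rw [Finset.mul_sum]
        refine Finset.sum_congr rfl fun x _ => ?_
        rw [hx3 x a ha]; ring
      have e2 : ∑ x ∈ h.W, (B (x - φ x) a - B (x - φ x) (φ a)) ^ 2 = ∑ v ∈ h.V, 9 * (B v a - B v (φ a)) ^ 2 := by
        rw [← Finset.sum_fiberwise_of_maps_to (t := h.V) (g := fun x => x - φ x) (fun x hx => h.W_V hx)]
        refine Finset.sum_congr rfl fun v hv => ?_
        rw [Finset.sum_congr rfl (g := fun _ => (B v a - B v (φ a)) ^ 2) (fun x hx => by rw [(Finset.mem_filter.1 hx).2]), Finset.sum_const, fe v hv]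
        simp
      have e3 : ∑ v ∈ h.V, 9 * (B v a - B v (φ a)) ^ 2 = 9 * (2 * ∑ v ∈ h.V, (B v a) ^ 2 + 2 * ∑ v ∈ h.V, (B v (φ a)) ^ 2 - ∑ v ∈ h.V, (B v (φ (φ a))) ^ 2) := by
        rw [Finset.mul_sum, Finset.mul_sum, ← Finset.sum_add_distrib, ← Finset.sum_sub_distrib, Finset.mul_sum]
        refine Finset.sum_congr rfl fun v _ => ?_
        have : B v (a + φ a + φ (φ a)) = 0 := by rw [ha, map_zero]
        simp only [map_add] at this
        have : B v (φ (φ a)) = - B v a - B v (φ a) := by linarith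
        rw [this]; ring
      rw [e2, e3, hφV (φ a), hφV a] at e1
      linarith
    have hW' : ∑ x ∈ h.W, (B x a : ℚ) ^ 2 = 3 * ∑ x ∈ h.V, (B x a : ℚ) ^ 2 := by exact_mod_cast hW
    rw [hW'] at key
    have : ((∑ x ∈ h.V, (B x a) ^ 2 : ℤ) : ℚ) = ((180 * B a a : ℤ) : ℚ) := by
      push_cast; linear_combination (-1 / 96 : ℚ) * key
    exact_mod_cast this
end PartD

section PartE

variable {Λ : Type*} [AddCommGroup Λ] {B : Λ →ₗ[ℤ] Λ →ₗ[ℤ] ℤ} {φ : Λ →ₗ[ℤ] Λ} {V : Finset Λ}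

def al (B : Λ →ₗ[ℤ] Λ →ₗ[ℤ] ℤ) (φ : Λ →ₗ[ℤ] Λ) (w f : Λ) : ℤ := (B w f - B w (φ (φ f))) / 3
def be (B : Λ →ₗ[ℤ] Λ →ₗ[ℤ] ℤ) (φ : Λ →ₗ[ℤ] Λ) (w f : Λ) : ℤ := (B w (φ f) - B w (φ (φ f))) / 3
def gg (B : Λ →ₗ[ℤ] Λ →ₗ[ℤ] ℤ) (φ : Λ →ₗ[ℤ] Λ) (w f : Λ) : Λ := al B φ w f • f + be B φ w f • φ f
def nm (B : Λ →ₗ[ℤ] Λ →ₗ[ℤ] ℤ) (φ : Λ →ₗ[ℤ] Λ) (w f : Λ) : ℤ :=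
  al B φ w f ^ 2 - al B φ w f * be B φ w f + be B φ w f ^ 2
def InS (φ : Λ →ₗ[ℤ] Λ) (w : Λ) : Prop := w + φ w + φ (φ w) = 0

lemma InS.add {v w : Λ} (hv : InS φ v) (hw : InS φ w) : InS φ (v + w) := by
  have : v + w + φ (v + w) + φ (φ (v + w)) = (v + φ v + φ (φ v)) + (w + φ w + φ (φ w)) := by
    simp only [map_add]; abel
  rw [InS, this, hv, hw, add_zero]
lemma InS.smul {v : Λ} (k : ℤ) (hv : InS φ v) : InS φ (k • v) := by
  have : k • v + φ (k • v) + φ (φ (k • v)) = k • (v + φ v + φ (φ v)) := by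
    simp only [_root_.map_smul, smul_add]
  rw [InS, this, hv, smul_zero]
lemma InS.neg {v : Λ} (hv : InS φ v) : InS φ (-v) := by simpa using hv.smul (-1)
lemma InS.sub {v w : Λ} (hv : InS φ v) (hw : InS φ w) : InS φ (v - w) := by
  rw [sub_eq_add_neg]; exact hv.add hw.neg
lemma InS.phi {v : Λ} (hv : InS φ v) : InS φ (φ v) := by
  rw [InS, ← map_add, ← map_add, hv, map_zero]

lemma DV.inS (h : DV B φ V) {v : Λ} (hv : v ∈ V) : InS φ v := ((h.memV v).1 hv).2
lemma DV.nrm (h : DV B φ V) {v : Λ} (hv : v ∈ V) : B v v = 4 := ((h.memV v).1 hv).1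
lemma DV.mk_mem (h : DV B φ V) {v : Λ} (hv : InS φ v) (h4 : B v v = 4) : v ∈ V := (h.memV v).2 ⟨h4, hv⟩
lemma DV.adj (h : DV B φ V) (x y : Λ) : B (φ x) y = B x (φ (φ y)) := by
  rw [← h.iso x, h.cube]
lemma DV.adj2 (h : DV B φ V) (x y : Λ) : B (φ (φ x)) y = B x (φ y) := by
  rw [h.adj, h.adj, h.cube]
lemma DV.nonneg (h : DV B φ V) (x : Λ) : 0 ≤ B x x := by
  by_cases h0 : x = 0
  · simp [h0]
  · linarith [h.nn x h0]
lemma DV.eq0 (h : DV B φ V) {x : Λ} (hx : B x x ≤ 2) : x = 0 := by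
  by_contra h0
  linarith [h.nn x h0]
lemma DV.neg_mem (h : DV B φ V) {v : Λ} (hv : v ∈ V) : -v ∈ V :=
  h.mk_mem (h.inS hv).neg (by simp [h.nrm hv])
lemma DV.phi_mem (h : DV B φ V) {v : Λ} (hv : v ∈ V) : φ v ∈ V :=
  h.mk_mem (h.inS hv).phi (by rw [h.iso, h.nrm hv])

lemma DV.ab (h : DV B φ V) {w f : Λ} (hw : InS φ w) (hf : f ∈ V) :
    B w f = 2 * al B φ w f - be B φ w f ∧ B w (φ f) = 2 * be B φ w f - al B φ w f ∧
    B w (φ (φ f)) = - al B φ w f - be B φ w f := by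
  have t1 := h.tri f hf w hw
  have t2 := h.tri f hf (φ w) hw.phi
  rw [← h.adj2, h.symm f, h.symm (φ (φ f))] at t1
  rw [← h.adj2, ← h.adj, h.symm (φ f), h.symm (φ (φ f))] at t2
  have t3 : B w (f + φ f + φ (φ f)) = 0 := by rw [h.inS hf, map_zero]
  simp only [map_add] at t3
  unfold al be
  omega

lemma DV.self (h : DV B φ V) {f : Λ} (hf : f ∈ V) : B f (φ f) = -2 ∧ B f (φ (φ f)) = -2 := by
  have t3 : B f (f + φ f + φ (φ f)) = 0 := by rw [h.inS hf, map_zero]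
  have t : B f (φ (φ f)) = B f (φ f) := by rw [h.symm, h.adj2]
  simp only [map_add, h.nrm hf, t] at t3
  omega

lemma DV.ab_eq (h : DV B φ V) {w f : Λ} (hw : InS φ w) (hf : f ∈ V) (a b : ℤ)
    (h1 : B w f = 2 * a - b) (h2 : B w (φ f) = 2 * b - a) : al B φ w f = a ∧ be B φ w f = b := by
  have := h.ab hw hf
  omega

lemma DV.gg_inS (h : DV B φ V) {w f : Λ} (hf : f ∈ V) : InS φ (gg B φ w f) :=
  ((h.inS hf).smul _).add ((h.inS hf).phi.smul _)

lemma DV.gg_apply (h : DV B φ V) {w f y : Λ} (hf : f ∈ V) (hy : InS φ y) :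
    B (gg B φ w f) y = al B φ w f * (2 * al B φ y f - be B φ y f) + be B φ w f * (2 * be B φ y f - al B φ y f) := by
  obtain ⟨h1, h2, h3⟩ := h.ab hy hf
  rw [gg, map_add, LinearMap.add_apply, _root_.map_smul, _root_.map_smul, LinearMap.smul_apply, LinearMap.smul_apply, h.symm f, h.symm (φ f), h1, h2]
  simp

lemma DV.gg_ab (h : DV B φ V) {w f : Λ} (hf : f ∈ V) :
    al B φ (gg B φ w f) f = 2 * al B φ w f ∧ be B φ (gg B φ w f) f = 2 * be B φ w f := by
  obtain ⟨h1, h2⟩ := h.self hf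
  apply h.ab_eq (h.gg_inS hf) hf
  · rw [gg, map_add, LinearMap.add_apply, _root_.map_smul, _root_.map_smul, LinearMap.smul_apply, LinearMap.smul_apply, h.adj, h2, h.nrm hf]
    simp; ring
  · rw [gg, map_add, LinearMap.add_apply, _root_.map_smul, _root_.map_smul, LinearMap.smul_apply, LinearMap.smul_apply, h.iso, h1, h.nrm hf]
    simp; ring

lemma DV.gg_self (h : DV B φ V) {w f : Λ} (hf : f ∈ V) : B (gg B φ w f) (gg B φ w f) = 4 * nm B φ w f := by
  obtain ⟨h1, h2⟩ := h.gg_ab (w := w) hf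
  rw [h.gg_apply hf (h.gg_inS hf), h1, h2, nm]; ring

lemma DV.gg_w (h : DV B φ V) {w f : Λ} (hw : InS φ w) (hf : f ∈ V) : B w (gg B φ w f) = 2 * nm B φ w f := by
  rw [h.symm, h.gg_apply hf hw, nm]; ring

lemma ab_of_nm0 {a b : ℤ} (h : a ^ 2 - a * b + b ^ 2 = 0) : a = 0 ∧ b = 0 := by
  have h1 : a ^ 2 + b ^ 2 + (a - b) ^ 2 = 0 := by linarith
  constructor
  · nlinarith [sq_nonneg a, sq_nonneg b, sq_nonneg (a - b)]
  · nlinarith [sq_nonneg a, sq_nonneg b, sq_nonneg (a - b)]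

lemma ab_of_nm1 {a b : ℤ} (h : a ^ 2 - a * b + b ^ 2 = 1) :
    (a = 1 ∧ b = 0) ∨ (a = 0 ∧ b = 1) ∨ (a = -1 ∧ b = -1) ∨ (a = -1 ∧ b = 0) ∨ (a = 0 ∧ b = -1) ∨ (a = 1 ∧ b = 1) := by
  have h1 : a ^ 2 + b ^ 2 + (a - b) ^ 2 = 2 := by linarith
  have : a ≤ 1 := by nlinarith [sq_nonneg b, sq_nonneg (a - b)]
  have : -1 ≤ a := by nlinarith [sq_nonneg b, sq_nonneg (a - b)]
  have : b ≤ 1 := by nlinarith [sq_nonneg a, sq_nonneg (a - b)]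
  have : -1 ≤ b := by nlinarith [sq_nonneg a, sq_nonneg (a - b)]
  interval_cases a <;> interval_cases b <;> simp_all

/-- orthogonality in the hermitian sense -/
lemma DV.nm0_ab {w f : Λ} (h0 : nm B φ w f = 0) : al B φ w f = 0 ∧ be B φ w f = 0 := ab_of_nm0 h0

lemma DV.nm0 (h : DV B φ V) {w f : Λ} (hw : InS φ w) (hf : f ∈ V) :
    nm B φ w f = 0 ↔ B w f = 0 ∧ B w (φ f) = 0 := by
  obtain ⟨h1, h2, h3⟩ := h.ab hw hf
  constructor
  · intro h0
    obtain ⟨a, b⟩ := ab_of_nm0 h0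
    rw [h1, h2, a, b]; simp
  · rintro ⟨a, b⟩
    have : al B φ w f = 0 := by omega
    have : be B φ w f = 0 := by omega
    simp [nm, *]

lemma DV.gg_eq0 {w f : Λ} (h0 : nm B φ w f = 0) : gg B φ w f = 0 := by
  obtain ⟨a, b⟩ := ab_of_nm0 h0
  simp [gg, a, b]

lemma DV.nm_symm (h : DV B φ V) {w f : Λ} (hw : w ∈ V) (hf : f ∈ V) : nm B φ w f = nm B φ f w := by
  obtain ⟨h1, h2, h3⟩ := h.ab (h.inS hw) hf
  have := h.ab_eq (h.inS hf) hw (al B φ w f - be B φ w f) (- be B φ w f) (by rw [h.symm, h1]; ring)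
    (by rw [← h.adj2, h.symm, h3]; ring)
  rw [nm, nm, this.1, this.2]; ring

lemma DV.ip (h : DV B φ V) {v w : Λ} (hv : v ∈ V) (hw : w ∈ V) :
    (B v w = 4 ∧ v = w) ∨ (B v w = -4 ∧ v = -w) ∨ (-2 ≤ B v w ∧ B v w ≤ 2) := by
  have e1 : B (v - w) (v - w) = 8 - 2 * B v w := by
    simp only [map_sub, LinearMap.sub_apply, h.nrm hv, h.nrm hw, h.symm w v]; ring
  have e2 : B (v + w) (v + w) = 8 + 2 * B v w := by
    simp only [map_add, LinearMap.add_apply, h.nrm hv, h.nrm hw, h.symm w v]; ring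
  by_cases h1 : v = w
  · left; rw [← h1]; exact ⟨h.nrm hv, rfl⟩
  by_cases h2 : v = -w
  · right; left; rw [h2]; simp [h.nrm hw]
  have n1 := h.nn _ (sub_ne_zero.2 h1)
  have n2 := h.nn (v + w) (fun h0 => h2 (eq_neg_of_add_eq_zero_left h0))
  omega

variable [DecidableEq Λ]

def Par (φ : Λ →ₗ[ℤ] Λ) (f : Λ) : Finset Λ := {f, φ f, φ (φ f), -f, -φ f, -φ (φ f)}

lemma DV.Par_card (h : DV B φ V) {f : Λ} (hf : f ∈ V) : (Par φ f).card = 6 := by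
  apply le_antisymm
  · exact Finset.card_le_six
  · have : ((Par φ f).image fun x => (B x f, B x (φ f))) = {(4,-2), (-2,4), (-2,-2), (-4,2), (2,-4), (2,2)} := by
      obtain ⟨h1, h2⟩ := h.self hf
      simp only [Par, Finset.image_insert, Finset.image_singleton, map_neg, LinearMap.neg_apply, h.iso, h1, h.nrm hf, h.adj2, h.adj, h2, neg_neg]
    have c := Finset.card_image_le (s := Par φ f) (f := fun x => (B x f, B x (φ f)))
    rw [this] at c
    exact c

lemma DV.Par_sub (h : DV B φ V) {f : Λ} (hf : f ∈ V) : Par φ f ⊆ V := by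
  intro x hx
  simp only [Par, Finset.mem_insert, Finset.mem_singleton] at hx
  rcases hx with rfl | rfl | rfl | rfl | rfl | rfl
  · exact hf
  · exact h.phi_mem hf
  · exact h.phi_mem (h.phi_mem hf)
  · exact h.neg_mem hf
  · exact h.neg_mem (h.phi_mem hf)
  · exact h.neg_mem (h.phi_mem (h.phi_mem hf))

lemma DV.Par_nm (h : DV B φ V) {f x : Λ} (hf : f ∈ V) (hx : x ∈ Par φ f) : nm B φ x f = 4 := by
  have hxV := h.inS (h.Par_sub hf hx)
  obtain ⟨h1, h2⟩ := h.self hf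
  simp only [Par, Finset.mem_insert, Finset.mem_singleton] at hx
  have key : ∀ a b : ℤ, B x f = 2 * a - b → B x (φ f) = 2 * b - a → a ^ 2 - a * b + b ^ 2 = 4 → nm B φ x f = 4 := by
    intro a b e1 e2 e3
    obtain ⟨e4, e5⟩ := h.ab_eq hxV hf a b e1 e2
    rw [nm, e4, e5, e3]
  rcases hx with rfl | rfl | rfl | rfl | rfl | rfl
  · apply key 2 0 <;> simp [h1, h.nrm hf]
  · apply key 0 2 <;> simp [h2, h.nrm hf, h.iso, h.adj]
  · apply key (-2) (-2) <;> simp [h1, h2, h.iso, h.adj2, h.adj]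
  · apply key (-2) 0 <;> simp [h1, h.nrm hf]
  · apply key 0 (-2) <;> simp [h2, h.nrm hf, h.iso, h.adj]
  · apply key 2 2 <;> simp [h1, h2, h.iso, h.adj2, h.adj]

lemma DV.nm_cases (h : DV B φ V) {v f : Λ} (hv : v ∈ V) (hf : f ∈ V) :
    nm B φ v f = 0 ∨ nm B φ v f = 1 ∨ (nm B φ v f = 4 ∧ v ∈ Par φ f) := by
  by_cases hP : v ∈ Par φ f
  · exact Or.inr (Or.inr ⟨h.Par_nm hf hP, hP⟩)
  have hP' := hP
  simp only [Par, Finset.mem_insert, Finset.mem_singleton, not_or] at hP'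
  obtain ⟨q1, q2, q3, q4, q5, q6⟩ := hP'
  have i1 := h.ip hv hf
  have i2 := h.ip hv (h.phi_mem hf)
  have i3 := h.ip hv (h.phi_mem (h.phi_mem hf))
  simp only [q1, q2, q3, q4, q5, q6, and_false, false_or] at i1 i2 i3
  obtain ⟨h1, h2, h3⟩ := h.ab (h.inS hv) hf
  rw [h1] at i1
  rw [h2] at i2
  rw [h3] at i3
  unfold nm
  generalize al B φ v f = a at *
  generalize be B φ v f = b at *
  have : -1 ≤ a := by omega
  have : a ≤ 1 := by omega
  have : -1 ≤ b := by omega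
  have : b ≤ 1 := by omega
  interval_cases a <;> interval_cases b <;> simp_all

lemma DV.nm4 (h : DV B φ V) {v f : Λ} (hv : v ∈ V) (hf : f ∈ V) : nm B φ v f = 4 ↔ v ∈ Par φ f := by
  constructor
  · intro h4
    rcases h.nm_cases hv hf with h0 | h0 | h0
    · omega
    · omega
    · exact h0.2
  · exact h.Par_nm hf

/-- zero product of two short vectors implies hermitian orthogonality -/
lemma DV.nm_of_B0 (h : DV B φ V) {v f : Λ} (hv : v ∈ V) (hf : f ∈ V) (h0 : B v f = 0) : nm B φ v f = 0 := by
  obtain ⟨h1, h2, h3⟩ := h.ab (h.inS hv) hf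
  have hb : be B φ v f = 2 * al B φ v f := by omega
  have : nm B φ v f = 3 * al B φ v f ^ 2 := by rw [nm, hb]; ring
  rcases h.nm_cases hv hf with e | e | ⟨e, _⟩ <;> omega

lemma DV.gg_Par (h : DV B φ V) {w f : Λ} (hf : f ∈ V) (h1 : nm B φ w f = 1) : gg B φ w f ∈ Par φ f := by
  have e : φ (φ f) = -f - φ f := by
    have := h.inS hf
    rw [InS] at this
    rw [← sub_eq_zero, ← this]; abel
  have := ab_of_nm1 h1
  simp only [Par, Finset.mem_insert, Finset.mem_singleton, e, gg]
  rcases this with ⟨a, b⟩ | ⟨a, b⟩ | ⟨a, b⟩ | ⟨a, b⟩ | ⟨a, b⟩ | ⟨a, b⟩ <;> simp only [a, b] <;> simp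
  · right; right; left; abel
  · right; right; right; right; right; abel

lemma DV.gg_V (h : DV B φ V) {w f : Λ} (hf : f ∈ V) (h1 : nm B φ w f = 1) : gg B φ w f ∈ V :=
  h.Par_sub hf (h.gg_Par hf h1)

/-- number of neighbours -/
lemma DV.deg (h : DV B φ V) {f : Λ} (hf : f ∈ V) : (V.filter fun w => nm B φ w f = 1).card = 336 := by
  have s1 := h.frame f (h.inS hf)
  have s2 := h.frame (φ f) (h.inS hf).phi
  have s3 := h.frame (φ (φ f)) (h.inS hf).phi.phi
  rw [h.iso, h.iso, h.nrm hf] at s3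
  rw [h.iso, h.nrm hf] at s2
  rw [h.nrm hf] at s1
  have e : ∑ w ∈ V, 6 * nm B φ w f = 2160 := by
    have : ∀ w ∈ V, 6 * nm B φ w f = B w f ^ 2 + B w (φ f) ^ 2 + B w (φ (φ f)) ^ 2 := by
      intro w hw
      obtain ⟨h1, h2, h3⟩ := h.ab (h.inS hw) hf
      rw [h1, h2, h3, nm]; ring
    rw [Finset.sum_congr rfl this, Finset.sum_add_distrib, Finset.sum_add_distrib, s1, s2, s3]; norm_num
  have e2 : ∀ w ∈ V, nm B φ w f = (if nm B φ w f = 1 then 1 else 0) + (if w ∈ Par φ f then 4 else 0) := by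
    intro w hw
    simp only [← h.nm4 hw hf]
    rcases h.nm_cases hw hf with e | e | ⟨e, _⟩ <;> simp [e]
  rw [← Finset.mul_sum, Finset.sum_congr rfl e2, Finset.sum_add_distrib, Finset.sum_boole, Finset.sum_ite_mem, Finset.inter_eq_right.2 (h.Par_sub hf), Finset.sum_const, h.Par_card hf] at e
  push_cast at e
  have : ((V.filter fun w => nm B φ w f = 1).card : ℤ) = 336 := by simp at e; omega
  exact_mod_cast this

end PartE

section PartF

variable {Λ : Type*} [AddCommGroup Λ] {B : Λ →ₗ[ℤ] Λ →ₗ[ℤ] ℤ} {φ : Λ →ₗ[ℤ] Λ} {V : Finset Λ}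

lemma DV.ab_sub (h : DV B φ V) {v w f : Λ} (hv : InS φ v) (hw : InS φ w) (hf : f ∈ V) :
    al B φ (v - w) f = al B φ v f - al B φ w f ∧ be B φ (v - w) f = be B φ v f - be B φ w f := by
  have h1 := h.ab hv hf
  have h2 := h.ab hw hf
  apply h.ab_eq (hv.sub hw) hf
  · rw [map_sub, LinearMap.sub_apply, h1.1, h2.1]; ring
  · rw [map_sub, LinearMap.sub_apply, h1.2.1, h2.2.1]; ring

lemma DV.ab_neg (h : DV B φ V) {w f : Λ} (hw : InS φ w) (hf : f ∈ V) :
    al B φ (-w) f = - al B φ w f ∧ be B φ (-w) f = - be B φ w f := by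
  have h2 := h.ab hw hf
  apply h.ab_eq hw.neg hf
  · rw [map_neg, LinearMap.neg_apply, h2.1]; ring
  · rw [map_neg, LinearMap.neg_apply, h2.2.1]; ring

lemma DV.gg_orth (h : DV B φ V) {w f f' : Λ} (hf : f ∈ V) (hf' : f' ∈ V) (h0 : nm B φ f f' = 0) :
    al B φ (gg B φ w f) f' = 0 ∧ be B φ (gg B φ w f) f' = 0 := by
  obtain ⟨a, b⟩ := ab_of_nm0 h0
  obtain ⟨h1, h2, h3⟩ := h.ab (h.inS hf) hf'
  rw [a, b] at h1 h2 h3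
  apply h.ab_eq (h.gg_inS hf) hf'
  · simp [gg, h1, h.adj, h3]
  · simp [gg, h2, h.iso, h1]

lemma DV.gg_gg (h : DV B φ V) {w w' f f' : Λ} (hf : f ∈ V) (hf' : f' ∈ V) (h0 : nm B φ f f' = 0) :
    B (gg B φ w f) (gg B φ w' f') = 0 := by
  obtain ⟨a, b⟩ := h.gg_orth (w := w) hf hf' h0
  rw [h.symm, h.gg_apply hf' (h.gg_inS hf), a, b]; simp

lemma DV.rf (h : DV B φ V) {w f : Λ} (hw : w ∈ V) (hf : f ∈ V) (h1 : nm B φ w f = 1) :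
    w - gg B φ w f ∈ V := by
  apply h.mk_mem ((h.inS hw).sub (h.gg_inS hf))
  have := h.gg_w (h.inS hw) hf
  rw [map_sub, map_sub, LinearMap.sub_apply, LinearMap.sub_apply, h.gg_self hf, h.symm (gg B φ w f) w, this, h1, h.nrm hw]
  norm_num

lemma DV.rf_ab (h : DV B φ V) {w f : Λ} (hw : w ∈ V) (hf : f ∈ V) :
    al B φ (w - gg B φ w f) f = - al B φ w f ∧ be B φ (w - gg B φ w f) f = - be B φ w f := by
  obtain ⟨a, b⟩ := h.ab_sub (h.inS hw) (h.gg_inS (w := w) hf) hf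
  obtain ⟨c, d⟩ := h.gg_ab (w := w) hf
  rw [a, b, c, d]
  constructor <;> ring

lemma DV.rf_ab' (h : DV B φ V) {w f f' : Λ} (hw : w ∈ V) (hf : f ∈ V) (hf' : f' ∈ V) (h0 : nm B φ f f' = 0) :
    al B φ (w - gg B φ w f) f' = al B φ w f' ∧ be B φ (w - gg B φ w f) f' = be B φ w f' := by
  obtain ⟨a, b⟩ := h.ab_sub (h.inS hw) (h.gg_inS (w := w) hf) hf'
  obtain ⟨c, d⟩ := h.gg_orth (w := w) hf hf' h0
  rw [a, b, c, d]
  constructor <;> ring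

def sg (B : Λ →ₗ[ℤ] Λ →ₗ[ℤ] ℤ) (φ : Λ →ₗ[ℤ] Λ) (w f : Λ) : ℤ :=
  (2 * al B φ w f - be B φ w f) * (2 * be B φ w f - al B φ w f) * (- al B φ w f - be B φ w f)

lemma sg_ne {w f : Λ} (h1 : nm B φ w f = 1) : sg B φ w f ≠ 0 := by
  rcases ab_of_nm1 h1 with ⟨a, b⟩ | ⟨a, b⟩ | ⟨a, b⟩ | ⟨a, b⟩ | ⟨a, b⟩ | ⟨a, b⟩ <;> simp only [sg, a, b] <;> norm_num

lemma two_card {X : Finset Λ} (r : Λ → Λ) (s : Λ → ℤ) (hr : ∀ x ∈ X, r x ∈ X) (hi : ∀ x ∈ X, r (r x) = x)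
    (hs : ∀ x ∈ X, s (r x) = - s x) (hn : ∀ x ∈ X, s x ≠ 0) : X.card = 2 * (X.filter fun x => 0 < s x).card := by
  rw [← Finset.card_filter_add_card_filter_not (s := X) (fun x => 0 < s x), two_mul]
  congr 1
  refine Finset.card_bij' (fun x _ => r x) (fun x _ => r x) ?_ ?_ ?_ ?_
  · intro x hx
    rw [Finset.mem_filter] at hx ⊢
    have := hn x hx.1
    refine ⟨hr x hx.1, ?_⟩
    rw [hs x hx.1]; omega
  · intro x hx
    rw [Finset.mem_filter] at hx ⊢
    refine ⟨hr x hx.1, ?_⟩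
    rw [hs x hx.1]; omega
  · intro x hx; exact hi x (Finset.mem_filter.1 hx).1
  · intro x hx; exact hi x (Finset.mem_filter.1 hx).1

lemma two_dvd_card {X : Finset Λ} (r : Λ → Λ) (hr : ∀ x ∈ X, r x ∈ X) (hi : ∀ x ∈ X, r (r x) = x)
    (hn : ∀ x ∈ X, r x ≠ x) : 2 ∣ X.card := by
  have : ∑ x ∈ X, (1 : ZMod 2) = 0 :=
    Finset.sum_involution (fun x _ => r x) (fun _ _ => by decide) (fun x hx _ => hn x hx) (fun x hx => hr x hx) (fun x hx => hi x hx)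
  rw [Finset.sum_const, nsmul_eq_mul, mul_one] at this
  exact (ZMod.natCast_eq_zero_iff _ _).1 this

lemma gg_congr {w w' f : Λ} (h : al B φ w f = al B φ w' f ∧ be B φ w f = be B φ w' f) : gg B φ w f = gg B φ w' f := by
  rw [gg, gg, h.1, h.2]
lemma gg_congr_neg {w w' f : Λ} (h : al B φ w f = - al B φ w' f ∧ be B φ w f = - be B φ w' f) : gg B φ w f = - gg B φ w' f := by
  rw [gg, gg, h.1, h.2, neg_smul, neg_smul]; abel
lemma sg_congr {w w' f : Λ} (h : al B φ w f = al B φ w' f ∧ be B φ w f = be B φ w' f) : sg B φ w f = sg B φ w' f := by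
  rw [sg, sg, h.1, h.2]
lemma sg_congr_neg {w w' f : Λ} (h : al B φ w f = - al B φ w' f ∧ be B φ w f = - be B φ w' f) : sg B φ w f = - sg B φ w' f := by
  rw [sg, sg, h.1, h.2]; ring
lemma nm_congr {w w' f : Λ} (h : al B φ w f = al B φ w' f ∧ be B φ w f = be B φ w' f) : nm B φ w f = nm B φ w' f := by
  rw [nm, nm, h.1, h.2]
lemma nm_congr_neg {w w' f : Λ} (h : al B φ w f = - al B φ w' f ∧ be B φ w f = - be B φ w' f) : nm B φ w f = nm B φ w' f := by
  rw [nm, nm, h.1, h.2]; ring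

lemma DV.card8 (h : DV B φ V) {f f' : Λ} (hf : f ∈ V) (hf' : f' ∈ V) (h0 : nm B φ f f' = 0) {X : Finset Λ}
    (hX : ∀ w ∈ X, w ∈ V ∧ nm B φ w f = 1 ∧ nm B φ w f' = 1)
    (h1 : ∀ w ∈ X, w - gg B φ w f ∈ X) (h2 : ∀ w ∈ X, w - gg B φ w f' ∈ X) (h3 : ∀ w ∈ X, -w ∈ X) :
    8 ∣ X.card := by
  have h0' : nm B φ f' f = 0 := by rw [h.nm_symm hf' hf, h0]
  have e1 := two_card (X := X) (fun w => w - gg B φ w f) (fun w => sg B φ w f) h1 (fun w hw => by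
    rw [gg_congr_neg (h.rf_ab (hX w hw).1 hf)]; abel)
    (fun w hw => sg_congr_neg (h.rf_ab (hX w hw).1 hf)) (fun w hw => sg_ne (hX w hw).2.1)
  have e2 := two_card (X := X.filter fun w => 0 < sg B φ w f) (fun w => w - gg B φ w f') (fun w => sg B φ w f')
    (fun w hw => by
      rw [Finset.mem_filter] at hw ⊢
      refine ⟨h2 w hw.1, ?_⟩
      rw [sg_congr (h.rf_ab' (hX w hw.1).1 hf' hf h0')]
      exact hw.2)
    (fun w hw => by
      rw [Finset.mem_filter] at hw
      rw [gg_congr_neg (h.rf_ab (hX w hw.1).1 hf')]; abel)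
    (fun w hw => sg_congr_neg (h.rf_ab (hX w (Finset.mem_filter.1 hw).1).1 hf'))
    (fun w hw => sg_ne (hX w (Finset.mem_filter.1 hw).1).2.2)
  have e3 : 2 ∣ ((X.filter fun w => 0 < sg B φ w f).filter fun w => 0 < sg B φ w f').card := by
    have key : ∀ w ∈ X, (al B φ (gg B φ w f + gg B φ w f' - w) f = al B φ w f ∧ be B φ (gg B φ w f + gg B φ w f' - w) f = be B φ w f) ∧
       (al B φ (gg B φ w f + gg B φ w f' - w) f' = al B φ w f' ∧ be B φ (gg B φ w f + gg B φ w f' - w) f' = be B φ w f') := by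
      intro w hw
      have hwV := (hX w hw).1
      obtain ⟨a1, a2⟩ := h.gg_ab (w := w) hf
      obtain ⟨a3, a4⟩ := h.gg_ab (w := w) hf'
      obtain ⟨b1, b2⟩ := h.gg_orth (w := w) hf hf' h0
      obtain ⟨b3, b4⟩ := h.gg_orth (w := w) hf' hf h0'
      have i1 := h.gg_inS (w := w) hf
      have i2 := h.gg_inS (w := w) hf'
      have i3 := (h.inS hwV).sub i2
      have e : gg B φ w f + gg B φ w f' - w = gg B φ w f - (w - gg B φ w f') := by abel
      rw [e, (h.ab_sub i1 i3 hf).1, (h.ab_sub i1 i3 hf).2, (h.ab_sub i1 i3 hf').1, (h.ab_sub i1 i3 hf').2,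
        (h.ab_sub (h.inS hwV) i2 hf).1, (h.ab_sub (h.inS hwV) i2 hf).2, (h.ab_sub (h.inS hwV) i2 hf').1, (h.ab_sub (h.inS hwV) i2 hf').2,
        a1, a2, a3, a4, b1, b2, b3, b4]
      refine ⟨⟨?_, ?_⟩, ?_, ?_⟩ <;> ring
    apply two_dvd_card (fun w => gg B φ w f + gg B φ w f' - w)
    · intro w hw
      rw [Finset.mem_filter, Finset.mem_filter] at hw ⊢
      obtain ⟨⟨hw, w1⟩, w2⟩ := hw
      obtain ⟨k1, k2⟩ := key w hw
      rw [sg_congr k1, sg_congr k2]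
      refine ⟨⟨?_, w1⟩, w2⟩
      have m1 := h3 _ (h2 _ (h1 w hw))
      rw [gg_congr (h.rf_ab' (hX w hw).1 hf hf' h0)] at m1
      convert m1 using 1; abel
    · intro w hw
      rw [Finset.mem_filter, Finset.mem_filter] at hw
      obtain ⟨k1, k2⟩ := key w hw.1.1
      rw [gg_congr k1, gg_congr k2]; abel
    · intro w hw he
      rw [Finset.mem_filter, Finset.mem_filter] at hw
      obtain ⟨hwV, n1, n2⟩ := hX w hw.1.1
      have hs : B (w + w - gg B φ w f - gg B φ w f') w = 0 := by
        have : w + w - gg B φ w f - gg B φ w f' = 0 := by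
          nth_rewrite 2 [← he]; abel
        rw [this]; simp
      simp only [map_sub, map_add, LinearMap.sub_apply, LinearMap.add_apply] at hs
      rw [h.symm _ w, h.symm (gg B φ w f) w, h.symm (gg B φ w f') w, h.gg_w (h.inS hwV) hf, h.gg_w (h.inS hwV) hf', n1, n2, h.nrm hwV] at hs
      omega
  omega

end PartF

section PartG

variable {Λ : Type*} [AddCommGroup Λ] {B : Λ →ₗ[ℤ] Λ →ₗ[ℤ] ℤ} {φ : Λ →ₗ[ℤ] Λ} {V F : Finset Λ}

lemma dvd_of_eq_zero' {n : ℕ} (h : n = 0) : 8 ∣ n := by omega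
lemma dvd_of_eq' {n m : ℕ} (h : 8 ∣ m) (e : n = m) : 8 ∣ n := by omega

structure Fr (B : Λ →ₗ[ℤ] Λ →ₗ[ℤ] ℤ) (φ : Λ →ₗ[ℤ] Λ) (V F : Finset Λ) : Prop where
  sub : F ⊆ V
  orth : ∀ f ∈ F, ∀ f' ∈ F, f ≠ f' → nm B φ f f' = 0

def JJ (B : Λ →ₗ[ℤ] Λ →ₗ[ℤ] ℤ) (φ : Λ →ₗ[ℤ] Λ) (F : Finset Λ) (w : Λ) : Finset Λ :=
  F.filter fun f => nm B φ w f = 1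
def EE (B : Λ →ₗ[ℤ] Λ →ₗ[ℤ] ℤ) (φ : Λ →ₗ[ℤ] Λ) (V F : Finset Λ) : Finset Λ :=
  V.filter fun w => ∀ f ∈ F, nm B φ w f ≠ 4

lemma mem_JJ {w f : Λ} : f ∈ JJ B φ F w ↔ f ∈ F ∧ nm B φ w f = 1 := Finset.mem_filter
lemma mem_EE {w : Λ} : w ∈ EE B φ V F ↔ w ∈ V ∧ ∀ f ∈ F, nm B φ w f ≠ 4 := Finset.mem_filter

variable [DecidableEq Λ]

lemma Fr.bessel (h : DV B φ V) (hF : Fr B φ V F) {w : Λ} (hw : w ∈ V) {J : Finset Λ} (hJ : J ⊆ JJ B φ F w) :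
    B (w + w - ∑ f ∈ J, gg B φ w f) (w + w - ∑ f ∈ J, gg B φ w f) = 16 - 4 * J.card := by
  have e1 : B w (∑ f ∈ J, gg B φ w f) = 2 * J.card := by
    rw [map_sum, Finset.sum_congr rfl (g := fun _ => (2 : ℤ)), Finset.sum_const, nsmul_eq_mul, mul_comm]
    intro f hf
    have hf := mem_JJ.1 (hJ hf)
    rw [h.gg_w (h.inS hw) (hF.sub hf.1), hf.2]; norm_num
  have e2 : B (∑ f ∈ J, gg B φ w f) (∑ f ∈ J, gg B φ w f) = 4 * J.card := by
    rw [map_sum B, LinearMap.sum_apply, Finset.sum_congr rfl (g := fun _ => (4 : ℤ)), Finset.sum_const, nsmul_eq_mul, mul_comm]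
    intro f hf
    have hf1 := mem_JJ.1 (hJ hf)
    rw [map_sum, Finset.sum_eq_single_of_mem f hf, h.gg_self (hF.sub hf1.1), hf1.2, mul_one]
    intro f' hf' hne
    have hf2 := mem_JJ.1 (hJ hf')
    exact h.gg_gg (hF.sub hf1.1) (hF.sub hf2.1) (hF.orth _ hf1.1 _ hf2.1 hne.symm)
  simp only [map_sub, map_add, LinearMap.sub_apply, LinearMap.add_apply]
  rw [h.symm (∑ f ∈ J, gg B φ w f) w, e1, e2, h.nrm hw]; ring

lemma Fr.J_le (h : DV B φ V) (hF : Fr B φ V F) {w : Λ} (hw : w ∈ V) : (JJ B φ F w).card ≤ 4 := by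
  have e := hF.bessel h hw (Finset.Subset.refl _)
  have := h.nonneg (w + w - ∑ f ∈ JJ B φ F w, gg B φ w f)
  omega

lemma Fr.J_four (h : DV B φ V) (hF : Fr B φ V F) {w : Λ} (hw : w ∈ V) (h4 : (JJ B φ F w).card = 4) :
    w + w = ∑ f ∈ JJ B φ F w, gg B φ w f := by
  have e := hF.bessel h hw (Finset.Subset.refl _)
  rw [← sub_eq_zero]
  apply h.eq0
  rw [e, h4]; norm_num

lemma DV.Par_orth (h : DV B φ V) {f f' x : Λ} (hf : f ∈ V) (hf' : f' ∈ V) (h0 : nm B φ f f' = 0) (hx : x ∈ Par φ f) :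
    nm B φ x f' = 0 := by
  obtain ⟨a, b⟩ := ab_of_nm0 h0
  obtain ⟨h1, h2, h3⟩ := h.ab (h.inS hf) hf'
  rw [a, b] at h1 h2 h3
  rw [h.nm0 (h.inS (h.Par_sub hf hx)) hf']
  simp only [Par, Finset.mem_insert, Finset.mem_singleton] at hx
  rcases hx with rfl | rfl | rfl | rfl | rfl | rfl <;> simp [h.iso, h.adj, h.cube, h1, h2, h3]

lemma Fr.E_card (h : DV B φ V) (hF : Fr B φ V F) : (EE B φ V F).card + 6 * F.card = 720 := by
  have e : (V.filter fun w => ¬ ∀ f ∈ F, nm B φ w f ≠ 4) = F.biUnion (Par φ) := by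
    ext w
    simp only [Finset.mem_filter, Finset.mem_biUnion, not_forall, ne_eq, not_not]
    constructor
    · rintro ⟨hw, f, hf, h4⟩
      exact ⟨f, hf, (h.nm4 hw (hF.sub hf)).1 h4⟩
    · rintro ⟨f, hf, hw⟩
      exact ⟨h.Par_sub (hF.sub hf) hw, f, hf, h.Par_nm (hF.sub hf) hw⟩
  have c := Finset.card_filter_add_card_filter_not (s := V) (fun w => ∀ f ∈ F, nm B φ w f ≠ 4)
  rw [e, Finset.card_biUnion, Finset.sum_congr rfl (g := fun _ => 6) (fun f hf => h.Par_card (hF.sub hf)), Finset.sum_const, h.card] at c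
  · rw [smul_eq_mul] at c
    rw [EE]; omega
  · intro f hf f' hf' hne
    rw [Function.onFun, Finset.disjoint_left]
    intro x hx hx'
    have a := h.Par_nm (hF.sub hf') hx'
    have b := h.Par_orth (hF.sub hf) (hF.sub hf') (hF.orth f hf f' hf' hne) hx
    omega

lemma Fr.E_of (h : DV B φ V) (hF : Fr B φ V F) {w f : Λ} (hw : w ∈ V) (hf : f ∈ F) (h1 : nm B φ w f = 1) : w ∈ EE B φ V F := by
  refine mem_EE.2 ⟨hw, fun f' hf' h4 => ?_⟩
  have hP := (h.nm4 hw (hF.sub hf')).1 h4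
  by_cases e : f' = f
  · rw [e] at h4; omega
  · have := h.Par_orth (hF.sub hf') (hF.sub hf) (hF.orth f' hf' f hf e) hP
    omega

lemma Fr.E_deg (h : DV B φ V) (hF : Fr B φ V F) {f : Λ} (hf : f ∈ F) :
    ((EE B φ V F).filter fun w => f ∈ JJ B φ F w).card = 336 := by
  rw [← h.deg (hF.sub hf)]
  congr 1
  ext w
  simp only [Finset.mem_filter, mem_JJ]
  constructor
  · rintro ⟨a, b, c⟩; exact ⟨(mem_EE.1 a).1, c⟩
  · rintro ⟨a, b⟩; exact ⟨hF.E_of h a hf b, hf, b⟩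

lemma Fr.sumJ (h : DV B φ V) (hF : Fr B φ V F) {K : Finset Λ} (hK : K ⊆ F) :
    ∑ w ∈ EE B φ V F, ((JJ B φ F w) ∩ K).card = 336 * K.card := by
  have : ∀ w ∈ EE B φ V F, ((JJ B φ F w) ∩ K).card = ∑ f ∈ K, if f ∈ JJ B φ F w then 1 else 0 := by
    intro w _
    rw [Finset.sum_boole, Finset.inter_comm, Nat.cast_id, Finset.filter_mem_eq_inter]
  rw [Finset.sum_congr rfl this, Finset.sum_comm, Finset.sum_congr rfl (g := fun _ => 336), Finset.sum_const, smul_eq_mul, mul_comm]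
  intro f hf
  rw [Finset.sum_boole, hF.E_deg h (hK hf), Nat.cast_id]

lemma Fr.sumJ' (h : DV B φ V) (hF : Fr B φ V F) : ∑ w ∈ EE B φ V F, (JJ B φ F w).card = 336 * F.card := by
  rw [← hF.sumJ h (Finset.Subset.refl F)]
  refine Finset.sum_congr rfl fun w _ => ?_
  rw [Finset.inter_eq_left.2 (show JJ B φ F w ⊆ F from Finset.filter_subset _ _)]

lemma Fr.card_le (h : DV B φ V) (hF : Fr B φ V F) : F.card ≤ 8 := by
  have e := hF.E_card h
  have s := hF.sumJ' h
  have : ∑ w ∈ EE B φ V F, (JJ B φ F w).card ≤ (EE B φ V F).card * 4 := by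
    rw [← smul_eq_mul]
    exact Finset.sum_le_card_nsmul _ _ _ fun w hw => hF.J_le h (mem_EE.1 hw).1
  omega

lemma Fr.rf_nm (h : DV B φ V) (hF : Fr B φ V F) {w f : Λ} (hw : w ∈ V) (hf : f ∈ F) :
    ∀ f' ∈ F, nm B φ (w - gg B φ w f) f' = nm B φ w f' := by
  intro f' hf'
  by_cases e : f = f'
  · rw [← e, nm_congr_neg (h.rf_ab hw (hF.sub hf))]
  · rw [nm_congr (h.rf_ab' hw (hF.sub hf) (hF.sub hf') (hF.orth f hf f' hf' e))]

lemma JJ_congr {w w' : Λ} (hn : ∀ f ∈ F, nm B φ w f = nm B φ w' f) : JJ B φ F w = JJ B φ F w' := by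
  unfold JJ
  exact Finset.filter_congr fun f hf => by rw [hn f hf]

lemma Fr.eight2 (h : DV B φ V) (hF : Fr B φ V F) {J : Finset Λ} (h2 : 2 ≤ J.card) :
    8 ∣ ((EE B φ V F).filter fun w => JJ B φ F w = J).card := by
  by_cases hJ : J ⊆ F
  swap
  · refine dvd_of_eq_zero' (Finset.card_eq_zero.2 (Finset.filter_eq_empty_iff.2 ?_))
    rintro w _ rfl
    exact hJ (Finset.filter_subset _ _)
  obtain ⟨f, hf, f', hf', hne⟩ := Finset.one_lt_card.1 h2
  have hX : ∀ w ∈ ((EE B φ V F).filter fun w => JJ B φ F w = J), w ∈ V ∧ ∀ g ∈ J, nm B φ w g = 1 := by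
    intro w hw
    rw [Finset.mem_filter] at hw
    refine ⟨(mem_EE.1 hw.1).1, fun g hg => ?_⟩
    rw [← hw.2] at hg
    exact (mem_JJ.1 hg).2
  have cl : ∀ w ∈ ((EE B φ V F).filter fun w => JJ B φ F w = J), ∀ w' ∈ V, (∀ f ∈ F, nm B φ w' f = nm B φ w f) →
      w' ∈ ((EE B φ V F).filter fun w => JJ B φ F w = J) := by
    intro w hw w' hw' hn
    rw [Finset.mem_filter, mem_EE] at hw ⊢
    refine ⟨⟨hw', fun f hf => ?_⟩, ?_⟩
    · rw [hn f hf]; exact hw.1.2 f hf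
    · rw [JJ_congr hn, hw.2]
  have rc : ∀ g ∈ J, ∀ w ∈ ((EE B φ V F).filter fun w => JJ B φ F w = J), w - gg B φ w g ∈ ((EE B φ V F).filter fun w => JJ B φ F w = J) := by
    intro g hg w hw
    exact cl w hw _ (h.rf (hX w hw).1 (hF.sub (hJ hg)) ((hX w hw).2 g hg)) (hF.rf_nm h (hX w hw).1 (hJ hg))
  apply h.card8 (hF.sub (hJ hf)) (hF.sub (hJ hf')) (hF.orth f (hJ hf) f' (hJ hf') hne)
  · exact fun w hw => ⟨(hX w hw).1, (hX w hw).2 f hf, (hX w hw).2 f' hf'⟩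
  · exact rc f hf
  · exact rc f' hf'
  · intro w hw
    exact cl w hw _ (h.neg_mem (hX w hw).1) fun g hg => nm_congr_neg (h.ab_neg (h.inS (hX w hw).1) (hF.sub hg))

lemma Fr.eight1 (h : DV B φ V) (hF : Fr B φ V F) {f : Λ} (hf : f ∈ F) :
    8 ∣ ((EE B φ V F).filter fun w => JJ B φ F w = {f}).card := by
  have d := hF.E_deg h hf
  rw [Finset.card_eq_sum_card_fiberwise (f := JJ B φ F) (t := F.powerset) (fun w _ => Finset.mem_powerset.2 (Finset.filter_subset _ _)),
    ← Finset.add_sum_erase _ _ (Finset.mem_powerset.2 (Finset.singleton_subset_iff.2 hf))] at d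
  have r : 8 ∣ ∑ J ∈ F.powerset.erase {f}, ((Finset.filter (fun w => f ∈ JJ B φ F w) (EE B φ V F)).filter fun w => JJ B φ F w = J).card := by
    apply Finset.dvd_sum
    intro J hJ
    rw [Finset.mem_erase, Finset.mem_powerset] at hJ
    by_cases hfJ : f ∈ J
    · have : 2 ≤ J.card := by
        by_contra hc
        have : J.card ≤ 1 := by omega
        exact hJ.1 ((Finset.eq_singleton_iff_unique_mem).2 ⟨hfJ, fun x hx => Finset.card_le_one.1 this x hx f hfJ⟩)
      refine dvd_of_eq' (hF.eight2 h this) (congrArg Finset.card ?_)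
      ext w
      simp only [Finset.mem_filter]
      constructor
      · rintro ⟨⟨a, b⟩, c⟩; exact ⟨a, c⟩
      · rintro ⟨a, c⟩; exact ⟨⟨a, by rw [c]; exact hfJ⟩, c⟩
    · refine dvd_of_eq_zero' (Finset.card_eq_zero.2 (Finset.filter_eq_empty_iff.2 ?_))
      rintro w hw rfl
      exact hfJ (Finset.mem_filter.1 hw).2
  have e : ((Finset.filter (fun w => f ∈ JJ B φ F w) (EE B φ V F)).filter fun w => JJ B φ F w = {f}) = (EE B φ V F).filter fun w => JJ B φ F w = {f} := by
    ext w
    simp only [Finset.mem_filter]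
    constructor
    · rintro ⟨⟨a, b⟩, c⟩; exact ⟨a, c⟩
    · rintro ⟨a, c⟩; exact ⟨⟨a, by rw [c]; simp⟩, c⟩
  rw [e] at d
  omega

lemma Fr.J_ne (h : DV B φ V) (hF : Fr B φ V F) (hm : ∀ w ∈ V, ∃ f ∈ F, nm B φ w f ≠ 0) {w : Λ} (hw : w ∈ EE B φ V F) :
    (JJ B φ F w).Nonempty := by
  rw [mem_EE] at hw
  obtain ⟨f, hf, h0⟩ := hm w hw.1
  refine ⟨f, mem_JJ.2 ⟨hf, ?_⟩⟩
  rcases h.nm_cases hw.1 (hF.sub hf) with e | e | e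
  · exact absurd e h0
  · exact e
  · exact absurd e.1 (hw.2 f hf)

lemma Fr.max_card (h : DV B φ V) (hF : Fr B φ V F) (hm : ∀ w ∈ V, ∃ f ∈ F, nm B φ w f ≠ 0) : F.card = 4 ∨ F.card = 8 := by
  have e := hF.E_card h
  have l := hF.card_le h
  have d : 8 ∣ (EE B φ V F).card := by
    rw [Finset.card_eq_sum_card_fiberwise (f := JJ B φ F) (t := F.powerset) (fun w _ => Finset.mem_powerset.2 (Finset.filter_subset _ _))]
    apply Finset.dvd_sum
    intro J hJ
    rw [Finset.mem_powerset] at hJ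
    rcases Nat.lt_or_ge J.card 2 with hc | hc
    · interval_cases hk : J.card
      · refine dvd_of_eq_zero' (Finset.card_eq_zero.2 (Finset.filter_eq_empty_iff.2 ?_))
        rintro w hw rfl
        have := Finset.card_pos.2 (hF.J_ne h hm hw)
        omega
      · obtain ⟨f, rfl⟩ := Finset.card_eq_one.1 hk
        exact hF.eight1 h (hJ (by simp))
    · exact hF.eight2 h hc
  have : 1 ≤ F.card := by
    have : 0 < V.card := by rw [h.card]; norm_num
    obtain ⟨w, hw⟩ := Finset.card_pos.1 this
    obtain ⟨f, hf, _⟩ := hm w hw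
    exact Finset.card_pos.2 ⟨f, hf⟩
  omega

lemma Fr.exists_max (h : DV B φ V) (hF : Fr B φ V F) :
    ∃ F', F ⊆ F' ∧ Fr B φ V F' ∧ ∀ w ∈ V, ∃ f ∈ F', nm B φ w f ≠ 0 := by
  classical
  obtain ⟨F', h1, h2⟩ := Finset.exists_max_image (V.powerset.filter fun G => F ⊆ G ∧ Fr B φ V G) Finset.card
    ⟨F, by rw [Finset.mem_filter, Finset.mem_powerset]; exact ⟨hF.sub, Finset.Subset.refl _, hF⟩⟩
  rw [Finset.mem_filter] at h1
  obtain ⟨a, b, c⟩ := h1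
  refine ⟨F', b, c, fun w hw => ?_⟩
  by_contra hcon
  push Not at hcon
  have hwF : w ∉ F' := by
    intro hwF
    have := hcon w hwF
    have := h.Par_nm hw (x := w) (by simp [Par])
    omega
  have := h2 (insert w F') (by
    rw [Finset.mem_filter, Finset.mem_powerset]
    have s : insert w F' ⊆ V := Finset.insert_subset hw c.sub
    refine ⟨s, b.trans (Finset.subset_insert _ _), s, ?_⟩
    intro f hf f' hf' hne
    rw [Finset.mem_insert] at hf hf'
    rcases hf with rfl | hf
    · rcases hf' with rfl | hf'
      · exact absurd rfl hne
      · exact hcon f' hf'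
    · rcases hf' with rfl | hf'
      · rw [h.nm_symm (c.sub hf) hw]; exact hcon f hf
      · exact c.orth f hf f' hf' hne)
  rw [Finset.card_insert_of_notMem hwF] at this
  omega

end PartG

section PartH

variable {Λ : Type*} [AddCommGroup Λ] {B : Λ →ₗ[ℤ] Λ →ₗ[ℤ] ℤ} {φ : Λ →ₗ[ℤ] Λ} {V F : Finset Λ}
variable [DecidableEq Λ]

lemma Fr.pair (h : DV B φ V) (hF : Fr B φ V F) (hk : F.card = 4 ∨ F.card = 8) :
    ∃ f ∈ F, ∃ f' ∈ F, f ≠ f' ∧ 73 ≤ (V.filter fun w => nm B φ w f = 1 ∧ nm B φ w f' = 1).card := by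
  by_contra hcon
  push Not at hcon
  have e := hF.E_card h
  have s := hF.sumJ' h
  have t : ∑ w ∈ EE B φ V F, (JJ B φ F w).offDiag.card ≤ 72 * F.offDiag.card := by
    have : ∀ w ∈ EE B φ V F, (JJ B φ F w).offDiag.card = ∑ q ∈ F.offDiag, if q ∈ (JJ B φ F w).offDiag then 1 else 0 := by
      intro w _
      rw [Finset.sum_boole, Nat.cast_id, Finset.filter_mem_eq_inter, Finset.inter_eq_right.2]
      exact Finset.offDiag_mono (Finset.filter_subset _ _)
    rw [Finset.sum_congr rfl this, Finset.sum_comm, mul_comm, ← smul_eq_mul]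
    apply Finset.sum_le_card_nsmul
    rintro ⟨f, f'⟩ hq
    obtain ⟨q1, q2, q3⟩ := Finset.mem_offDiag.1 hq
    rw [Finset.sum_boole, Nat.cast_id]
    have := hcon f q1 f' q2 q3
    have l : ((EE B φ V F).filter fun w => (f, f') ∈ (JJ B φ F w).offDiag).card ≤ (V.filter fun w => nm B φ w f = 1 ∧ nm B φ w f' = 1).card := by
      apply Finset.card_le_card
      intro w hw
      simp only [Finset.mem_filter, Finset.mem_offDiag, mem_JJ, mem_EE] at hw ⊢
      exact ⟨hw.1.1, hw.2.1.2, hw.2.2.1.2⟩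
    omega
  have u : ∑ w ∈ EE B φ V F, 4 * (JJ B φ F w).card ≤ ∑ w ∈ EE B φ V F, ((JJ B φ F w).offDiag.card + 6) := by
    apply Finset.sum_le_sum
    intro w _
    rw [Finset.offDiag_card]
    have h4 := Nat.le_mul_self (JJ B φ F w).card
    generalize (JJ B φ F w).card = n at *
    zify [h4]
    rcases Nat.lt_or_ge n 3 with hn | hn
    · interval_cases n <;> norm_num
    · zify at hn; nlinarith
  rw [← Finset.mul_sum, s, Finset.sum_add_distrib, Finset.sum_const, smul_eq_mul] at u
  rw [Finset.offDiag_card] at t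
  rcases hk with hk | hk <;> rw [hk] at e t u <;> omega

lemma DV.Fr4 (h : DV B φ V) {a b c d : Λ} (ha : a ∈ V) (hb : b ∈ V) (hc : c ∈ V) (hd : d ∈ V)
    (h1 : B a b = 0) (h2 : B a c = 0) (h3 : B a d = 0) (h4 : B b c = 0) (h5 : B b d = 0) (h6 : B c d = 0) :
    ∃ F, Fr B φ V F ∧ F.card = 4 ∧ ∑ x ∈ F, x = a + b + c + d := by
  have ne : ∀ {x y : Λ}, x ∈ V → B x y = 0 → x ≠ y := by
    rintro x y hx hxy rfl
    have := h.nrm hx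
    omega
  have n1 := ne ha h1
  have n2 := ne ha h2
  have n3 := ne ha h3
  have n4 := ne hb h4
  have n5 := ne hb h5
  have n6 := ne hc h6
  refine ⟨{a, b, c, d}, ⟨?_, ?_⟩, ?_, ?_⟩
  · intro x hx
    simp only [Finset.mem_insert, Finset.mem_singleton] at hx
    rcases hx with rfl | rfl | rfl | rfl <;> assumption
  · intro f hf f' hf' hne
    simp only [Finset.mem_insert, Finset.mem_singleton] at hf hf'
    rcases hf with rfl | rfl | rfl | rfl <;> rcases hf' with rfl | rfl | rfl | rfl <;>
      first
      | exact absurd rfl hne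
      | (apply h.nm_of_B0 <;> first | assumption | (rw [h.symm]; assumption))
  · rw [Finset.card_insert_of_notMem, Finset.card_insert_of_notMem, Finset.card_pair n6] <;> simp [n1, n2, n3, n4, n5]
  · rw [Finset.sum_insert, Finset.sum_insert, Finset.sum_pair n6]
    · abel
    · simp [n4, n5]
    · simp [n1, n2, n3]

lemma DV.D4 (h : DV B φ V) {w v a b : Λ} (hw : w ∈ V) (hv : v ∈ V) (ha : a ∈ V) (hb : b ∈ V)
    (hab : B a b = 0) (w1 : B w a = 2) (w2 : B w b = 2) (v1 : B v a = 2) (v2 : B v b = 2) (n1 : w ≠ v) (n2 : w ≠ a + b - v) :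
    ∃ F, Fr B φ V F ∧ F.card = 4 ∧ ∑ x ∈ F, x = w + w := by
  have iw := h.inS hw
  have iv := h.inS hv
  have ia := h.inS ha
  have ib := h.inS hb
  have nw := h.nrm hw
  have nv := h.nrm hv
  have na := h.nrm ha
  have nb := h.nrm hb
  have s1 := h.symm a w
  have s2 := h.symm b w
  have s3 := h.symm a v
  have s4 := h.symm b v
  have s5 := h.symm a b
  have s6 := h.symm v w
  have m : a + b - v ∈ V := by
    apply h.mk_mem ((ia.add ib).sub iv)
    simp only [map_add, map_sub, LinearMap.add_apply, LinearMap.sub_apply]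
    omega
  have q : B w v = 2 := by
    have i1 := h.ip hw hv
    have i2 := h.ip hw m
    simp only [map_add, map_sub] at i2
    rcases i1 with i1 | i1 | i1
    · exact absurd i1.2 n1
    · rcases i2 with i2 | i2 | i2
      · exact absurd i2.2 n2
      · omega
      · omega
    · rcases i2 with i2 | i2 | i2
      · exact absurd i2.2 n2
      · omega
      · omega
  obtain ⟨F, f1, f2, f3⟩ := h.Fr4 (a := a) (b := b) (c := w + v - a - b) (d := w - v) ha hb
    (h.mk_mem (((iw.add iv).sub ia).sub ib) (by
      simp only [map_add, map_sub, LinearMap.add_apply, LinearMap.sub_apply]; omega))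
    (h.mk_mem (iw.sub iv) (by
      simp only [map_sub, LinearMap.sub_apply]; omega))
    hab
    (by simp only [map_add, map_sub]; omega)
    (by simp only [map_sub]; omega)
    (by simp only [map_add, map_sub]; omega)
    (by simp only [map_sub]; omega)
    (by simp only [map_add, map_sub, LinearMap.add_apply, LinearMap.sub_apply]; omega)
  exact ⟨F, f1, f2, by rw [f3]; abel⟩

lemma Fr.exists_D4 (h : DV B φ V) (hF : Fr B φ V F) (hk : F.card = 4 ∨ F.card = 8) :
    ∃ G p, Fr B φ V G ∧ G.card = 4 ∧ p ∈ V ∧ ∑ x ∈ G, x = p + p := by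
  obtain ⟨f, hf, f', hf', hne, hc⟩ := hF.pair h hk
  have fV := hF.sub hf
  have fV' := hF.sub hf'
  obtain ⟨⟨a, b⟩, hy, hlt⟩ := Finset.exists_lt_card_fiber_of_mul_lt_card_of_maps_to
    (s := V.filter fun w => nm B φ w f = 1 ∧ nm B φ w f' = 1) (t := Par φ f ×ˢ Par φ f')
    (f := fun w => (gg B φ w f, gg B φ w f')) (n := 2) (fun w hw => by
      rw [Finset.mem_filter] at hw
      rw [Finset.mem_product]
      exact ⟨h.gg_Par fV hw.2.1, h.gg_Par fV' hw.2.2⟩)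
    (by rw [Finset.card_product, h.Par_card fV, h.Par_card fV']; omega)
  rw [Finset.mem_product] at hy
  set X := (V.filter fun w => nm B φ w f = 1 ∧ nm B φ w f' = 1).filter fun w => (gg B φ w f, gg B φ w f') = (a, b) with hX
  have key : ∀ w ∈ X, w ∈ V ∧ B w a = 2 ∧ B w b = 2 ∧ B a b = 0 := by
    intro w hw
    rw [hX, Finset.mem_filter, Finset.mem_filter, Prod.mk.injEq] at hw
    obtain ⟨⟨w1, w2, w3⟩, w4, w5⟩ := hw
    have k1 := h.gg_w (h.inS w1) fV
    have k2 := h.gg_w (h.inS w1) fV'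
    have k3 := h.gg_gg (w := w) (w' := w) fV fV' (hF.orth f hf f' hf' hne)
    rw [w4] at k1 k3
    rw [w5] at k2 k3
    exact ⟨w1, by omega, by omega, k3⟩
  obtain ⟨w, hw⟩ := Finset.card_pos.1 (show 0 < X.card by omega)
  have : 0 < ((X.erase w).erase (a + b - w)).card := by
    have := Finset.pred_card_le_card_erase (s := X.erase w) (a := a + b - w)
    rw [Finset.card_erase_of_mem hw] at this
    omega
  obtain ⟨v, hv⟩ := Finset.card_pos.1 this
  rw [Finset.mem_erase, Finset.mem_erase] at hv
  obtain ⟨v1, v2, v3⟩ := hv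
  obtain ⟨k1, k2, k3, k4⟩ := key w hw
  obtain ⟨l1, l2, l3, _⟩ := key v v3
  obtain ⟨G, g1, g2, g3⟩ := h.D4 k1 l1 (h.Par_sub fV hy.1) (h.Par_sub fV' hy.2) k4 k2 k3 l2 l3 (Ne.symm v2)
    (fun e => v1 (by rw [e]; abel))
  exact ⟨G, w, g1, g2, k1, g3⟩

lemma Fr.D4_notmax (h : DV B φ V) (hF : Fr B φ V F) (hc : F.card = 4) {p : Λ} (hs : ∑ x ∈ F, x = p + p) :
    ¬ ∀ w ∈ V, ∃ f ∈ F, nm B φ w f ≠ 0 := by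
  intro hm
  have e := hF.E_card h
  have s := hF.sumJ' h
  have : (EE B φ V F).card * 2 ≤ ∑ w ∈ EE B φ V F, (JJ B φ F w).card := by
    rw [← smul_eq_mul]
    apply Finset.card_nsmul_le_sum
    intro w hw
    have p1 := Finset.card_pos.2 (hF.J_ne h hm hw)
    by_contra hlt
    obtain ⟨f, hf⟩ := Finset.card_eq_one.1 (show (JJ B φ F w).card = 1 by omega)
    have hfJ : f ∈ JJ B φ F w := by rw [hf]; simp
    obtain ⟨fF, n1⟩ := mem_JJ.1 hfJ
    obtain ⟨wV, w4⟩ := mem_EE.1 hw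
    have z : ∀ f' ∈ F, f' ≠ f → B w f' = 0 ∧ B w (φ f') = 0 := by
      intro f' hf' hne
      rw [← h.nm0 (h.inS wV) (hF.sub hf')]
      rcases h.nm_cases wV (hF.sub hf') with q | q | q
      · exact q
      · have : f' ∈ JJ B φ F w := mem_JJ.2 ⟨hf', q⟩
        rw [hf, Finset.mem_singleton] at this
        exact absurd this hne
      · exact absurd q.1 (w4 f' hf')
    have a1 : B w (p + p) = B w f := by
      rw [← hs, map_sum, Finset.sum_eq_single_of_mem f fF fun f' hf' hne => (z f' hf' hne).1]
    have a2 : B w (φ (p + p)) = B w (φ f) := by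
      rw [← hs, map_sum, map_sum, Finset.sum_eq_single_of_mem f fF fun f' hf' hne => (z f' hf' hne).2]
    obtain ⟨b1, b2, _⟩ := h.ab (h.inS wV) (hF.sub fF)
    simp only [map_add] at a1 a2
    rcases ab_of_nm1 n1 with ⟨x, y⟩ | ⟨x, y⟩ | ⟨x, y⟩ | ⟨x, y⟩ | ⟨x, y⟩ | ⟨x, y⟩ <;> rw [x, y] at b1 b2 <;> omega
  omega

lemma DV.exists8 (h : DV B φ V) : ∃ F, Fr B φ V F ∧ F.card = 8 := by
  obtain ⟨F, _, hF, hm⟩ := Fr.exists_max h (F := ∅) ⟨by simp, by simp⟩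
  obtain ⟨G, p, g1, g2, g3, g4⟩ := hF.exists_D4 h (hF.max_card h hm)
  obtain ⟨K, k1, k2, k3⟩ := g1.exists_max h
  rcases k2.max_card h k3 with hk | hk
  · have : G = K := Finset.eq_of_subset_of_card_le k1 (by omega)
    rw [← this] at k3
    exact absurd k3 (g1.D4_notmax h g2 g4)
  · exact ⟨K, k2, hk⟩

end PartH

section PartI

variable {Λ : Type*} [AddCommGroup Λ] {B : Λ →ₗ[ℤ] Λ →ₗ[ℤ] ℤ} {φ : Λ →ₗ[ℤ] Λ} {V F : Finset Λ}

lemma DV.ab_phi (h : DV B φ V) {w f : Λ} (hw : InS φ w) (hf : f ∈ V) :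
    al B φ (φ w) f = - be B φ w f ∧ be B φ (φ w) f = al B φ w f - be B φ w f := by
  obtain ⟨a, b, c⟩ := h.ab hw hf
  apply h.ab_eq hw.phi hf
  · rw [h.adj, c]; ring
  · rw [h.iso, a]; ring

lemma DV.nm_phi (h : DV B φ V) {w f : Λ} (hw : InS φ w) (hf : f ∈ V) : nm B φ (φ w) f = nm B φ w f := by
  obtain ⟨a, b⟩ := h.ab_phi hw hf
  rw [nm, nm, a, b]; ring

lemma DV.gg_phi (h : DV B φ V) {w f : Λ} (hw : InS φ w) (hf : f ∈ V) : gg B φ (φ w) f = φ (gg B φ w f) := by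
  obtain ⟨a, b⟩ := h.ab_phi hw hf
  have e : φ (φ f) = - f - φ f := by
    have := h.inS hf
    rw [InS] at this
    rw [← sub_eq_zero, ← this]; abel
  rw [gg, gg, a, b, map_add, _root_.map_smul, _root_.map_smul, e]
  module

lemma DV.half (h : DV B φ V) {x y : Λ} (e : x + x = y + y) : x = y := by
  rw [← sub_eq_zero]
  apply h.eq0
  have : B (x - y) ((x + x) - (y + y)) = 0 := by rw [e]; simp
  rw [show (x + x) - (y + y) = (x - y) + (x - y) by abel, map_add] at this
  omega

variable [DecidableEq Λ]

lemma DV.Par_trans (h : DV B φ V) {f x y : Λ} (hx : x ∈ Par φ f) (hy : y ∈ Par φ f) : y ∈ Par φ x := by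
  simp only [Par, Finset.mem_insert, Finset.mem_singleton] at hx hy ⊢
  rcases hx with rfl | rfl | rfl | rfl | rfl | rfl <;> rcases hy with rfl | rfl | rfl | rfl | rfl | rfl <;> simp [h.cube]

lemma DV.Par_B (h : DV B φ V) {f y : Λ} (hf : f ∈ V) (hy : y ∈ Par φ f) :
    (B f y = 4 ∧ y = f) ∨ (B f y = -4 ∧ y = -f) ∨ B f y = 2 ∨ B f y = -2 := by
  obtain ⟨a, b⟩ := h.self hf
  have c := h.nrm hf
  simp only [Par, Finset.mem_insert, Finset.mem_singleton] at hy
  rcases hy with rfl | rfl | rfl | rfl | rfl | rfl <;> simp [a, b, c]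

lemma Fr.four (h : DV B φ V) (hF : Fr B φ V F) (hk : F.card = 8) {w : Λ} (hw : w ∈ EE B φ V F) :
    (JJ B φ F w).card = 4 := by
  have e := hF.E_card h
  have s := hF.sumJ' h
  have : ∑ w ∈ EE B φ V F, (JJ B φ F w).card = ∑ w ∈ EE B φ V F, 4 := by
    rw [s, Finset.sum_const, smul_eq_mul]; omega
  exact (Finset.sum_eq_sum_iff_of_le fun w hw => hF.J_le h (mem_EE.1 hw).1).1 this w hw

lemma Fr.inner (h : DV B φ V) (hF : Fr B φ V F) (hk : F.card = 8) {w v : Λ} (hw : w ∈ EE B φ V F) (hv : v ∈ EE B φ V F) :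
    4 * B w v = ∑ f ∈ JJ B φ F w ∩ JJ B φ F v, B (gg B φ w f) (gg B φ v f) := by
  have e1 := hF.J_four h (mem_EE.1 hw).1 (hF.four h hk hw)
  have e2 := hF.J_four h (mem_EE.1 hv).1 (hF.four h hk hv)
  have : 4 * B w v = B (w + w) (v + v) := by simp only [map_add, LinearMap.add_apply]; ring
  rw [this, e1, e2, map_sum B, LinearMap.sum_apply, ← Finset.filter_mem_eq_inter, Finset.sum_filter]
  refine Finset.sum_congr rfl fun f hf => ?_
  have hf1 := mem_JJ.1 hf
  rw [map_sum]
  split_ifs with hfv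
  · rw [Finset.sum_eq_single_of_mem f hfv]
    intro f' hf' hne
    have hf2 := mem_JJ.1 hf'
    exact h.gg_gg (hF.sub hf1.1) (hF.sub hf2.1) (hF.orth _ hf1.1 _ hf2.1 hne.symm)
  · apply Finset.sum_eq_zero
    intro f' hf'
    have hf2 := mem_JJ.1 hf'
    exact h.gg_gg (hF.sub hf1.1) (hF.sub hf2.1) (hF.orth _ hf1.1 _ hf2.1 fun e => hfv (e ▸ hf'))

lemma Fr.same (h : DV B φ V) {w v : Λ} (hw : w ∈ EE B φ V F) (hv : v ∈ V)
    (hn : ∀ f ∈ F, nm B φ v f = nm B φ w f) : v ∈ EE B φ V F ∧ JJ B φ F v = JJ B φ F w := by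
  refine ⟨mem_EE.2 ⟨hv, fun f hf => ?_⟩, JJ_congr hn⟩
  rw [hn f hf]
  exact (mem_EE.1 hw).2 f hf

lemma Fr.E_phi (h : DV B φ V) (hF : Fr B φ V F) {w : Λ} (hw : w ∈ EE B φ V F) :
    φ w ∈ EE B φ V F ∧ JJ B φ F (φ w) = JJ B φ F w ∧ ∀ f ∈ F, gg B φ (φ w) f = φ (gg B φ w f) := by
  have wV := (mem_EE.1 hw).1
  obtain ⟨a, b⟩ := Fr.same h hw (h.phi_mem wV) fun f hf => h.nm_phi (h.inS wV) (hF.sub hf)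
  exact ⟨a, b, fun f hf => h.gg_phi (h.inS wV) (hF.sub hf)⟩

lemma Fr.E_neg (h : DV B φ V) (hF : Fr B φ V F) {w : Λ} (hw : w ∈ EE B φ V F) :
    -w ∈ EE B φ V F ∧ JJ B φ F (-w) = JJ B φ F w ∧ ∀ f ∈ F, gg B φ (-w) f = - (gg B φ w f) := by
  have wV := (mem_EE.1 hw).1
  obtain ⟨a, b⟩ := Fr.same h hw (h.neg_mem wV) fun f hf => nm_congr_neg (h.ab_neg (h.inS wV) (hF.sub hf))
  exact ⟨a, b, fun f hf => gg_congr_neg (h.ab_neg (h.inS wV) (hF.sub hf))⟩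

lemma Fr.E_flip (h : DV B φ V) (hF : Fr B φ V F) {w f : Λ} (hw : w ∈ EE B φ V F) (hf : f ∈ JJ B φ F w) :
    ∃ v ∈ EE B φ V F, JJ B φ F v = JJ B φ F w ∧ gg B φ v f = - gg B φ w f ∧ ∀ f' ∈ F, f' ≠ f → gg B φ v f' = gg B φ w f' := by
  have wV := (mem_EE.1 hw).1
  obtain ⟨hf, n1⟩ := mem_JJ.1 hf
  obtain ⟨a, b⟩ := Fr.same h hw (h.rf wV (hF.sub hf) n1) (hF.rf_nm h wV hf)
  exact ⟨_, a, b, gg_congr_neg (h.rf_ab wV (hF.sub hf)), fun f' hf' hne =>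
    gg_congr (h.rf_ab' wV (hF.sub hf) (hF.sub hf') (hF.orth f hf f' hf' hne.symm))⟩

lemma Fr.flip1 (h : DV B φ V) (hF : Fr B φ V F) {w f : Λ} (x : Λ) (hw : w ∈ EE B φ V F) (hf : f ∈ JJ B φ F w) :
    ∃ v ∈ EE B φ V F, JJ B φ F v = JJ B φ F w ∧ (gg B φ v f = gg B φ w f ∨ gg B φ v f = - gg B φ w f) ∧
      0 ≤ B x (gg B φ v f) ∧ ∀ f' ∈ F, f' ≠ f → gg B φ v f' = gg B φ w f' := by
  rcases le_total 0 (B x (gg B φ w f)) with q | q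
  · exact ⟨w, hw, rfl, Or.inl rfl, q, fun _ _ _ => rfl⟩
  · obtain ⟨v, a, b, c, d⟩ := hF.E_flip h hw hf
    refine ⟨v, a, b, Or.inr c, ?_, d⟩
    rw [c, map_neg]; omega

lemma Fr.scale (h : DV B φ V) (hF : Fr B φ V F) {w f g : Λ} (hw : w ∈ EE B φ V F) (hf : f ∈ JJ B φ F w)
    (hg : g ∈ Par φ f) : ∃ v ∈ EE B φ V F, JJ B φ F v = JJ B φ F w ∧ gg B φ v f = g := by
  obtain ⟨fF, n1⟩ := mem_JJ.1 hf
  have hp := h.Par_trans (h.gg_Par (hF.sub fF) n1) hg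
  obtain ⟨a1, a2, a3⟩ := hF.E_phi h hw
  obtain ⟨b1, b2, b3⟩ := hF.E_phi h a1
  obtain ⟨c1, c2, c3⟩ := hF.E_neg h hw
  obtain ⟨d1, d2, d3⟩ := hF.E_neg h a1
  obtain ⟨e1, e2, e3⟩ := hF.E_neg h b1
  have a3 := a3 f fF
  have b3 := b3 f fF
  have c3 := c3 f fF
  have d3 := d3 f fF
  have e3 := e3 f fF
  simp only [Par, Finset.mem_insert, Finset.mem_singleton] at hp
  rcases hp with rfl | rfl | rfl | rfl | rfl | rfl
  · exact ⟨_, hw, rfl, rfl⟩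
  · exact ⟨_, a1, a2, a3⟩
  · exact ⟨_, b1, by rw [b2, a2], by rw [b3, a3]⟩
  · exact ⟨_, c1, c2, c3⟩
  · exact ⟨_, d1, by rw [d2, a2], by rw [d3, a3]⟩
  · exact ⟨_, e1, by rw [e2, b2, a2], by rw [e3, b3, a3]⟩

lemma Fr.gV (h : DV B φ V) (hF : Fr B φ V F) {w f : Λ} (hf : f ∈ JJ B φ F w) : gg B φ w f ∈ V :=
  h.gg_V (hF.sub (mem_JJ.1 hf).1) (mem_JJ.1 hf).2
lemma Fr.gP (h : DV B φ V) (hF : Fr B φ V F) {w f : Λ} (hf : f ∈ JJ B φ F w) : gg B φ w f ∈ Par φ f :=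
  h.gg_Par (hF.sub (mem_JJ.1 hf).1) (mem_JJ.1 hf).2
lemma Fr.gB (h : DV B φ V) (hF : Fr B φ V F) {w v f : Λ} (hw : f ∈ JJ B φ F w) (hv : f ∈ JJ B φ F v) :
    (B (gg B φ w f) (gg B φ v f) = 4 ∧ gg B φ v f = gg B φ w f) ∨ (B (gg B φ w f) (gg B φ v f) = -4 ∧ gg B φ v f = -gg B φ w f) ∨
      B (gg B φ w f) (gg B φ v f) = 2 ∨ B (gg B φ w f) (gg B φ v f) = -2 :=
  h.Par_B (hF.gV h hw) (h.Par_trans (hF.gP h hw) (hF.gP h hv))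

lemma Fr.ne1 (h : DV B φ V) (hF : Fr B φ V F) (hk : F.card = 8) {w v : Λ} (hw : w ∈ EE B φ V F) (hv : v ∈ EE B φ V F) :
    (JJ B φ F w ∩ JJ B φ F v).card ≠ 1 := by
  intro h1
  obtain ⟨f, hf⟩ := Finset.card_eq_one.1 h1
  have hfm : f ∈ JJ B φ F w ∩ JJ B φ F v := by rw [hf]; simp
  rw [Finset.mem_inter] at hfm
  have hg : φ (gg B φ w f) ∈ Par φ f := by
    have := hF.gP h hfm.1
    have e := (hF.E_phi h hw)
    rw [← e.2.2 f (mem_JJ.1 hfm.1).1]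
    exact hF.gP h (by rw [e.2.1]; exact hfm.1)
  obtain ⟨u, u1, u2, u3⟩ := hF.scale h hv hfm.2 hg
  have := hF.inner h hk hw u1
  rw [u2, hf, Finset.sum_singleton, u3, (h.self (hF.gV h hfm.1)).1] at this
  omega

lemma Fr.compl (h : DV B φ V) (hF : Fr B φ V F) (hk : F.card = 8) {w : Λ} (hw : w ∈ EE B φ V F) :
    ∃ v ∈ EE B φ V F, JJ B φ F v = F \ JJ B φ F w := by
  have sub : ∀ w, JJ B φ F w ⊆ F := fun w => Finset.filter_subset _ _
  have c4 := hF.four h hk hw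
  have s := hF.sumJ h (sub w)
  have e := hF.E_card h
  by_contra hcon
  push Not at hcon
  have : ∑ v ∈ EE B φ V F, 2 < ∑ v ∈ EE B φ V F, (JJ B φ F v ∩ JJ B φ F w).card := by
    apply Finset.sum_lt_sum
    · intro v hv
      by_contra hlt
      have := hF.ne1 h hk hv hw
      have h0 : (JJ B φ F v ∩ JJ B φ F w) = ∅ := Finset.card_eq_zero.1 (by omega)
      refine hcon v hv (Finset.eq_of_subset_of_card_le ?_ ?_)
      · intro x hx
        rw [Finset.mem_sdiff]
        refine ⟨sub v hx, fun hxw => ?_⟩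
        have : x ∈ (∅ : Finset Λ) := by rw [← h0]; exact Finset.mem_inter.2 ⟨hx, hxw⟩
        simp at this
      · rw [Finset.card_sdiff_of_subset (sub w), hF.four h hk hv]; omega
    · exact ⟨w, hw, by rw [Finset.inter_self, c4]; norm_num⟩
  rw [Finset.sum_const, smul_eq_mul] at this
  omega

lemma Fr.two (h : DV B φ V) (hF : Fr B φ V F) (hk : F.card = 8) {w v : Λ} (hw : w ∈ EE B φ V F) (hv : v ∈ EE B φ V F)
    (h3 : 3 ≤ (JJ B φ F w ∩ JJ B φ F v).card) : JJ B φ F w = JJ B φ F v := by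
  have c1 := hF.four h hk hw
  have c2 := hF.four h hk hv
  have s1 : JJ B φ F w ∩ JJ B φ F v ⊆ JJ B φ F w := Finset.inter_subset_left
  have s2 : JJ B φ F w ∩ JJ B φ F v ⊆ JJ B φ F v := Finset.inter_subset_right
  have l := Finset.card_le_card s1
  rcases Nat.lt_or_ge 3 (JJ B φ F w ∩ JJ B φ F v).card with q | q
  · rw [← Finset.eq_of_subset_of_card_le s1 (by omega)]
    exact Finset.eq_of_subset_of_card_le s2 (by omega)
  · obtain ⟨u, u1, u2⟩ := hF.compl h hk hw
    exfalso
    apply hF.ne1 h hk hv u1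
    have sv : JJ B φ F v ⊆ F := Finset.filter_subset _ _
    have : JJ B φ F v ∩ JJ B φ F u = JJ B φ F v \ JJ B φ F w := by
      rw [u2]
      ext x
      simp only [Finset.mem_inter, Finset.mem_sdiff]
      exact ⟨fun a => ⟨a.1, a.2.2⟩, fun a => ⟨a.1, sv a.1, a.2⟩⟩
    rw [this]
    have := Finset.card_sdiff_add_card_inter (JJ B φ F v) (JJ B φ F w)
    rw [Finset.inter_comm] at this
    omega

lemma Fr.pm (h : DV B φ V) (hF : Fr B φ V F) (hk : F.card = 8) {w v f : Λ} (hw : w ∈ EE B φ V F) (hv : v ∈ EE B φ V F)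
    (hJ : JJ B φ F v = JJ B φ F w) (hf : f ∈ JJ B φ F w) (hg : gg B φ v f = gg B φ w f) :
    ∀ f' ∈ JJ B φ F w, gg B φ v f' = gg B φ w f' ∨ gg B φ v f' = - gg B φ w f' := by
  have c4 := hF.four h hk hw
  obtain ⟨x, y, z, xy, xz, yz, e⟩ := Finset.card_eq_three.1 (show ((JJ B φ F w).erase f).card = 3 by
    rw [Finset.card_erase_of_mem hf]; omega)
  have eJ : JJ B φ F w = insert f {x, y, z} := by rw [← e, Finset.insert_erase hf]
  have me : ∀ t ∈ ({x, y, z} : Finset Λ), t ≠ f ∧ t ∈ JJ B φ F w := by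
    intro t ht
    rw [← e, Finset.mem_erase] at ht
    exact ht
  obtain ⟨xf, xJ⟩ := me x (by simp)
  obtain ⟨yf, yJ⟩ := me y (by simp)
  obtain ⟨zf, zJ⟩ := me z (by simp)
  have sF : ∀ {t}, t ∈ JJ B φ F w → t ∈ F := fun ht => (mem_JJ.1 ht).1
  obtain ⟨a, a1, a2, a3, a4, a5⟩ := hF.flip1 h (gg B φ w x) hv (f := x) (by rw [hJ]; exact xJ)
  obtain ⟨b, b1, b2, b3, b4, b5⟩ := hF.flip1 h (gg B φ w y) a1 (f := y) (by rw [a2, hJ]; exact yJ)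
  obtain ⟨c, c1, c2, c3, c4', c5⟩ := hF.flip1 h (gg B φ w z) b1 (f := z) (by rw [b2, a2, hJ]; exact zJ)
  have cJ : JJ B φ F c = JJ B φ F w := by rw [c2, b2, a2, hJ]
  have cf : gg B φ c f = gg B φ w f := by
    rw [c5 f (sF hf) zf.symm, b5 f (sF hf) yf.symm, a5 f (sF hf) xf.symm, hg]
  have cx : gg B φ c x = gg B φ a x := by
    rw [c5 x (sF xJ) xz, b5 x (sF xJ) xy]
  have cy : gg B φ c y = gg B φ b y := c5 y (sF yJ) yz
  have by' : gg B φ a y = gg B φ v y := a5 y (sF yJ) xy.symm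
  have bz' : gg B φ b z = gg B φ v z := by
    rw [b5 z (sF zJ) yz.symm, a5 z (sF zJ) xz.symm]
  have I := hF.inner h hk hw c1
  rw [cJ, Finset.inter_self, eJ, Finset.sum_insert (by simp [xf.symm, yf.symm, zf.symm]),
    Finset.sum_insert (by simp [xy, xz]), Finset.sum_pair yz, cf, h.nrm (hF.gV h hf)] at I
  have px := hF.gB h xJ (v := c) (by rw [cJ]; exact xJ)
  have py := hF.gB h yJ (v := c) (by rw [cJ]; exact yJ)
  have pz := hF.gB h zJ (v := c) (by rw [cJ]; exact zJ)
  rw [← cx] at a4 a3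
  rw [← cy] at b4 b3
  rw [by'] at b3
  rw [bz'] at c3
  have ip := h.ip (mem_EE.1 hw).1 (mem_EE.1 c1).1
  have ipB : B w c = 4 ∨ B w c ≤ 2 := by omega
  have q : gg B φ c x = gg B φ w x ∧ gg B φ c y = gg B φ w y ∧ gg B φ c z = gg B φ w z := by
    rcases px with px | px | px | px
    · rcases py with py | py | py | py
      · rcases pz with pz | pz | pz | pz
        · exact ⟨px.2, py.2, pz.2⟩
        all_goals omega
      all_goals omega
    all_goals omega
  have fin : ∀ t, gg B φ c t = gg B φ w t → (gg B φ c t = gg B φ v t ∨ gg B φ c t = - gg B φ v t) →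
      (gg B φ v t = gg B φ w t ∨ gg B φ v t = - gg B φ w t) := by
    rintro t h1 (h2 | h2)
    · left; rw [← h1, h2]
    · right; rw [← h1, h2, neg_neg]
  intro f' hf'
  rw [eJ] at hf'
  simp only [Finset.mem_insert, Finset.mem_singleton] at hf'
  rcases hf' with rfl | rfl | rfl | rfl
  · exact Or.inl hg
  · exact fin _ q.1 a3
  · exact fin _ q.2.1 b3
  · exact fin _ q.2.2 c3

lemma Fr.le48 (h : DV B φ V) (hF : Fr B φ V F) (hk : F.card = 8) {w₀ : Λ} (hw₀ : w₀ ∈ EE B φ V F) :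
    ((EE B φ V F).filter fun w => JJ B φ F w = JJ B φ F w₀).card ≤ 48 := by
  have c4 := hF.four h hk hw₀
  obtain ⟨f, hf⟩ := Finset.card_pos.1 (show 0 < (JJ B φ F w₀).card by omega)
  have := Finset.card_le_mul_card_image_of_maps_to (s := (EE B φ V F).filter fun w => JJ B φ F w = JJ B φ F w₀)
    (f := fun w => gg B φ w f) (t := Par φ f) (fun w hw => by
      rw [Finset.mem_filter] at hw
      exact hF.gP h (by rw [hw.2]; exact hf)) 8 (fun g _ => ?_)
  · rw [h.Par_card (hF.sub (mem_JJ.1 hf).1)] at this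
    omega
  · rcases Finset.eq_empty_or_nonempty (((EE B φ V F).filter fun w => JJ B φ F w = JJ B φ F w₀).filter fun w => gg B φ w f = g) with q | ⟨u, hu⟩
    · rw [q]; simp
    · rw [Finset.mem_filter, Finset.mem_filter] at hu
      obtain ⟨⟨u1, u2⟩, u3⟩ := hu
      have hc : (((JJ B φ F w₀).erase f).powerset).card = 8 := by
        rw [Finset.card_powerset, Finset.card_erase_of_mem hf, c4]; norm_num
      rw [← hc]
      apply Finset.card_le_card_of_injOn (fun w => ((JJ B φ F w₀).erase f).filter fun t => gg B φ w t = gg B φ u t)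
      · intro w _
        exact Finset.mem_coe.2 (Finset.mem_powerset.2 (Finset.filter_subset _ _))
      · intro w hw v hv he
        rw [Finset.mem_coe, Finset.mem_filter, Finset.mem_filter] at hw hv
        obtain ⟨⟨w1, w2⟩, w3⟩ := hw
        obtain ⟨⟨v1, v2⟩, v3⟩ := hv
        have fu : f ∈ JJ B φ F u := by rw [u2]; exact hf
        have pw := hF.pm h hk u1 w1 (by rw [w2, u2]) fu (by rw [w3, u3])
        have pv := hF.pm h hk u1 v1 (by rw [v2, u2]) fu (by rw [v3, u3])
        apply h.half
        rw [hF.J_four h (mem_EE.1 w1).1 (hF.four h hk w1), hF.J_four h (mem_EE.1 v1).1 (hF.four h hk v1), w2, v2]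
        refine Finset.sum_congr rfl fun t ht => ?_
        by_cases e : t = f
        · rw [e, w3, v3]
        have iff : gg B φ w t = gg B φ u t ↔ gg B φ v t = gg B φ u t := by
          have := congrArg (fun s => t ∈ s) he
          simp only [Finset.mem_filter, Finset.mem_erase, e, ht, eq_iff_iff] at this
          simpa [e] using this
        have pw := pw t (by rw [u2]; exact ht)
        have pv := pv t (by rw [u2]; exact ht)
        by_cases q : gg B φ w t = gg B φ u t
        · rw [q, iff.1 q]
        · rw [pw.resolve_left q, pv.resolve_left (fun a => q (iff.2 a))]

lemma Fr.triple (h : DV B φ V) (hF : Fr B φ V F) (hk : F.card = 8) {T : Finset Λ} (hT : T ⊆ F) (h3 : T.card = 3) :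
    ∃ w ∈ EE B φ V F, T ⊆ JJ B φ F w := by
  have e := hF.E_card h
  have c1 := Finset.card_le_mul_card_image (s := EE B φ V F) (f := JJ B φ F) 48 (fun J hJ => by
    obtain ⟨w, hw, rfl⟩ := Finset.mem_image.1 hJ
    exact hF.le48 h hk hw)
  have c2 : (((EE B φ V F).image (JJ B φ F)).biUnion fun J => J.powersetCard 3).card = ((EE B φ V F).image (JJ B φ F)).card * 4 := by
    rw [Finset.card_biUnion, Finset.sum_congr rfl (g := fun _ => 4), Finset.sum_const, smul_eq_mul]
    · intro J hJ
      obtain ⟨w, hw, rfl⟩ := Finset.mem_image.1 hJ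
      rw [Finset.card_powersetCard, hF.four h hk hw]; rfl
    · intro J hJ J' hJ' hne
      obtain ⟨w, hw, rfl⟩ := Finset.mem_image.1 hJ
      obtain ⟨v, hv, rfl⟩ := Finset.mem_image.1 hJ'
      rw [Function.onFun, Finset.disjoint_left]
      intro S hS hS'
      rw [Finset.mem_powersetCard] at hS hS'
      apply hne
      apply hF.two h hk hw hv
      rw [← hS.2]
      exact Finset.card_le_card (Finset.subset_inter hS.1 hS'.1)
  have : (((EE B φ V F).image (JJ B φ F)).biUnion fun J => J.powersetCard 3) = F.powersetCard 3 := by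
    apply Finset.eq_of_subset_of_card_le
    · intro S hS
      obtain ⟨J, hJ, hS⟩ := Finset.mem_biUnion.1 hS
      obtain ⟨w, hw, rfl⟩ := Finset.mem_image.1 hJ
      rw [Finset.mem_powersetCard] at hS ⊢
      exact ⟨hS.1.trans (Finset.filter_subset _ _), hS.2⟩
    · rw [c2, Finset.card_powersetCard, hk, show Nat.choose 8 3 = 56 from rfl]
      omega
  have hm : T ∈ F.powersetCard 3 := Finset.mem_powersetCard.2 ⟨hT, h3⟩
  rw [← this] at hm
  obtain ⟨J, hJ, hS⟩ := Finset.mem_biUnion.1 hm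
  obtain ⟨w, hw, rfl⟩ := Finset.mem_image.1 hJ
  exact ⟨w, hw, (Finset.mem_powersetCard.1 hS).1⟩

end PartI

section PartJ

variable {Λ : Type*} [AddCommGroup Λ] {B : Λ →ₗ[ℤ] Λ →ₗ[ℤ] ℤ} {φ : Λ →ₗ[ℤ] Λ} {V F : Finset Λ}
variable [DecidableEq Λ]

lemma Fr.two' (h : DV B φ V) (hF : Fr B φ V F) (hk : F.card = 8) {w v a b c : Λ} (hw : w ∈ EE B φ V F) (hv : v ∈ EE B φ V F)
    (ab : a ≠ b) (ac : a ≠ c) (bc : b ≠ c) (a1 : a ∈ JJ B φ F w) (b1 : b ∈ JJ B φ F w) (c1 : c ∈ JJ B φ F w)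
    (a2 : a ∈ JJ B φ F v) (b2 : b ∈ JJ B φ F v) (c2 : c ∈ JJ B φ F v) : JJ B φ F w = JJ B φ F v := by
  apply hF.two h hk hw hv
  rw [← Finset.card_eq_three.2 ⟨a, b, c, ab, ac, bc, rfl⟩]
  apply Finset.card_le_card
  intro x hx
  simp only [Finset.mem_insert, Finset.mem_singleton] at hx
  rw [Finset.mem_inter]
  rcases hx with rfl | rfl | rfl <;> constructor <;> assumption

lemma Fr.quad (h : DV B φ V) (hF : Fr B φ V F) (hk : F.card = 8) {a b c : Λ} (ha : a ∈ F) (hb : b ∈ F) (hc : c ∈ F)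
    (ab : a ≠ b) (ac : a ≠ c) (bc : b ≠ c) :
    ∃ w ∈ EE B φ V F, ∃ d ∈ F, d ≠ a ∧ d ≠ b ∧ d ≠ c ∧ JJ B φ F w = {a, b, c, d} := by
  have c3 : ({a, b, c} : Finset Λ).card = 3 := Finset.card_eq_three.2 ⟨a, b, c, ab, ac, bc, rfl⟩
  obtain ⟨w, hw, hs⟩ := hF.triple h hk (T := {a, b, c}) (by
    intro x hx
    simp only [Finset.mem_insert, Finset.mem_singleton] at hx
    rcases hx with rfl | rfl | rfl <;> assumption) c3
  have c4 := hF.four h hk hw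
  obtain ⟨d, hd⟩ := Finset.card_eq_one.1 (show (JJ B φ F w \ {a, b, c}).card = 1 by
    rw [Finset.card_sdiff_of_subset hs]; omega)
  have hdm : d ∈ JJ B φ F w \ {a, b, c} := by rw [hd]; simp
  rw [Finset.mem_sdiff] at hdm
  simp only [Finset.mem_insert, Finset.mem_singleton, not_or] at hdm
  refine ⟨w, hw, d, (mem_JJ.1 hdm.1).1, hdm.2.1, hdm.2.2.1, hdm.2.2.2, ?_⟩
  have := Finset.sdiff_union_of_subset hs
  rw [← this, hd]
  ext x
  simp only [Finset.mem_union, Finset.mem_insert, Finset.mem_singleton]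
  tauto

lemma Fr.blocks (h : DV B φ V) (hF : Fr B φ V F) (hk : F.card = 8) :
    ∃ x : Fin 8 → Λ, Function.Injective x ∧ Finset.univ.image x = F ∧
      ∃ w₁ ∈ EE B φ V F, ∃ w₂ ∈ EE B φ V F, ∃ w₃ ∈ EE B φ V F, ∃ w₄ ∈ EE B φ V F,
        JJ B φ F w₁ = Finset.image x {0, 1, 2, 3} ∧ JJ B φ F w₂ = Finset.image x {0, 1, 4, 5} ∧
        JJ B φ F w₃ = Finset.image x {0, 2, 4, 6} ∧ JJ B φ F w₄ = Finset.image x {0, 1, 6, 7} := by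
  obtain ⟨a, b, c, ha, hb, hc, ab, ac, bc⟩ := Finset.two_lt_card_iff.1 (show 2 < F.card by omega)
  obtain ⟨w₁, e₁, d, hd, da, db, dc, J₁⟩ := hF.quad h hk ha hb hc ab ac bc
  have s₁ : JJ B φ F w₁ ⊆ F := Finset.filter_subset _ _
  obtain ⟨p, hp⟩ := Finset.card_pos.1 (show 0 < (F \ JJ B φ F w₁).card by
    rw [Finset.card_sdiff_of_subset s₁, hF.four h hk e₁]; omega)
  rw [Finset.mem_sdiff, J₁] at hp
  simp only [Finset.mem_insert, Finset.mem_singleton, not_or] at hp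
  obtain ⟨hp, pa, pb, pc, pd⟩ := hp
  obtain ⟨w₂, e₂, q, hq, qa, qb, qp, J₂⟩ := hF.quad h hk ha hb hp ab (Ne.symm pa) (Ne.symm pb)
  have J12 : JJ B φ F w₁ ≠ JJ B φ F w₂ := by
    intro e
    have : p ∈ JJ B φ F w₁ := by rw [e, J₂]; simp
    rw [J₁] at this
    simp [pa, pb, pc, pd] at this
  have qc : q ≠ c := by
    rintro rfl
    exact J12 (hF.two' h hk e₁ e₂ ab (Ne.symm qa) (Ne.symm qb) (by simp [J₁]) (by simp [J₁]) (by simp [J₁]) (by simp [J₂]) (by simp [J₂]) (by simp [J₂]))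
  have qd : q ≠ d := by
    rintro rfl
    exact J12 (hF.two' h hk e₁ e₂ ab (Ne.symm qa) (Ne.symm qb) (by simp [J₁]) (by simp [J₁]) (by simp [J₁]) (by simp [J₂]) (by simp [J₂]) (by simp [J₂]))
  obtain ⟨w₃, e₃, r, hr, ra, rc, rp, J₃⟩ := hF.quad h hk ha hc hp ac (Ne.symm pa) (Ne.symm pc)
  have J13 : JJ B φ F w₁ ≠ JJ B φ F w₃ := by
    intro e
    have : p ∈ JJ B φ F w₁ := by rw [e, J₃]; simp
    rw [J₁] at this
    simp [pa, pb, pc, pd] at this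
  have J23 : JJ B φ F w₂ ≠ JJ B φ F w₃ := by
    intro e
    have : c ∈ JJ B φ F w₂ := by rw [e, J₃]; simp
    rw [J₂] at this
    simp [Ne.symm ac, Ne.symm bc, Ne.symm pc, Ne.symm qc] at this
  have rb : r ≠ b := by
    rintro rfl
    exact J13 (hF.two' h hk e₁ e₃ ac (Ne.symm ra) (Ne.symm rc) (by simp [J₁]) (by simp [J₁]) (by simp [J₁]) (by simp [J₃]) (by simp [J₃]) (by simp [J₃]))
  have rd : r ≠ d := by
    rintro rfl
    exact J13 (hF.two' h hk e₁ e₃ ac (Ne.symm ra) (Ne.symm rc) (by simp [J₁]) (by simp [J₁]) (by simp [J₁]) (by simp [J₃]) (by simp [J₃]) (by simp [J₃]))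
  have rq : r ≠ q := by
    rintro rfl
    exact J23 (hF.two' h hk e₂ e₃ (Ne.symm pa) (Ne.symm ra) (Ne.symm rp) (by simp [J₂]) (by simp [J₂]) (by simp [J₂]) (by simp [J₃]) (by simp [J₃]) (by simp [J₃]))
  obtain ⟨w₄, e₄, t, ht, ta, tb, tr, J₄⟩ := hF.quad h hk ha hb hr ab (Ne.symm ra) (Ne.symm rb)
  have J14 : JJ B φ F w₁ ≠ JJ B φ F w₄ := by
    intro e
    have : r ∈ JJ B φ F w₁ := by rw [e, J₄]; simp
    rw [J₁] at this
    simp [ra, rb, rc, rd] at this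
  have J24 : JJ B φ F w₂ ≠ JJ B φ F w₄ := by
    intro e
    have : r ∈ JJ B φ F w₂ := by rw [e, J₄]; simp
    rw [J₂] at this
    simp [ra, rb, rp, rq] at this
  have tc : t ≠ c := by
    rintro rfl
    exact J14 (hF.two' h hk e₁ e₄ ab (Ne.symm ta) (Ne.symm tb) (by simp [J₁]) (by simp [J₁]) (by simp [J₁]) (by simp [J₄]) (by simp [J₄]) (by simp [J₄]))
  have td : t ≠ d := by
    rintro rfl
    exact J14 (hF.two' h hk e₁ e₄ ab (Ne.symm ta) (Ne.symm tb) (by simp [J₁]) (by simp [J₁]) (by simp [J₁]) (by simp [J₄]) (by simp [J₄]) (by simp [J₄]))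
  have tp : t ≠ p := by
    rintro rfl
    exact J24 (hF.two' h hk e₂ e₄ ab (Ne.symm ta) (Ne.symm tb) (by simp [J₂]) (by simp [J₂]) (by simp [J₂]) (by simp [J₄]) (by simp [J₄]) (by simp [J₄]))
  have tq : t ≠ q := by
    rintro rfl
    exact J24 (hF.two' h hk e₂ e₄ ab (Ne.symm ta) (Ne.symm tb) (by simp [J₂]) (by simp [J₂]) (by simp [J₂]) (by simp [J₄]) (by simp [J₄]) (by simp [J₄]))
  have inj : Function.Injective ![a, b, c, d, p, q, r, t] := by
    have : ∀ i j : Fin 8, i < j → ![a, b, c, d, p, q, r, t] j ≠ ![a, b, c, d, p, q, r, t] i := by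
      intro i j hij
      fin_cases i <;> fin_cases j <;> first
        | (exfalso; revert hij; decide)
        | assumption
        | (apply Ne.symm; assumption)
    intro i j e
    rcases lt_trichotomy i j with q | q | q
    · exact absurd e.symm (this i j q)
    · exact q
    · exact absurd e (this j i q)
  refine ⟨![a, b, c, d, p, q, r, t], inj, ?_, w₁, e₁, w₂, e₂, w₃, e₃, w₄, e₄, ?_, ?_, ?_, ?_⟩
  · apply Finset.eq_of_subset_of_card_le
    · intro x hx
      obtain ⟨i, _, rfl⟩ := Finset.mem_image.1 hx
      fin_cases i <;> assumption
    · rw [Finset.card_image_of_injective _ inj, hk]; simp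
  · rw [J₁]; ext x; simp [eq_comm]
  · rw [J₂]; ext x; simp [eq_comm]
  · rw [J₃]; ext x; simp [eq_comm]
  · rw [J₄]; ext x; simp [eq_comm]

lemma Fr.align (h : DV B φ V) (hF : Fr B φ V F) (hk : F.card = 8) {x : Fin 8 → Λ} (hx : Function.Injective x)
    {w v : Λ} (hw : w ∈ EE B φ V F) (hv : v ∈ EE B φ V F) {s t : Finset (Fin 8)} (hs : JJ B φ F w = s.image x)
    (ht : JJ B φ F v = t.image x) {a b : Fin 8} (hab : a ≠ b) (hst : s ∩ t = {a, b}) (hg : gg B φ v (x a) = gg B φ w (x a)) :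
    ∃ v' ∈ EE B φ V F, JJ B φ F v' = t.image x ∧ gg B φ v' (x b) = gg B φ w (x b) ∧
      ∀ i, x i ∈ F → i ≠ b → gg B φ v' (x i) = gg B φ v (x i) := by
  have am : a ∈ s ∩ t := by rw [hst]; simp
  have bm : b ∈ s ∩ t := by rw [hst]; simp
  rw [Finset.mem_inter] at am bm
  have aw : x a ∈ JJ B φ F w := by rw [hs]; exact Finset.mem_image_of_mem _ am.1
  have bw : x b ∈ JJ B φ F w := by rw [hs]; exact Finset.mem_image_of_mem _ bm.1
  have bv : x b ∈ JJ B φ F v := by rw [ht]; exact Finset.mem_image_of_mem _ bm.2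
  have I := hF.inner h hk hw hv
  rw [hs, ht, ← Finset.image_inter s t hx, hst, Finset.sum_image (fun i _ j _ e => hx e), Finset.sum_pair hab, hg, h.nrm (hF.gV h aw)] at I
  rcases hF.gB h bw bv with q | q | q | q
  · exact ⟨v, hv, ht, q.2, fun _ _ _ => rfl⟩
  · obtain ⟨v', a1, a2, a3, a4⟩ := hF.E_flip h hv bv
    refine ⟨v', a1, by rw [a2, ht], by rw [a3, q.2, neg_neg], fun i hi hib => a4 _ hi fun e => hib (hx e)⟩
  · omega
  · omega

lemma DV.orth2 (h : DV B φ V) {f f' a b : Λ} (hf : f ∈ V) (hf' : f' ∈ V) (h0 : nm B φ f f' = 0) (ha : a ∈ Par φ f) (hb : b ∈ Par φ f') :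
    B a b = 0 ∧ B a (φ b) = 0 := by
  have aV := h.Par_sub hf ha
  have bV := h.Par_sub hf' hb
  rw [← h.nm0 (h.inS aV) bV, h.nm_symm aV bV]
  apply h.Par_orth hf' aV _ hb
  rw [h.nm_symm hf' aV]
  exact h.Par_orth hf hf' h0 ha

lemma Fr.gdata (h : DV B φ V) (hF : Fr B φ V F) (hk : F.card = 8) :
    ∃ g : Fin 8 → Λ, (∀ i, g i ∈ V) ∧ (∀ i j, i ≠ j → B (g i) (g j) = 0 ∧ B (g i) (φ (g j)) = 0) ∧
      (∀ s, InS φ s → (∀ i, B s (g i) = 0 ∧ B s (φ (g i)) = 0) → s = 0) ∧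
      ∃ w₁ ∈ V, ∃ w₂ ∈ V, ∃ w₃ ∈ V, ∃ w₄ ∈ V,
        w₁ + w₁ = g 0 + g 1 + g 2 + g 3 ∧ w₂ + w₂ = g 0 + g 1 + g 4 + g 5 ∧
        w₃ + w₃ = g 0 + g 2 + g 4 + g 6 ∧ w₄ + w₄ = g 0 + g 1 + g 6 + g 7 := by
  obtain ⟨x, hx, xF, w₁, e₁, w₂, e₂, w₃, e₃, w₄, e₄, J₁, J₂, J₃, J₄⟩ := hF.blocks h hk
  have mF : ∀ i, x i ∈ F := fun i => by rw [← xF]; exact Finset.mem_image_of_mem _ (Finset.mem_univ i)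
  have mV : ∀ i, x i ∈ V := fun i => hF.sub (mF i)
  have mJ : ∀ {w : Λ} {s : Finset (Fin 8)} {i : Fin 8}, JJ B φ F w = s.image x → i ∈ s → x i ∈ JJ B φ F w := by
    intro w s i e hi
    rw [e]; exact Finset.mem_image_of_mem _ hi
  have p0 : gg B φ w₁ (x 0) ∈ Par φ (x 0) := hF.gP h (mJ J₁ (by decide))
  obtain ⟨u₂, a1, a2, a3⟩ := hF.scale h e₂ (mJ J₂ (by decide)) p0
  obtain ⟨v₂, b1, b2, b3, b4⟩ := hF.align h hk hx e₁ a1 J₁ (a2.trans J₂) (a := 0) (b := 1) (by decide) (by decide) a3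
  have v20 : gg B φ v₂ (x 0) = gg B φ w₁ (x 0) := by rw [b4 0 (mF 0) (by decide), a3]
  obtain ⟨u₃, c1, c2, c3⟩ := hF.scale h e₃ (mJ J₃ (by decide)) p0
  obtain ⟨t₃, d1, d2, d3, d4⟩ := hF.align h hk hx e₁ c1 J₁ (c2.trans J₃) (a := 0) (b := 2) (by decide) (by decide) c3
  have t30 : gg B φ t₃ (x 0) = gg B φ w₁ (x 0) := by rw [d4 0 (mF 0) (by decide), c3]
  obtain ⟨v₃, k1, k2, k3, k4⟩ := hF.align h hk hx b1 d1 b2 d2 (a := 0) (b := 4) (by decide) (by decide) (t30.trans v20.symm)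
  have v30 : gg B φ v₃ (x 0) = gg B φ w₁ (x 0) := by rw [k4 0 (mF 0) (by decide), t30]
  have v32 : gg B φ v₃ (x 2) = gg B φ w₁ (x 2) := by rw [k4 2 (mF 2) (by decide), d3]
  obtain ⟨u₄, l1, l2, l3⟩ := hF.scale h e₄ (mJ J₄ (by decide)) p0
  obtain ⟨t₄, m1, m2, m3, m4⟩ := hF.align h hk hx e₁ l1 J₁ (l2.trans J₄) (a := 0) (b := 1) (by decide) (by decide) l3
  have t40 : gg B φ t₄ (x 0) = gg B φ w₁ (x 0) := by rw [m4 0 (mF 0) (by decide), l3]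
  obtain ⟨v₄, n1, n2, n3, n4⟩ := hF.align h hk hx k1 m1 k2 m2 (a := 0) (b := 6) (by decide) (by decide) (t40.trans v30.symm)
  have v40 : gg B φ v₄ (x 0) = gg B φ w₁ (x 0) := by rw [n4 0 (mF 0) (by decide), t40]
  have v41 : gg B φ v₄ (x 1) = gg B φ w₁ (x 1) := by rw [n4 1 (mF 1) (by decide), m3]
  have gP : ∀ i, (![gg B φ w₁ (x 0), gg B φ w₁ (x 1), gg B φ w₁ (x 2), gg B φ w₁ (x 3), gg B φ v₂ (x 4), gg B φ v₂ (x 5),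
      gg B φ v₃ (x 6), gg B φ v₄ (x 7)] : Fin 8 → Λ) i ∈ Par φ (x i) := by
    intro i
    fin_cases i
    · exact p0
    · exact hF.gP h (mJ J₁ (by decide))
    · exact hF.gP h (mJ J₁ (by decide))
    · exact hF.gP h (mJ J₁ (by decide))
    · exact hF.gP h (mJ b2 (by decide))
    · exact hF.gP h (mJ b2 (by decide))
    · exact hF.gP h (mJ k2 (by decide))
    · exact hF.gP h (mJ n2 (by decide))
  refine ⟨_, fun i => h.Par_sub (mV i) (gP i), fun i j hij => h.orth2 (mV i) (mV j) (hF.orth _ (mF i) _ (mF j) fun e => hij (hx e)) (gP i) (gP j),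
    ?_, w₁, (mem_EE.1 e₁).1, v₂, (mem_EE.1 b1).1, v₃, (mem_EE.1 k1).1, v₄, (mem_EE.1 n1).1, ?_, ?_, ?_, ?_⟩
  · intro s hs hz
    have z : ∀ i, B s (x i) = 0 ∧ B s (φ (x i)) = 0 ∧ B s (φ (φ (x i))) = 0 := by
      intro i
      have hp := h.Par_trans (gP i) (show x i ∈ Par φ (x i) by simp [Par])
      have hi := h.inS (h.Par_sub (mV i) (gP i))
      obtain ⟨z1, z2⟩ := hz i
      generalize (![gg B φ w₁ (x 0), gg B φ w₁ (x 1), gg B φ w₁ (x 2), gg B φ w₁ (x 3), gg B φ v₂ (x 4), gg B φ v₂ (x 5),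
        gg B φ v₃ (x 6), gg B φ v₄ (x 7)] : Fin 8 → Λ) i = y at *
      have z3 : B s (φ (φ y)) = 0 := by
        have := congrArg (B s) hi
        simp only [map_add, map_zero] at this
        omega
      simp only [Par, Finset.mem_insert, Finset.mem_singleton] at hp
      rcases hp with e | e | e | e | e | e <;> rw [e] <;> simp [z1, z2, z3, h.cube]
    have zf : ∀ f ∈ F, B s f = 0 ∧ B s (φ f) = 0 ∧ B s (φ (φ f)) = 0 := by
      intro f hf
      rw [← xF] at hf
      obtain ⟨i, _, rfl⟩ := Finset.mem_image.1 hf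
      exact z i
    have zV : ∀ w ∈ V, B w s = 0 := by
      intro w hw
      rw [h.symm]
      by_cases hE : w ∈ EE B φ V F
      · have e := congrArg (B s) (hF.J_four h hw (hF.four h hk hE))
        rw [map_add, map_sum, Finset.sum_eq_zero] at e
        · omega
        · intro f hf
          obtain ⟨z1, z2, _⟩ := zf f (mem_JJ.1 hf).1
          simp [gg, z1, z2]
      · have : ∃ f ∈ F, nm B φ w f = 4 := by
          by_contra hcon
          push Not at hcon
          exact hE (mem_EE.2 ⟨hw, hcon⟩)
        obtain ⟨f, hf, h4⟩ := this
        have hp := (h.nm4 hw (hF.sub hf)).1 h4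
        obtain ⟨z1, z2, z3⟩ := zf f hf
        simp only [Par, Finset.mem_insert, Finset.mem_singleton] at hp
        rcases hp with e | e | e | e | e | e <;> rw [e] <;> simp [z1, z2, z3]
    have fr := h.frame s hs
    rw [Finset.sum_eq_zero fun w hw => by rw [zV w hw]; norm_num] at fr
    apply h.eq0; omega
  · have := hF.J_four h (mem_EE.1 e₁).1 (hF.four h hk e₁)
    rw [J₁, Finset.sum_image (fun i _ j _ e => hx e)] at this
    rw [this]; simp [Finset.sum_insert, add_assoc]
  · have := hF.J_four h (mem_EE.1 b1).1 (hF.four h hk b1)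
    rw [b2, Finset.sum_image (fun i _ j _ e => hx e)] at this
    rw [this]; simp [Finset.sum_insert, add_assoc, v20, b3]
  · have := hF.J_four h (mem_EE.1 k1).1 (hF.four h hk k1)
    rw [k2, Finset.sum_image (fun i _ j _ e => hx e)] at this
    rw [this]; simp [Finset.sum_insert, add_assoc, v30, v32, k3]
  · have := hF.J_four h (mem_EE.1 n1).1 (hF.four h hk n1)
    rw [n2, Finset.sum_image (fun i _ j _ e => hx e)] at this
    rw [this]; simp [Finset.sum_insert, add_assoc, v40, v41, n3]

end PartJ

section PartK

def E8I : Matrix (Fin 8) (Fin 8) ℤ :=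
  !![4, 5, 7, 10, 8, 6, 4, 2; 5, 8, 10, 15, 12, 9, 6, 3; 7, 10, 14, 20, 16, 12, 8, 4; 10, 15, 20, 30, 24, 18, 12, 6;
     8, 12, 16, 24, 20, 15, 10, 5; 6, 9, 12, 18, 15, 12, 8, 4; 4, 6, 8, 12, 10, 8, 6, 3; 2, 3, 4, 6, 5, 4, 3, 2]
def M8 : Matrix (Fin 8) (Fin 8) ℤ :=
  !![2, 0, 0, 0, 0, 0, 0, 0; 0, 2, 0, 0, 0, 0, 0, 0; -1, 0, 1, 0, 1, 0, 1, 0; 0, -1, -1, 0, -1, 0, 0, 1;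
     0, 0, 0, 0, 0, 0, 0, -2; 0, 0, 0, 0, 1, 1, -1, 1; 0, 0, 0, 0, 0, -2, 0, 0; 0, 0, 1, 1, -1, 1, 0, 0]
def P8 : Matrix (Fin 8) (Fin 8) ℤ :=
  !![1, 0, 0, 0, 0, 0, 0, 0; 0, 1, 0, 0, 0, 0, 0, 0; -1, -2, -2, -4, -3, -2, -1, 0; 2, 3, 4, 6, 5, 4, 3, 2;
     1, 1, 2, 2, 2, 2, 1, 0; 0, 0, 0, 0, 0, 0, -1, 0; 1, 1, 2, 2, 1, 0, 0, 0; 0, 0, 0, 0, -1, 0, 0, 0]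

lemma E8_inv : E8M * E8I = 1 := by decide
lemma E8_inv' : E8I * E8M = 1 := by decide
lemma M8_gram (i j : Fin 8) : ∑ k, M8 i k * M8 j k = 2 * E8M i j := by revert i j; decide
lemma E8_symm (i j : Fin 8) : E8M i j = E8M j i := by
  have h1 := M8_gram i j
  have h2 := M8_gram j i
  rw [Finset.sum_congr rfl (fun k _ => mul_comm (M8 j k) (M8 i k))] at h2
  omega
lemma P8_M8 (i j : Fin 8) : ∑ k, P8 i k * M8 k j = if i = j then 2 else 0 := by revert i j; decide

variable {Λ : Type*} [AddCommGroup Λ] {B : Λ →ₗ[ℤ] Λ →ₗ[ℤ] ℤ} {φ : Λ →ₗ[ℤ] Λ} {V : Finset Λ}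

structure CB (B : Λ →ₗ[ℤ] Λ →ₗ[ℤ] ℤ) (φ : Λ →ₗ[ℤ] Λ) (V : Finset Λ) (c : Fin 8 → Λ) : Prop where
  mem : ∀ i, c i ∈ V
  g1 : ∀ i j, B (c i) (c j) = 2 * E8M i j
  g2 : ∀ i j, B (c i) (φ (c j)) = - E8M i j
  zero : ∀ s, InS φ s → (∀ i, B s (c i) = 0 ∧ B s (φ (c i)) = 0) → s = 0

lemma DV.exists_c [DecidableEq Λ] (h : DV B φ V) : ∃ c, CB B φ V c := by
  obtain ⟨F, hF, hk⟩ := h.exists8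
  obtain ⟨g, gV, go, gz, w₁, h₁, w₂, h₂, w₃, h₃, w₄, h₄, e₁, e₂, e₃, e₄⟩ := hF.gdata h hk
  have iw₁ := h.inS h₁
  have iw₂ := h.inS h₂
  have iw₃ := h.inS h₃
  have iw₄ := h.inS h₄
  have ig : ∀ i, InS φ (g i) := fun i => h.inS (gV i)
  let c : Fin 8 → Λ := ![g 0, g 1, w₃ - g 0, w₃ + w₄ - g 0 - g 1 - g 2 - g 4 - g 6, - g 7, w₂ + w₄ - g 0 - g 1 - g 6, - g 5, w₁ + w₂ - g 0 - g 1 - g 4]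
  have ci : ∀ i, InS φ (c i) := by
    intro i
    fin_cases i
    · exact ig 0
    · exact ig 1
    · exact iw₃.sub (ig 0)
    · exact (((((iw₃.add iw₄).sub (ig 0)).sub (ig 1)).sub (ig 2)).sub (ig 4)).sub (ig 6)
    · exact (ig 7).neg
    · exact (((iw₂.add iw₄).sub (ig 0)).sub (ig 1)).sub (ig 6)
    · exact (ig 5).neg
    · exact (((iw₁.add iw₂).sub (ig 0)).sub (ig 1)).sub (ig 4)
  have cM : ∀ i, c i + c i = ∑ k, M8 i k • g k := by
    intro i
    fin_cases i
    · show g 0 + g 0 = _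
      simp [Fin.sum_univ_eight, M8]; module
    · show g 1 + g 1 = _
      simp [Fin.sum_univ_eight, M8]; module
    · show w₃ - g 0 + (w₃ - g 0) = _
      rw [show w₃ - g 0 + (w₃ - g 0) = (w₃ + w₃) - g 0 - g 0 by abel, e₃]
      simp [Fin.sum_univ_eight, M8]; abel
    · show (w₃ + w₄ - g 0 - g 1 - g 2 - g 4 - g 6) + (w₃ + w₄ - g 0 - g 1 - g 2 - g 4 - g 6) = _
      rw [show (w₃ + w₄ - g 0 - g 1 - g 2 - g 4 - g 6) + (w₃ + w₄ - g 0 - g 1 - g 2 - g 4 - g 6) = (w₃ + w₃) + (w₄ + w₄) - (g 0 + g 1 + g 2 + g 4 + g 6) - (g 0 + g 1 + g 2 + g 4 + g 6) by abel, e₃, e₄]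
      simp [Fin.sum_univ_eight, M8]; abel
    · show - g 7 + - g 7 = _
      simp [Fin.sum_univ_eight, M8]; module
    · show (w₂ + w₄ - g 0 - g 1 - g 6) + (w₂ + w₄ - g 0 - g 1 - g 6) = _
      rw [show (w₂ + w₄ - g 0 - g 1 - g 6) + (w₂ + w₄ - g 0 - g 1 - g 6) = (w₂ + w₂) + (w₄ + w₄) - (g 0 + g 1 + g 6) - (g 0 + g 1 + g 6) by abel, e₂, e₄]
      simp [Fin.sum_univ_eight, M8]; abel
    · show - g 5 + - g 5 = _
      simp [Fin.sum_univ_eight, M8]; module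
    · show (w₁ + w₂ - g 0 - g 1 - g 4) + (w₁ + w₂ - g 0 - g 1 - g 4) = _
      rw [show (w₁ + w₂ - g 0 - g 1 - g 4) + (w₁ + w₂ - g 0 - g 1 - g 4) = (w₁ + w₁) + (w₂ + w₂) - (g 0 + g 1 + g 4) - (g 0 + g 1 + g 4) by abel, e₁, e₂]
      simp [Fin.sum_univ_eight, M8]; abel
  have gram : ∀ (ψ : Λ →ₗ[ℤ] Λ) (m : ℤ), (∀ k l, B (g k) (ψ (g l)) = if k = l then m else 0) →
      ∀ i j, 4 * B (c i) (ψ (c j)) = m * (2 * E8M i j) := by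
    intro ψ m hm i j
    have : 4 * B (c i) (ψ (c j)) = B (c i + c i) (ψ (c j + c j)) := by simp only [map_add, LinearMap.add_apply]; ring
    rw [this, cM, cM, map_sum B, LinearMap.sum_apply, ← M8_gram, Finset.mul_sum]
    refine Finset.sum_congr rfl fun k _ => ?_
    rw [map_sum ψ, map_sum]
    simp only [_root_.map_smul, LinearMap.smul_apply, smul_eq_mul, hm, mul_ite, mul_zero, Finset.sum_ite_eq, Finset.mem_univ, if_true]
    ring
  have g1 : ∀ i j, B (c i) (c j) = 2 * E8M i j := by
    intro i j
    have := gram LinearMap.id 4 (fun k l => by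
      split_ifs with e
      · rw [e]; exact h.nrm (gV l)
      · exact (go k l e).1) i j
    rw [LinearMap.id_apply] at this
    omega
  have g2 : ∀ i j, B (c i) (φ (c j)) = - E8M i j := by
    intro i j
    have := gram φ (-2) (fun k l => by
      split_ifs with e
      · rw [e]; exact (h.self (gV l)).1
      · exact (go k l e).2) i j
    omega
  refine ⟨c, fun i => h.mk_mem (ci i) ?_, g1, g2, ?_⟩
  · rw [g1]; revert i; decide
  · intro s hs hz
    have key : ∀ (ψ : Λ →ₗ[ℤ] Λ), (∀ i, B s (ψ (c i)) = 0) → ∀ k, B s (ψ (g k)) = 0 := by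
      intro ψ hψ k
      have e : ∑ i, P8 k i * B s (ψ (c i + c i)) = 2 * B s (ψ (g k)) := by
        simp only [cM, map_sum, _root_.map_smul, smul_eq_mul, Finset.mul_sum]
        rw [Finset.sum_comm]
        simp only [← mul_assoc]
        simp only [← Finset.sum_mul, P8_M8]
        simp
      rw [Finset.sum_eq_zero] at e
      · omega
      · intro i _
        rw [map_add, map_add, hψ]; simp
    exact gz s hs fun i => ⟨key LinearMap.id (fun i => (hz i).1) i, key φ (fun i => (hz i).2) i⟩

def Psi (φ : Λ →ₗ[ℤ] Λ) (c : Fin 8 → Λ) : ((Fin 8 → ℤ) × (Fin 8 → ℤ)) →ₗ[ℤ] Λ where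
  toFun z := ∑ i, (z.1 i • c i + z.2 i • φ (c i))
  map_add' x y := by
    rw [← Finset.sum_add_distrib]
    refine Finset.sum_congr rfl fun i _ => ?_
    simp only [Prod.fst_add, Prod.snd_add, Pi.add_apply]
    module
  map_smul' k x := by
    rw [Finset.smul_sum]
    refine Finset.sum_congr rfl fun i _ => ?_
    simp only [Prod.smul_fst, Prod.smul_snd, Pi.smul_apply, RingHom.id_apply, smul_eq_mul]
    module

def Tht : ((Fin 8 → ℤ) × (Fin 8 → ℤ)) →ₗ[ℤ] E83 where
  toFun z := ![z.1, z.2 - z.1, - z.2]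
  map_add' x y := by
    funext j
    fin_cases j <;> simp <;> abel
  map_smul' k x := by
    funext j
    fin_cases j <;> simp [smul_sub]

lemma Tht_inj : Function.Injective Tht := by
  intro x y e
  have e0 := congrFun e 0
  have e2 := congrFun e 2
  simp [Tht] at e0 e2
  exact Prod.ext e0 e2

lemma Tht_range : LinearMap.range Tht = S3exo := by
  ext y
  rw [S3exo, LinearMap.mem_range, LinearMap.mem_range]
  constructor
  · rintro ⟨z, rfl⟩
    refine ⟨![z.1, z.2, 0], ?_⟩
    funext j
    fin_cases j
    · show z.1 - 0 = z.1
      simp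
    · rfl
    · show 0 - z.2 = - z.2
      simp
  · rintro ⟨a, rfl⟩
    refine ⟨(a 0 - a 2, a 1 - a 2), ?_⟩
    funext j
    fin_cases j
    · rfl
    · show (a 1 - a 2) - (a 0 - a 2) = a 1 - a 0
      abel
    · show -(a 1 - a 2) = a 2 - a 1
      abel

lemma E8_dot (x y : Fin 8 → ℤ) : x ⬝ᵥ (E8M *ᵥ y) = y ⬝ᵥ (E8M *ᵥ x) := by
  have : E8Mᵀ = E8M := by ext i j; exact E8_symm j i
  rw [dotProduct_mulVec, ← mulVec_transpose, this, dotProduct_comm]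

lemma bE83_Tht (z z' : (Fin 8 → ℤ) × (Fin 8 → ℤ)) : bE83 (Tht z) (Tht z') =
    - (2 * (z'.1 ⬝ᵥ (E8M *ᵥ z.1)) - z'.1 ⬝ᵥ (E8M *ᵥ z.2) + 2 * (z'.2 ⬝ᵥ (E8M *ᵥ z.2)) - z'.2 ⬝ᵥ (E8M *ᵥ z.1)) := by
  rw [bE83, Fin.sum_univ_three]
  show -(z.1 ⬝ᵥ (E8M *ᵥ z'.1) + (z.2 - z.1) ⬝ᵥ (E8M *ᵥ (z'.2 - z'.1)) + (- z.2) ⬝ᵥ (E8M *ᵥ (- z'.2))) = _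
  simp only [mulVec_sub, mulVec_neg, dotProduct_sub, sub_dotProduct, dotProduct_neg, neg_dotProduct]
  rw [E8_dot z.1 z'.1, E8_dot z.2 z'.2, E8_dot z.2 z'.1, E8_dot z.1 z'.2]
  ring

lemma CB.g3 (h : DV B φ V) {c : Fin 8 → Λ} (hc : CB B φ V c) (i j : Fin 8) : B (φ (c i)) (c j) = - E8M i j := by
  rw [h.symm, hc.g2, E8_symm]

lemma CB.psi_c (h : DV B φ V) {c : Fin 8 → Λ} (hc : CB B φ V c) (z : (Fin 8 → ℤ) × (Fin 8 → ℤ)) (j : Fin 8) :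
    B (Psi φ c z) (c j) = 2 * (E8M *ᵥ z.1) j - (E8M *ᵥ z.2) j ∧
    B (Psi φ c z) (φ (c j)) = 2 * (E8M *ᵥ z.2) j - (E8M *ᵥ z.1) j := by
  have e : Psi φ c z = ∑ i, (z.1 i • c i + z.2 i • φ (c i)) := rfl
  rw [e, map_sum, LinearMap.sum_apply, LinearMap.sum_apply]
  simp only [mulVec, dotProduct, Finset.mul_sum, ← Finset.sum_sub_distrib]
  constructor <;> refine Finset.sum_congr rfl fun i _ => ?_
  · simp only [map_add, _root_.map_smul, LinearMap.add_apply, LinearMap.smul_apply, hc.g1, hc.g3 h, smul_eq_mul, E8_symm j i]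
    ring
  · simp only [map_add, _root_.map_smul, LinearMap.add_apply, LinearMap.smul_apply, hc.g2, h.iso, hc.g1, smul_eq_mul, E8_symm j i]
    ring

lemma CB.psi_inS (h : DV B φ V) {c : Fin 8 → Λ} (hc : CB B φ V c) (z : (Fin 8 → ℤ) × (Fin 8 → ℤ)) : InS φ (Psi φ c z) := by
  have e : Psi φ c z = ∑ i, (z.1 i • c i + z.2 i • φ (c i)) := rfl
  rw [e]
  apply Finset.sum_induction _ (InS φ) (fun _ _ => InS.add)
  · simp [InS]
  · intro i _
    have := h.inS (hc.mem i)
    exact (this.smul _).add (this.phi.smul _)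

lemma CB.psi_inj (h : DV B φ V) {c : Fin 8 → Λ} (hc : CB B φ V c) : Function.Injective (Psi φ c) := by
  rw [injective_iff_map_eq_zero]
  intro z hz
  have k := hc.psi_c h z
  rw [hz] at k
  have a1 : E8M *ᵥ z.1 = 0 := by
    funext j
    have := k j
    simp only [map_zero, LinearMap.zero_apply] at this
    rw [Pi.zero_apply]; omega
  have a2 : E8M *ᵥ z.2 = 0 := by
    funext j
    have := k j
    simp only [map_zero, LinearMap.zero_apply] at this
    rw [Pi.zero_apply]; omega
  have b : ∀ y : Fin 8 → ℤ, E8M *ᵥ y = 0 → y = 0 := by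
    intro y hy
    have := congrArg (fun t => E8I *ᵥ t) hy
    simpa [mulVec_mulVec, E8_inv'] using this
  exact Prod.ext (b _ a1) (b _ a2)

lemma CB.psi_surj (h : DV B φ V) {c : Fin 8 → Λ} (hc : CB B φ V c) {s : Λ} (hs : InS φ s) : ∃ z, Psi φ c z = s := by
  refine ⟨(E8I *ᵥ (fun j => al B φ s (c j)), E8I *ᵥ (fun j => be B φ s (c j))), ?_⟩
  symm
  rw [← sub_eq_zero]
  apply hc.zero _ (hs.sub (hc.psi_inS h _))
  intro j
  obtain ⟨k1, k2⟩ := hc.psi_c h (E8I *ᵥ (fun j => al B φ s (c j)), E8I *ᵥ (fun j => be B φ s (c j))) j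
  simp only [mulVec_mulVec, E8_inv, one_mulVec] at k1 k2
  obtain ⟨l1, l2, _⟩ := h.ab hs (hc.mem j)
  rw [map_sub, LinearMap.sub_apply, LinearMap.sub_apply]
  omega

lemma CB.psi_B (h : DV B φ V) {c : Fin 8 → Λ} (hc : CB B φ V c) (z z' : (Fin 8 → ℤ) × (Fin 8 → ℤ)) :
    B (Psi φ c z) (Psi φ c z') = - bE83 (Tht z) (Tht z') := by
  rw [bE83_Tht, neg_neg]
  have e : Psi φ c z' = ∑ i, (z'.1 i • c i + z'.2 i • φ (c i)) := rfl
  rw [e, map_sum]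
  simp only [map_add, _root_.map_smul, (hc.psi_c h z _).1, (hc.psi_c h z _).2, smul_eq_mul]
  simp only [dotProduct, Finset.mul_sum, ← Finset.sum_sub_distrib, ← Finset.sum_add_distrib]
  refine Finset.sum_congr rfl fun i _ => ?_
  ring

end PartK

section PartL

variable {Λ : Type*} [AddCommGroup Λ] [Module.Free ℤ Λ] [Module.Finite ℤ Λ]
    {B : Λ →ₗ[ℤ] Λ →ₗ[ℤ] ℤ} {φ : Λ →ₗ[ℤ] Λ}

lemma L3.top (h : L3 Λ B φ) (hd : finrank ℤ (Sf φ) = 24) : Sf φ = ⊤ := by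
  have q := Submodule.finrank_quotient_add_finrank (Sf φ)
  rw [hd, h.ll.rank] at q
  have q0 : finrank ℤ (Λ ⧸ Sf φ) = 0 := by omega
  rw [Module.finrank_eq_zero_iff] at q0
  rw [eq_top_iff]
  intro x _
  obtain ⟨a, ha, hx⟩ := q0 (Submodule.Quotient.mk x)
  rw [← Submodule.Quotient.mk_smul, Submodule.Quotient.mk_eq_zero, mem_Sf] at hx
  rw [mem_Sf]
  simp only [_root_.map_smul, ← smul_add] at hx
  exact (smul_eq_zero.1 hx).resolve_left ha

lemma L3.iso16 (h : L3 Λ B φ) (hd : finrank ℤ (Sf φ) = 16) :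
    ∃ e : ↥(Sf φ) ≃ₗ[ℤ] ↥S3exo, ∀ x y : ↥(Sf φ), B (x : Λ) (y : Λ) = - bE83 (e x : E83) (e y : E83) := by
  classical
  have dv := h.dv hd
  obtain ⟨c, hc⟩ := dv.exists_c
  have hr : LinearMap.range (Psi φ c) = Sf φ := by
    ext s
    rw [LinearMap.mem_range, mem_Sf]
    constructor
    · rintro ⟨z, rfl⟩; exact hc.psi_inS dv z
    · exact fun hs => hc.psi_surj dv hs
  let e₁ := (LinearEquiv.ofInjective (Psi φ c) (hc.psi_inj dv)).trans (LinearEquiv.ofEq _ _ hr)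
  let e₂ := (LinearEquiv.ofInjective Tht Tht_inj).trans (LinearEquiv.ofEq _ _ Tht_range)
  refine ⟨e₁.symm.trans e₂, fun x y => ?_⟩
  obtain ⟨z, rfl⟩ := e₁.surjective x
  obtain ⟨z', rfl⟩ := e₁.surjective y
  have s : ∀ z, (e₁.symm.trans e₂) (e₁ z) = e₂ z := fun z => congrArg e₂ (e₁.symm_apply_apply z)
  rw [s, s]
  exact hc.psi_B dv z z'

end PartL

/-- the coinvariant lattice of an order-3 isometry of the Leech lattice
has rank 12, 16, 18 or 24; in the rank 16 case it is isometric to `S_{3.exo}` and in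
the rank 24 case it is the whole Leech lattice. -/
theorem stmt11
    (Λ : Type*) [AddCommGroup Λ] [Module.Free ℤ Λ] [Module.Finite ℤ Λ]
    (bΛ : Λ →ₗ[ℤ] Λ →ₗ[ℤ] ℤ)
    (hsymm : ∀ x y : Λ, bΛ x y = bΛ y x)
    (heven : ∀ x : Λ, Even (bΛ x x))
    (hneg : ∀ x : Λ, x ≠ 0 → bΛ x x < 0)
    (hrank : finrank ℤ Λ = 24)
    (hunimodular : Function.Bijective bΛ)
    (hnoroot : ∀ x : Λ, bΛ x x ≠ -2)
    (φ : Λ ≃ₗ[ℤ] Λ)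
    (hiso : ∀ x y : Λ, bΛ (φ x) (φ y) = bΛ x y)
    (hord : orderOf φ = 3) :
    (finrank ℤ (orthSub bΛ (fixSub φ)) = 12 ∨
     finrank ℤ (orthSub bΛ (fixSub φ)) = 16 ∨
     finrank ℤ (orthSub bΛ (fixSub φ)) = 18 ∨
     finrank ℤ (orthSub bΛ (fixSub φ)) = 24) ∧
    (finrank ℤ (orthSub bΛ (fixSub φ)) = 16 →
      ∃ e : ↥(orthSub bΛ (fixSub φ)) ≃ₗ[ℤ] ↥S3exo,
        ∀ x y : ↥(orthSub bΛ (fixSub φ)),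
          bΛ (x : Λ) (y : Λ) = bE83 (e x : E83) (e y : E83)) ∧
    (finrank ℤ (orthSub bΛ (fixSub φ)) = 24 →
      orthSub bΛ (fixSub φ) = ⊤) := by
  have cube : ∀ x, φ (φ (φ x)) = x := by
    intro x
    have := pow_orderOf_eq_one φ
    rw [hord] at this
    have := congrArg (fun f : Λ ≃ₗ[ℤ] Λ => f x) this
    simpa [pow_succ] using this
  have ll : LL Λ (-bΛ) := by
    refine ⟨fun x y => ?_, fun x => ?_, fun x hx => ?_, hrank, ⟨?_, ?_⟩, fun x => ?_⟩
    · simp [hsymm x y]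
    · simpa using heven x
    · have := hneg x hx
      simp only [LinearMap.neg_apply]; omega
    · intro x y e
      exact hunimodular.1 (neg_injective e)
    · intro f
      obtain ⟨x, hx⟩ := hunimodular.2 (-f)
      exact ⟨x, by rw [LinearMap.neg_apply, hx, neg_neg]⟩
    · have := hnoroot x
      simp only [LinearMap.neg_apply]; omega
  have h3 : L3 Λ (-bΛ) φ.toLinearMap := by
    refine ⟨ll, fun x y => ?_, cube, ?_⟩
    · simp [hiso]
    · by_contra hcon
      push Not at hcon
      have : φ = 1 := LinearEquiv.ext hcon
      rw [this, orderOf_one] at hord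
      omega
  have hS : orthSub bΛ (fixSub φ) = Sf φ.toLinearMap := by
    have mF : ∀ y, y ∈ fixSub φ ↔ φ y = y := by
      intro y
      rw [fixSub, LinearMap.mem_ker, LinearMap.sub_apply, sub_eq_zero]; rfl
    have mO : ∀ x, x ∈ orthSub bΛ (fixSub φ) ↔ ∀ y ∈ fixSub φ, bΛ x y = 0 := fun x => Iff.rfl
    have i1 : ∀ x y, bΛ (φ x) y = bΛ x (φ (φ y)) := fun x y => by
      rw [← hiso x (φ (φ y)), cube]
    have i2 : ∀ x y, bΛ (φ (φ x)) y = bΛ x (φ y) := fun x y => by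
      rw [i1, i1, cube]
    ext x
    rw [mO, mem_Sf]
    simp only [LinearEquiv.coe_coe]
    constructor
    · intro hx
      apply hunimodular.1
      ext y
      have := hx (y + φ y + φ (φ y)) ((mF _).2 (by simp only [map_add, cube]; abel))
      simp only [map_add, LinearMap.add_apply, i1, i2, cube, map_zero, LinearMap.zero_apply] at this ⊢
      omega
    · intro hx y hy
      rw [mF] at hy
      have := congrArg (fun t => bΛ t y) hx
      simp only [map_add, LinearMap.add_apply, i1, i2, hy, map_zero, LinearMap.zero_apply] at this
      omega
  rw [hS]
  refine ⟨h3.rank_cases, fun hd => ?_, h3.top⟩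
  obtain ⟨e, he⟩ := h3.iso16 hd
  refine ⟨e, fun x y => ?_⟩
  have := he x y
  simp only [LinearMap.neg_apply] at this
  omega
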